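/- arXiv:0909.0717 — 2 statements merged into one kernel-verified Lean document; each statement's English description precedes it below -/
import Mathlib

section
/- There exist absolute constants C > 0 and ε₀ ∈ (0,1) with the following property. For every nonempty finite set P of n points in ℝ³ and all parameters 0 < ε < ε₀ and 0 < p < 1, there exists a nonempty subset Z ⊆ P with |Z| ≤ C·(1/(ε^{3/2}·p))·log^{3/2}(2/(ε·p)) such that for every closed halfspace h in ℝ³ with X̄(h,P) ≤ p, one has |X̄(h,Z) − X̄(h,P)| ≤ ε·p. -/
/-- The measure of a set `h` in a finite point set `Z ⊆ ℝ³`: `|Z ∩ h| / |Z|`. -/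
noncomputable def meas3 (h : Set (ℝ × ℝ × ℝ)) (Z : Finset (ℝ × ℝ × ℝ)) : ℝ :=
  (((↑Z : Set (ℝ × ℝ × ℝ)) ∩ h).ncard : ℝ) / (Z.card : ℝ)

section Helpers
open Finset Filter Topology

/-- Value at `y` of the linear form on `ℝ⁴` with coefficient vector `f`. -/
def affEval (f y : Fin 4 → ℝ) : ℝ := f 0 * y 0 + f 1 * y 1 + f 2 * y 2 + f 3 * y 3

lemma affEval_add_smul (f y d : Fin 4 → ℝ) (t : ℝ) :
    affEval f (y + t • d) = affEval f y + t * affEval f d := by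
  simp [affEval]; ring

lemma affEval_smul_add_smul (f y z : Fin 4 → ℝ) (s t : ℝ) :
    affEval f (s • y + t • z) = s * affEval f y + t * affEval f z := by
  simp [affEval]; ring

lemma exists_unrealized_pattern {ι Y : Type*} [DecidableEq ι] (B : Finset ι) (l : ι → ℝ) (c : ℝ)
    (g : ι → Y → ℝ) (D : Set Y) (h : ∀ y ∈ D, ∑ i ∈ B, l i * g i y = c)
    (hne : ∃ i ∈ B, l i ≠ 0) :
    ∃ T ⊆ B, ∀ y ∈ D, ¬ ∀ i ∈ B, (0 ≤ g i y ↔ i ∈ T) := by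
  wlog hc : c ≤ 0 generalizing l c
  · refine this (fun i => - l i) (-c) ?_ ?_ (by linarith)
    · intro y hy; simp [h y hy]
    · simpa using hne
  obtain ⟨i, hi, hli⟩ := hne
  by_cases hneg : c < 0 ∨ l i < 0
  · refine ⟨B.filter (fun j => 0 ≤ l j), filter_subset _ _, fun y hy hp => ?_⟩
    have hnn : ∀ j ∈ B, 0 ≤ l j * g j y := by
      intro j hj
      have := hp j hj
      simp only [mem_filter, hj, true_and] at this
      by_cases h0 : 0 ≤ l j
      · exact mul_nonneg h0 (this.2 h0)
      · have : g j y < 0 := by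
          by_contra h1; exact h0 (this.1 (not_lt.1 h1))
        nlinarith
    rcases hneg with hneg | hneg
    · have := Finset.sum_nonneg hnn
      rw [h y hy] at this; linarith
    · have : 0 < ∑ j ∈ B, l j * g j y := by
        refine Finset.sum_pos' hnn ⟨i, hi, ?_⟩
        have h1 := hp i hi
        simp only [mem_filter, hi, true_and] at h1
        have : g i y < 0 := by
          by_contra h2; exact absurd (h1.1 (not_lt.1 h2)) (not_le.2 hneg)
        nlinarith
      rw [h y hy] at this; linarith
  · push Not at hneg
    have hpos : 0 < l i := lt_of_le_of_ne hneg.2 (Ne.symm hli)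
    refine ⟨B.filter (fun j => l j < 0), filter_subset _ _, fun y hy hp => ?_⟩
    have hnn : ∀ j ∈ B, 0 ≤ -(l j * g j y) := by
      intro j hj
      have := hp j hj
      simp only [mem_filter, hj, true_and] at this
      by_cases h0 : l j < 0
      · have := this.2 h0
        nlinarith
      · have : g j y < 0 := by
          by_contra h1; exact h0 (this.1 (not_lt.1 h1))
        nlinarith
    have : 0 < ∑ j ∈ B, -(l j * g j y) := by
      refine Finset.sum_pos' hnn ⟨i, hi, ?_⟩
      have h1 := hp i hi
      simp only [mem_filter, hi, true_and] at h1
      have : g i y < 0 := by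
        by_contra h2; exact absurd (h1.1 (not_lt.1 h2)) (not_lt.2 hpos.le)
      nlinarith
    rw [sum_neg_distrib, h y hy] at this
    linarith

lemma exists_relation {ι : Type*} (B : Finset ι) (n : ℕ) (v : ι → Fin n → ℝ) (h : n < #B) :
    ∃ l : ι → ℝ, (∃ i ∈ B, l i ≠ 0) ∧ ∀ k, ∑ i ∈ B, l i * v i k = 0 := by
  classical
  let L : (B → ℝ) →ₗ[ℝ] (Fin n → ℝ) := Fintype.linearCombination ℝ (fun i : B => v i)
  have hk : LinearMap.ker L ≠ ⊥ := LinearMap.ker_ne_bot_of_finrank_lt (by simpa using h)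
  obtain ⟨x, hx, hx0⟩ := (Submodule.ne_bot_iff _).1 hk
  obtain ⟨i, hi⟩ := Function.ne_iff.1 hx0
  refine ⟨fun i => if h : i ∈ B then x ⟨i, h⟩ else 0, ⟨i, i.2, by simpa using hi⟩, fun k => ?_⟩
  have := congrFun (LinearMap.mem_ker.1 hx) k
  simp only [L, Fintype.linearCombination_apply, Finset.sum_apply, Pi.smul_apply, smul_eq_mul,
    Pi.zero_apply] at this
  rw [← Finset.sum_coe_sort, ← this]
  simp

/-- No four affine halfspaces in `ℝ³` are in general sign position. -/
lemma not_shattered_by_points {ι : Type*} [DecidableEq ι] (B : Finset ι) (f : ι → Fin 4 → ℝ)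
    (hB : 3 < #B) :
    ∃ T ⊆ B, ∀ y : Fin 4 → ℝ, y 0 = 1 → ¬ ∀ i ∈ B, (0 ≤ affEval (f i) y ↔ i ∈ T) := by
  obtain ⟨l, hl, hr⟩ := exists_relation B 3 (fun i k => f i k.succ) hB
  refine exists_unrealized_pattern B l (∑ i ∈ B, l i * f i 0) (fun i y => affEval (f i) y)
    {y | y 0 = 1} ?_ hl
  intro y hy
  have h0 := hr 0
  have h1 := hr 1
  have h2 := hr 2
  simp only [Fin.succ_zero_eq_one, Fin.succ_one_eq_two, show Fin.succ (2 : Fin 3) = 3 from rfl] at h0 h1 h2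
  have : ∀ i ∈ B, l i * affEval (f i) y =
      l i * f i 0 + (l i * f i 1 * y 1 + l i * f i 2 * y 2 + l i * f i 3 * y 3) := by
    intro i _
    simp only [Set.mem_ofPred_eq] at hy
    rw [affEval, hy]; ring
  rw [sum_congr rfl this, sum_add_distrib, sum_add_distrib, sum_add_distrib, ← sum_mul, ← sum_mul,
    ← sum_mul, h0, h1, h2]
  ring

/-- No five points are shattered by halfspaces in `ℝ³`. -/
lemma not_shattered_by_halfspaces {ι : Type*} [DecidableEq ι] (B : Finset ι) (y : ι → Fin 4 → ℝ)
    (hB : 4 < #B) :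
    ∃ T ⊆ B, ∀ f : Fin 4 → ℝ, ¬ ∀ i ∈ B, (0 ≤ affEval f (y i) ↔ i ∈ T) := by
  obtain ⟨l, hl, hr⟩ := exists_relation B 4 y hB
  suffices h : ∀ f ∈ Set.univ, ∑ i ∈ B, l i * affEval f (y i) = 0 by
    obtain ⟨T, hT, h⟩ := exists_unrealized_pattern B l 0 (fun i f => affEval f (y i)) _ h hl
    exact ⟨T, hT, fun f => h f trivial⟩
  intro f _
  have : ∀ i ∈ B, l i * affEval f (y i) =
      l i * y i 0 * f 0 + l i * y i 1 * f 1 + l i * y i 2 * f 2 + l i * y i 3 * f 3 := by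
    intro i _
    rw [affEval]; ring
  rw [sum_congr rfl this, sum_add_distrib, sum_add_distrib, sum_add_distrib, ← sum_mul, ← sum_mul,
    ← sum_mul, ← sum_mul, hr, hr, hr, hr]
  simp

lemma finite_det_add_smul_eq_zero {n : ℕ} (A B : Matrix (Fin n) (Fin n) ℝ) (hB : B.det ≠ 0) :
    {t : ℝ | (A + t • B).det = 0}.Finite := by
  set p : Polynomial ℝ :=
    ((Polynomial.X : Polynomial ℝ) • B.map Polynomial.C + A.map Polynomial.C).det with hp
  have hp0 : p ≠ 0 := by
    intro h0
    have := Polynomial.coeff_det_X_add_C_card B A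
    rw [← hp, h0] at this
    exact hB (by simpa using this.symm)
  refine (p.roots.toFinset.finite_toSet).subset ?_
  intro t ht
  simp only [Set.mem_ofPred_eq] at ht
  simp only [mem_coe, Multiset.mem_toFinset, Polynomial.mem_roots hp0, Polynomial.IsRoot.def]
  rw [← ht, hp, ← Polynomial.coe_evalRingHom, RingHom.map_det]
  congr 1
  ext i j
  simp
  ring

/-- Every square matrix of consecutive columns of a family of perturbed coefficient vectors is
nonsingular, for all but finitely many perturbation parameters. -/
lemma eventually_det_ne_zero {N n : ℕ} (f : Fin N → Fin 4 → ℝ) (s : Fin N → ℝ)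
    (hs : Function.Injective s) (hs0 : ∀ i, s i ≠ 0) (col : Fin n → Fin 4) (off : ℕ)
    (hcol : ∀ c, (col c : ℕ) = c + off) :
    ∀ᶠ t in 𝓝[>] (0 : ℝ), ∀ i : Fin n → Fin N, Function.Injective i →
      (Matrix.of fun r c => f (i r) (col c) + t * s (i r) ^ (col c : ℕ)).det ≠ 0 := by
  rw [eventually_all]
  intro i
  by_cases hi : Function.Injective i
  swap
  · exact Eventually.of_forall fun t h => absurd h hi
  have hB : (Matrix.of fun r c => s (i r) ^ (col c : ℕ) : Matrix (Fin n) (Fin n) ℝ).det ≠ 0 := by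
    have : (Matrix.of fun r c => s (i r) ^ (col c : ℕ) : Matrix (Fin n) (Fin n) ℝ) =
        Matrix.of fun r c => s (i r) ^ off * Matrix.vandermonde (s ∘ i) r c := by
      ext r c
      simp [hcol, Matrix.vandermonde_apply, pow_add, mul_comm]
    rw [this, Matrix.det_mul_column]
    refine mul_ne_zero (prod_ne_zero_iff.2 fun r _ => pow_ne_zero _ (hs0 _)) ?_
    exact Matrix.det_vandermonde_ne_zero_iff.2 (hs.comp hi)
  have hfin := finite_det_add_smul_eq_zero (Matrix.of fun r c => f (i r) (col c)) _ hB
  have h1 : ∀ᶠ t in 𝓝[≠] (0 : ℝ), t ∉ {t : ℝ | ((Matrix.of fun r c => f (i r) (col c)) +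
      t • (Matrix.of fun r c => s (i r) ^ (col c : ℕ))).det = 0} :=
    nhdsNE_le_cofinite _ hfin.compl_mem_cofinite
  filter_upwards [h1.filter_mono (nhdsGT_le_nhdsNE 0)] with t ht _
  convert ht using 1
  rfl

/-- General position for a family of affine functions on `ℝ³`. -/
structure GeneralPosition {N : ℕ} (f : Fin N → Fin 4 → ℝ) : Prop where
  det_four : ∀ i : Fin 4 → Fin N, Function.Injective i →
    (Matrix.of fun r c => f (i r) c).det ≠ 0
  det_three : ∀ i : Fin 3 → Fin N, Function.Injective i →
    (Matrix.of fun r (c : Fin 3) => f (i r) c.succ).det ≠ 0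
  det_two : ∀ i j, i ≠ j → f i 1 * f j 2 - f i 2 * f j 1 ≠ 0

lemma exists_generalPosition {N : ℕ} (f : Fin N → Fin 4 → ℝ) (X : Finset (Fin 4 → ℝ))
    (hX : ∀ y ∈ X, y 0 = 1) :
    ∃ g : Fin N → Fin 4 → ℝ, GeneralPosition g ∧
      ∀ y ∈ X, ∀ i, (0 ≤ affEval (g i) y ↔ 0 ≤ affEval (f i) y) := by
  obtain ⟨u, hu, hu0⟩ : ∃ u : ℝ, (∀ y ∈ X, ∀ i : Fin N,
      0 < affEval (fun k => (u * (i + 1)) ^ (k : ℕ)) y) ∧ 0 < u := by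
    have h1 : ∀ᶠ u in 𝓝[>] (0 : ℝ), ∀ y ∈ X, ∀ i : Fin N,
        0 < affEval (fun k => (u * (i + 1)) ^ (k : ℕ)) y := by
      rw [Finset.eventually_all]
      intro y hy
      rw [eventually_all]
      intro i
      have hc : Continuous fun u : ℝ => affEval (fun k => (u * ((i : ℕ) + 1)) ^ (k : ℕ)) y := by
        unfold affEval; fun_prop
      have h0 : 0 < affEval (fun k => ((0 : ℝ) * ((i : ℕ) + 1)) ^ (k : ℕ)) y := by
        simp [affEval, hX y hy]
      exact (hc.continuousAt.eventually (lt_mem_nhds h0)).filter_mono nhdsWithin_le_nhds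
    exact (h1.and self_mem_nhdsWithin).exists
  set s : Fin N → ℝ := fun i => u * (i + 1) with hs
  have hsinj : Function.Injective s := by
    intro i j hij
    simp only [hs] at hij
    have := mul_left_cancel₀ hu0.ne' hij
    exact Fin.ext (by exact_mod_cast add_right_cancel this)
  have hs0 : ∀ i, s i ≠ 0 := fun i => by simp only [hs]; positivity
  have hneg : ∀ᶠ t in 𝓝[>] (0 : ℝ), ∀ y ∈ X, ∀ i, affEval (f i) y < 0 →
      affEval (fun k => f i k + t * s i ^ (k : ℕ)) y < 0 := by
    rw [Finset.eventually_all]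
    intro y hy
    rw [eventually_all]
    intro i
    by_cases h : affEval (f i) y < 0
    swap
    · exact Eventually.of_forall fun t h' => absurd h' h
    have hc : Continuous fun t : ℝ => affEval (fun k => f i k + t * s i ^ (k : ℕ)) y := by
      unfold affEval; fun_prop
    have h0 : affEval (fun k => f i k + (0 : ℝ) * s i ^ (k : ℕ)) y < 0 := by simpa using h
    filter_upwards [(hc.continuousAt.eventually (gt_mem_nhds h0)).filter_mono nhdsWithin_le_nhds]
      with t ht _ using ht
  obtain ⟨t, hn, h4, h3, h2, ht⟩ := (hneg.and
    ((eventually_det_ne_zero f s hsinj hs0 (id : Fin 4 → Fin 4) 0 (by simp)).and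
    ((eventually_det_ne_zero f s hsinj hs0 (Fin.succ : Fin 3 → Fin 4) 1 (by simp)).and
    ((eventually_det_ne_zero f s hsinj hs0 (![1, 2] : Fin 2 → Fin 4) 1
      (by intro c; fin_cases c <;> rfl)).and self_mem_nhdsWithin)))).exists
  replace ht : 0 < t := ht
  refine ⟨fun i k => f i k + t * s i ^ (k : ℕ), ⟨h4, h3, ?_⟩, ?_⟩
  · intro i j hij
    have := h2 ![i, j] (by
      intro a b hab
      fin_cases a <;> fin_cases b <;> simp_all)
    rw [Matrix.det_fin_two] at this
    simpa using this
  · intro y hy i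
    constructor
    · intro h
      by_contra h'
      exact absurd (hn y hy i (not_le.1 h')) (not_lt.2 h)
    · intro h
      have h1 := hu y hy i
      have : affEval (fun k => f i k + t * s i ^ (k : ℕ)) y =
          affEval (f i) y + t * affEval (fun k => (u * (i + 1)) ^ (k : ℕ)) y := by
        simp only [affEval, hs]; ring
      rw [this]; positivity

/-- The four sign patterns on `{i, j}` are realized by points outside all other halfspaces of `A`. -/
def IsEdge {N : ℕ} (f : Fin N → Fin 4 → ℝ) (A : Finset (Fin N)) (i j : Fin N) : Prop :=
  i ∈ A ∧ j ∈ A ∧ i ≠ j ∧ ∀ T ⊆ ({i, j} : Finset (Fin N)), ∃ y : Fin 4 → ℝ, y 0 = 1 ∧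
    ∀ l ∈ A, (0 ≤ affEval (f l) y ↔ l ∈ T)

/-- `τ` is the set of tight constraints at a vertex of the polyhedron cut out by `A`. -/
def IsVertex {N : ℕ} (f : Fin N → Fin 4 → ℝ) (A τ : Finset (Fin N)) (v : Fin 4 → ℝ) : Prop :=
  v 0 = 1 ∧ (∀ l ∈ τ, affEval (f l) v = 0) ∧ ∀ l ∈ A, l ∉ τ → affEval (f l) v < 0

lemma exists_zero_between {N : ℕ} (f : Fin N → Fin 4 → ℝ) (i : Fin N) {y z : Fin 4 → ℝ}
    (hy : 0 ≤ affEval (f i) y) (hz : affEval (f i) z < 0) :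
    ∃ s t : ℝ, 0 < s ∧ 0 ≤ t ∧ s + t = 1 ∧ affEval (f i) (s • y + t • z) = 0 := by
  refine ⟨-affEval (f i) z / (affEval (f i) y - affEval (f i) z),
    affEval (f i) y / (affEval (f i) y - affEval (f i) z), ?_, ?_, ?_, ?_⟩
  · apply div_pos <;> linarith
  · apply div_nonneg <;> linarith
  · have : affEval (f i) y - affEval (f i) z ≠ 0 := by linarith
    field_simp; ring
  · have : affEval (f i) y - affEval (f i) z ≠ 0 := by linarith
    rw [affEval_smul_add_smul]; field_simp; ring

lemma IsEdge.exists_point {N : ℕ} {f : Fin N → Fin 4 → ℝ} {A : Finset (Fin N)} {i j : Fin N}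
    (h : IsEdge f A i j) :
    ∃ z, IsVertex f A {i, j} z := by
  obtain ⟨hi, hj, hij, h⟩ := h
  obtain ⟨y2, h20, h2⟩ := h {i, j} subset_rfl
  obtain ⟨yi, hi0, hyi⟩ := h {i} (by simp)
  obtain ⟨yj, hj0, hyj⟩ := h {j} (by simp)
  obtain ⟨y0, h00, h0⟩ := h ∅ (by simp)
  have neg : ∀ {T : Finset (Fin N)} {y : Fin 4 → ℝ}, (∀ l ∈ A, (0 ≤ affEval (f l) y ↔ l ∈ T)) →
      ∀ l ∈ A, l ∉ T → affEval (f l) y < 0 := by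
    intro T y h l hl hT
    by_contra h'
    exact hT ((h l hl).1 (not_lt.1 h'))
  obtain ⟨s, t, hs, ht, hst, hz1⟩ := exists_zero_between f i ((h2 i hi).2 (by simp))
    (neg hyj i hi (by simpa using hij))
  obtain ⟨s', t', hs', ht', hst', hz2⟩ := exists_zero_between f i ((hyi i hi).2 (by simp))
    (neg h0 i hi (by simp))
  have comb : ∀ {s t a b : ℝ}, 0 < s → 0 ≤ t → s + t = 1 → a < 0 → b < 0 → s * a + t * b < 0 := by
    intro s t a b hs ht _ ha hb
    have := mul_neg_of_pos_of_neg hs ha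
    have := mul_nonpos_of_nonneg_of_nonpos ht hb.le
    linarith
  have hj1 : 0 ≤ affEval (f j) (s • y2 + t • yj) := by
    rw [affEval_smul_add_smul]
    have := (h2 j hj).2 (by simp)
    have := (hyj j hj).2 (by simp)
    positivity
  have hj2 : affEval (f j) (s' • yi + t' • y0) < 0 := by
    rw [affEval_smul_add_smul]
    exact comb hs' ht' hst' (neg hyi j hj (by simpa using hij.symm)) (neg h0 j hj (by simp))
  obtain ⟨a, b, ha, hb, hab, hz⟩ := exists_zero_between f j hj1 hj2
  refine ⟨a • (s • y2 + t • yj) + b • (s' • yi + t' • y0), ?_, ?_, ?_⟩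
  · simp only [Pi.add_apply, Pi.smul_apply, smul_eq_mul, h20, hi0, hj0, h00, mul_one, hst, hst', hab]
  · intro l hl
    simp only [mem_insert, mem_singleton] at hl
    rcases hl with rfl | rfl
    · rw [affEval_smul_add_smul, hz1, hz2]; simp
    · exact hz
  · intro l hl hl'
    simp only [mem_insert, mem_singleton, not_or] at hl'
    rw [affEval_smul_add_smul]
    apply comb ha hb hab
    · rw [affEval_smul_add_smul]
      exact comb hs ht hst (neg h2 l hl (by simp [hl'])) (neg hyj l hl (by simp [hl']))
    · rw [affEval_smul_add_smul]
      exact comb hs' ht' hst' (neg hyi l hl (by simp [hl'])) (neg h0 l hl (by simp))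

lemma GeneralPosition.direction {N : ℕ} {f : Fin N → Fin 4 → ℝ} (hf : GeneralPosition f)
    {i j k : Fin N} (hij : i ≠ j) (hik : k ≠ i) (hjk : k ≠ j) :
    ∃ d : Fin 4 → ℝ, d 0 = 0 ∧ affEval (f i) d = 0 ∧ affEval (f j) d = 0 ∧
      0 < affEval (f k) d := by
  have hinj : Function.Injective ![i, j, k] := by
    intro a b hab
    fin_cases a <;> fin_cases b <;> simp_all
  have h3 := hf.det_three _ hinj
  rw [Matrix.det_fin_three] at h3
  simp only [Matrix.of_apply, Matrix.cons_val_zero, Matrix.cons_val_one, Matrix.cons_val,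
    Fin.succ_zero_eq_one, Fin.succ_one_eq_two, show Fin.succ (2 : Fin 3) = 3 from rfl] at h3
  set D : ℝ := _ with hD
  change D ≠ 0 at h3
  refine ⟨D • ![0, f i 2 * f j 3 - f i 3 * f j 2, f i 3 * f j 1 - f i 1 * f j 3,
    f i 1 * f j 2 - f i 2 * f j 1], by simp, ?_, ?_, ?_⟩
  · simp [affEval]; ring
  · simp [affEval]; ring
  · have : affEval (f k) (D • ![0, f i 2 * f j 3 - f i 3 * f j 2, f i 3 * f j 1 - f i 1 * f j 3,
      f i 1 * f j 2 - f i 2 * f j 1]) = D ^ 2 := by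
      simp only [affEval, Pi.smul_apply, smul_eq_mul, Matrix.cons_val_zero, Matrix.cons_val_one,
        Matrix.cons_val]
      rw [hD]; ring
    rw [this]; positivity

lemma GeneralPosition.no_four_zeros {N : ℕ} {f : Fin N → Fin 4 → ℝ} (hf : GeneralPosition f)
    (i : Fin 4 → Fin N) (hi : Function.Injective i) {v : Fin 4 → ℝ} (hv : v 0 = 1)
    (h : ∀ r, affEval (f (i r)) v = 0) : False := by
  refine hf.det_four i hi (Matrix.exists_mulVec_eq_zero_iff.1 ⟨v, ?_, ?_⟩)
  · intro h0
    simp [h0] at hv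
  · ext r
    have := h r
    simpa [Matrix.mulVec, dotProduct, Fin.sum_univ_four, affEval] using this

/-- In general position an edge has an endpoint. -/
lemma IsEdge.exists_vertex {N : ℕ} {f : Fin N → Fin 4 → ℝ} (hf : GeneralPosition f)
    {A : Finset (Fin N)} {i j : Fin N} (h : IsEdge f A i j) (hA : 2 < #A) :
    ∃ k ∈ A, k ≠ i ∧ k ≠ j ∧ ∃ v, IsVertex f A {i, j, k} v := by
  obtain ⟨z, hz0, hz, hneg⟩ := h.exists_point
  obtain ⟨hi, hj, hij, -⟩ := h
  obtain ⟨k, hk, hkij⟩ : ∃ k ∈ A, k ∉ ({i, j} : Finset (Fin N)) :=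
    exists_mem_notMem_of_card_lt_card (lt_of_le_of_lt card_le_two hA)
  simp only [mem_insert, mem_singleton, not_or] at hkij
  obtain ⟨d, hd0, hdi, hdj, hdk⟩ := hf.direction hij hkij.1 hkij.2
  set U := A.filter fun l => 0 < affEval (f l) d with hU
  obtain ⟨m, hmU, hm⟩ := exists_min_image U (fun l => -affEval (f l) z / affEval (f l) d)
    ⟨k, by simp [hU, hk, hdk]⟩
  simp only [hU, mem_filter] at hmU hm
  have hmi : m ≠ i := by rintro rfl; linarith [hmU.2]
  have hmj : m ≠ j := by rintro rfl; linarith [hmU.2]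
  set t := -affEval (f m) z / affEval (f m) d with ht
  have hzm := hneg m hmU.1 (by simp [hmi, hmj])
  have ht0 : 0 < t := div_pos (by linarith) hmU.2
  have hiv : affEval (f i) (z + t • d) = 0 := by
    rw [affEval_add_smul, hdi, hz i (by simp)]; simp
  have hjv : affEval (f j) (z + t • d) = 0 := by
    rw [affEval_add_smul, hdj, hz j (by simp)]; simp
  have hmv : affEval (f m) (z + t • d) = 0 := by
    have := hmU.2.ne'
    rw [affEval_add_smul, ht]; field_simp; ring
  have hv0 : (z + t • d) 0 = 1 := by simp [hz0, hd0]
  refine ⟨m, hmU.1, hmi, hmj, z + t • d, hv0, ?_, ?_⟩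
  · intro l hl
    simp only [mem_insert, mem_singleton] at hl
    rcases hl with rfl | rfl | rfl <;> assumption
  · intro l hl hl'
    simp only [mem_insert, mem_singleton, not_or] at hl'
    have hle : affEval (f l) (z + t • d) ≤ 0 := by
      rw [affEval_add_smul]
      have hzl := hneg l hl (by simp [hl'])
      by_cases hld : 0 < affEval (f l) d
      · have := hm l ⟨hl, hld⟩
        rw [le_div_iff₀ hld] at this
        linarith
      · have := mul_nonpos_of_nonneg_of_nonpos ht0.le (not_lt.1 hld)
        linarith
    refine lt_of_le_of_ne hle fun h0 => ?_
    refine hf.no_four_zeros ![i, j, m, l] ?_ hv0 ?_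
    · intro a b hab
      fin_cases a <;> fin_cases b <;> simp_all
    · intro r
      fin_cases r <;> assumption

/-- At a vertex, two of the three coefficients expressing a fixed coordinate through the tight
constraints have the same sign, so the vertex is extreme on one of its facets. -/
lemma GeneralPosition.exists_facet {N : ℕ} {f : Fin N → Fin 4 → ℝ} (hf : GeneralPosition f)
    {A τ : Finset (Fin N)} (hτA : τ ⊆ A) (hτ : #τ = 3) {v : Fin 4 → ℝ} (hv : IsVertex f A τ v) :
    ∃ k ∈ τ, ∃ b : Bool, ∀ y : Fin 4 → ℝ, y 0 = 1 → (∀ l ∈ A, affEval (f l) y ≤ 0) →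
      affEval (f k) y = 0 → (if b then 1 else -1) * y 3 ≤ (if b then 1 else -1) * v 3 →
      ∀ l ∈ τ, affEval (f l) y = 0 := by
  obtain ⟨a, b, c, hab, hac, hbc, rfl⟩ := card_eq_three.1 hτ
  obtain ⟨hv0, hvz, -⟩ := hv
  have hinj : Function.Injective ![a, b, c] := by
    intro a b hab
    fin_cases a <;> fin_cases b <;> simp_all
  have h3 := hf.det_three _ hinj
  set G : Matrix (Fin 3) (Fin 3) ℝ := Matrix.of fun r (c' : Fin 3) => f (![a, b, c] r) c'.succ
    with hG
  have hw : Matrix.vecMul (Matrix.vecMul (![0, 0, 1] : Fin 3 → ℝ) G⁻¹) G = ![0, 0, 1] := by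
    rw [Matrix.vecMul_vecMul, Matrix.nonsing_inv_mul _ (isUnit_iff_ne_zero.2 h3), Matrix.vecMul_one]
  obtain ⟨w, hw⟩ : ∃ w : Fin 3 → ℝ, Matrix.vecMul w G = ![0, 0, 1] := ⟨_, hw⟩
  have e0 : w 0 * f a 1 + w 1 * f b 1 + w 2 * f c 1 = 0 := by
    have := congrFun hw 0
    simpa [hG, Matrix.vecMul, dotProduct, Fin.sum_univ_three] using this
  have e1 : w 0 * f a 2 + w 1 * f b 2 + w 2 * f c 2 = 0 := by
    have := congrFun hw 1
    simpa [hG, Matrix.vecMul, dotProduct, Fin.sum_univ_three] using this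
  have e2 : w 0 * f a 3 + w 1 * f b 3 + w 2 * f c 3 = 1 := by
    have := congrFun hw 2
    simpa [hG, Matrix.vecMul, dotProduct, Fin.sum_univ_three] using this
  have two : ∀ {p q : ℝ} {i j : Fin N}, i ≠ j → p * f i 1 + q * f j 1 = 0 →
      p * f i 2 + q * f j 2 = 0 → p * f i 3 + q * f j 3 = 1 → False := by
    intro p q i j hij h1 h2 h3
    have hd := hf.det_two i j hij
    have hp : p = 0 := by
      have : p * (f i 1 * f j 2 - f i 2 * f j 1) = 0 := by linear_combination f j 2 * h1 - f j 1 * h2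
      simpa [hd] using this
    have hq : q = 0 := by
      have : q * (f i 1 * f j 2 - f i 2 * f j 1) = 0 := by
        linear_combination f i 1 * h2 - f i 2 * h1
      simpa [hd] using this
    simp [hp, hq] at h3
  have w0 : w 0 ≠ 0 := fun h => two hbc (p := w 1) (q := w 2)
    (by rw [h] at e0; linarith) (by rw [h] at e1; linarith) (by rw [h] at e2; linarith)
  have w1 : w 1 ≠ 0 := fun h => two hac (p := w 0) (q := w 2)
    (by rw [h] at e0; linarith) (by rw [h] at e1; linarith) (by rw [h] at e2; linarith)
  have w2 : w 2 ≠ 0 := fun h => two hab (p := w 0) (q := w 1)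
    (by rw [h] at e0; linarith) (by rw [h] at e1; linarith) (by rw [h] at e2; linarith)
  have key : ∀ y : Fin 4 → ℝ, y 0 = 1 →
      y 3 - v 3 = w 0 * affEval (f a) y + w 1 * affEval (f b) y + w 2 * affEval (f c) y := by
    intro y hy
    have za := hvz a (by simp)
    have zb := hvz b (by simp)
    have zc := hvz c (by simp)
    simp only [affEval, hv0, hy] at *
    linear_combination (v 1 - y 1) * e0 + (v 2 - y 2) * e1 + (v 3 - y 3) * e2 -
      w 0 * za - w 1 * zb - w 2 * zc
  have fin : ∀ {p q : ℝ} {i j k : Fin N}, 0 < p * q → i ∈ A → j ∈ A →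
      (∀ y : Fin 4 → ℝ, y 0 = 1 →
        y 3 - v 3 = p * affEval (f i) y + q * affEval (f j) y + affEval (f k) y * w 0 ∨
        y 3 - v 3 = p * affEval (f i) y + q * affEval (f j) y + affEval (f k) y * w 1 ∨
        y 3 - v 3 = p * affEval (f i) y + q * affEval (f j) y + affEval (f k) y * w 2) →
      ∃ b : Bool, ∀ y : Fin 4 → ℝ, y 0 = 1 → (∀ l ∈ A, affEval (f l) y ≤ 0) →
        affEval (f k) y = 0 → (if b then 1 else -1) * y 3 ≤ (if b then 1 else -1) * v 3 →
        affEval (f i) y = 0 ∧ affEval (f j) y = 0 ∧ affEval (f k) y = 0 := by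
    intro p q i j k hpq hi hj hk
    have hk' : ∀ y : Fin 4 → ℝ, y 0 = 1 → affEval (f k) y = 0 →
        y 3 - v 3 = p * affEval (f i) y + q * affEval (f j) y := by
      intro y hy h0
      simpa [h0] using hk y hy
    rcases pos_and_pos_or_neg_and_neg_of_mul_pos hpq with ⟨hp, hq⟩ | ⟨hp, hq⟩
    · refine ⟨false, fun y hy hK h0 hle => ?_⟩
      have h1 := hk' y hy h0
      have hi' := hK i hi
      have hj' := hK j hj
      simp only [Bool.false_eq_true, if_false] at hle
      have := mul_nonpos_of_nonneg_of_nonpos hp.le hi'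
      have := mul_nonpos_of_nonneg_of_nonpos hq.le hj'
      refine ⟨?_, ?_, h0⟩
      · have : p * affEval (f i) y = 0 := by linarith
        simpa [hp.ne'] using this
      · have : q * affEval (f j) y = 0 := by linarith
        simpa [hq.ne'] using this
    · refine ⟨true, fun y hy hK h0 hle => ?_⟩
      have h1 := hk' y hy h0
      have hi' := hK i hi
      have hj' := hK j hj
      simp only [if_true] at hle
      have := mul_nonneg_of_nonpos_of_nonpos hp.le hi'
      have := mul_nonneg_of_nonpos_of_nonpos hq.le hj'
      refine ⟨?_, ?_, h0⟩
      · have : p * affEval (f i) y = 0 := by linarith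
        simpa [hp.ne] using this
      · have : q * affEval (f j) y = 0 := by linarith
        simpa [hq.ne] using this
  have ha : a ∈ A := hτA (by simp)
  have hb : b ∈ A := hτA (by simp)
  have hc : c ∈ A := hτA (by simp)
  have sgn : 0 < w 0 * w 1 ∨ 0 < w 0 * w 2 ∨ 0 < w 1 * w 2 := by
    rcases lt_or_gt_of_ne w0 with h0 | h0 <;> rcases lt_or_gt_of_ne w1 with h1 | h1 <;>
      rcases lt_or_gt_of_ne w2 with h2 | h2 <;>
      first
      | exact Or.inl (mul_pos h0 h1)
      | exact Or.inl (mul_pos_of_neg_of_neg h0 h1)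
      | exact Or.inr (Or.inl (mul_pos h0 h2))
      | exact Or.inr (Or.inl (mul_pos_of_neg_of_neg h0 h2))
      | exact Or.inr (Or.inr (mul_pos h1 h2))
      | exact Or.inr (Or.inr (mul_pos_of_neg_of_neg h1 h2))
  rcases sgn with h | h | h
  · obtain ⟨s, hs⟩ := fin (k := c) h ha hb
      (fun y hy => Or.inr (Or.inr (by rw [key y hy]; ring)))
    refine ⟨c, by simp, s, fun y hy hK h0 hle l hl => ?_⟩
    obtain ⟨p1, p2, p3⟩ := hs y hy hK h0 hle
    simp only [mem_insert, mem_singleton] at hl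
    rcases hl with rfl | rfl | rfl <;> assumption
  · obtain ⟨s, hs⟩ := fin (k := b) h ha hc
      (fun y hy => Or.inr (Or.inl (by rw [key y hy]; ring)))
    refine ⟨b, by simp, s, fun y hy hK h0 hle l hl => ?_⟩
    obtain ⟨p1, p2, p3⟩ := hs y hy hK h0 hle
    simp only [mem_insert, mem_singleton] at hl
    rcases hl with rfl | rfl | rfl <;> assumption
  · obtain ⟨s, hs⟩ := fin (k := a) h hb hc
      (fun y hy => Or.inl (by rw [key y hy]; ring))
    refine ⟨a, by simp, s, fun y hy hK h0 hle l hl => ?_⟩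
    obtain ⟨p1, p2, p3⟩ := hs y hy hK h0 hle
    simp only [mem_insert, mem_singleton] at hl
    rcases hl with rfl | rfl | rfl <;> assumption

open Classical in
/-- A simple polyhedron with `n` facets has at most `2 * n` vertices. -/
lemma GeneralPosition.card_vertices_le {N : ℕ} {f : Fin N → Fin 4 → ℝ} (hf : GeneralPosition f)
    (A : Finset (Fin N)) :
    #{τ ∈ A.powersetCard 3 | ∃ v, IsVertex f A τ v} ≤ 2 * #A := by
  set V := {τ ∈ A.powersetCard 3 | ∃ v, IsVertex f A τ v} with hV
  have hVm : ∀ τ ∈ V, τ ⊆ A ∧ #τ = 3 ∧ ∃ v, IsVertex f A τ v := by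
    intro τ hτ
    simpa [hV, mem_powersetCard, and_assoc] using hτ
  have : ∀ τ ∈ V, ∃ kb : Fin N × Bool, ∃ v, IsVertex f A τ v ∧ kb.1 ∈ τ ∧
      ∀ y : Fin 4 → ℝ, y 0 = 1 → (∀ l ∈ A, affEval (f l) y ≤ 0) →
        affEval (f kb.1) y = 0 → (if kb.2 then 1 else -1) * y 3 ≤ (if kb.2 then 1 else -1) * v 3 →
        ∀ l ∈ τ, affEval (f l) y = 0 := by
    intro τ hτ
    obtain ⟨h1, h2, v, hv⟩ := hVm τ hτ
    obtain ⟨k, hk, b, h⟩ := hf.exists_facet h1 h2 hv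
    exact ⟨(k, b), v, hv, hk, h⟩
  rcases V.eq_empty_or_nonempty with h0 | ⟨τ₀, hτ₀⟩
  · simp [h0]
  have : Nonempty (Fin N × Bool) := ⟨(this τ₀ hτ₀).choose⟩
  choose! g hg using ‹∀ τ ∈ V, ∃ kb : Fin N × Bool, _›
  have hcard : #(A ×ˢ (univ : Finset Bool)) = 2 * #A := by simp [card_product, mul_comm]
  rw [← hcard]
  refine card_le_card_of_injOn g ?_ ?_
  · intro τ hτ
    obtain ⟨v, -, hk, -⟩ := hg τ hτ
    simp [(hVm τ hτ).1 hk]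
  · have half : ∀ τ ∈ V, ∀ τ' ∈ V, g τ = g τ' → ∀ v v', IsVertex f A τ v → IsVertex f A τ' v' →
        (∀ l ∈ τ, affEval (f l) v' = 0) → τ = τ' := by
      intro τ hτ τ' hτ' _ v v' hv hv' h
      refine eq_of_subset_of_card_le ?_ (by rw [(hVm τ hτ).2.1, (hVm τ' hτ').2.1])
      intro l hl
      by_contra hl'
      exact (hv'.2.2 l ((hVm τ hτ).1 hl) hl').ne (h l hl)
    have inK : ∀ {τ v}, IsVertex f A τ v → ∀ l ∈ A, affEval (f l) v ≤ 0 := by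
      intro τ v hv l hl
      by_cases h : l ∈ τ
      · exact (hv.2.1 l h).le
      · exact (hv.2.2 l hl h).le
    intro τ hτ τ' hτ' heq
    obtain ⟨v, hv, hk, h⟩ := hg τ hτ
    obtain ⟨v', hv', hk', h'⟩ := hg τ' hτ'
    rw [← heq] at hk' h'
    rcases le_total ((if (g τ).2 then 1 else -1) * v' 3) ((if (g τ).2 then 1 else -1) * v 3)
      with hle | hle
    · exact half τ hτ τ' hτ' heq v v' hv hv' (h v' hv'.1 (inK hv') (hv'.2.1 _ hk') hle)
    · exact (half τ' hτ' τ hτ heq.symm v' v hv' hv (h' v hv.1 (inK hv) (hv.2.1 _ hk) hle)).symm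

open Classical in
/-- The edges of an arrangement's base cell: a linear bound. -/
lemma card_edges_le {N : ℕ} (f : Fin N → Fin 4 → ℝ) (A : Finset (Fin N)) :
    #{e ∈ A ×ˢ A | IsEdge f A e.1 e.2} ≤ 18 * #A := by
  rcases le_or_gt #A 2 with hA | hA
  · refine (card_filter_le _ _).trans ?_
    rw [card_product]
    nlinarith
  have : ∀ e : Fin N × Fin N, ∀ T : Finset (Fin N), ∃ y : Fin 4 → ℝ, y 0 = 1 ∧
      (IsEdge f A e.1 e.2 → T ⊆ {e.1, e.2} → ∀ l ∈ A, (0 ≤ affEval (f l) y ↔ l ∈ T)) := by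
    intro e T
    by_cases h : IsEdge f A e.1 e.2 ∧ T ⊆ {e.1, e.2}
    · obtain ⟨y, hy, h'⟩ := h.1.2.2.2 T h.2
      exact ⟨y, hy, fun _ _ => h'⟩
    · exact ⟨fun _ => 1, rfl, fun h1 h2 => absurd ⟨h1, h2⟩ h⟩
  choose y hy0 hy using this
  obtain ⟨g, hg, hgf⟩ := exists_generalPosition f
    (univ.image fun p : (Fin N × Fin N) × Finset (Fin N) => y p.1 p.2) (by
      intro z hz
      obtain ⟨p, -, rfl⟩ := mem_image.1 hz
      exact hy0 _ _)
  have hE : ∀ i j, IsEdge f A i j → IsEdge g A i j := by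
    intro i j h
    refine ⟨h.1, h.2.1, h.2.2.1, fun T hT => ⟨y (i, j) T, hy0 _ _, fun l hl => ?_⟩⟩
    rw [hgf _ (mem_image.2 ⟨((i, j), T), mem_univ _, rfl⟩)]
    exact hy (i, j) T h hT l hl
  set V := {τ ∈ A.powersetCard 3 | ∃ v, IsVertex g A τ v} with hV
  have hsub : {e ∈ A ×ˢ A | IsEdge f A e.1 e.2} ⊆ V.biUnion fun τ => τ ×ˢ τ := by
    rintro ⟨i, j⟩ he
    simp only [mem_filter, mem_product] at he
    have hij := he.2.2.2.1
    obtain ⟨k, hk, hki, hkj, v, hv⟩ := (hE _ _ he.2).exists_vertex hg hA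
    simp only [mem_biUnion]
    refine ⟨{i, j, k}, ?_, by simp⟩
    simp only [hV, mem_filter, mem_powersetCard]
    refine ⟨⟨?_, card_eq_three.2 ⟨i, j, k, hij, hki.symm, hkj.symm, rfl⟩⟩, v, hv⟩
    intro l hl
    simp only [mem_insert, mem_singleton] at hl
    rcases hl with rfl | rfl | rfl
    exacts [he.1.1, he.1.2, hk]
  calc _ ≤ #(V.biUnion fun τ => τ ×ˢ τ) := card_le_card hsub
    _ ≤ #V * 9 := card_biUnion_le_card_mul _ _ _ (by
      intro τ hτ
      simp only [hV, mem_filter, mem_powersetCard] at hτ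
      rw [card_product, hτ.1.2])
    _ ≤ 18 * #A := by
      have := hg.card_vertices_le A
      rw [← hV] at this
      omega

lemma card_lowerSet_le {ι : Type*} [DecidableEq ι] (𝒮 : Finset (Finset ι))
    (hlow : IsLowerSet (𝒮 : Set (Finset ι))) (h3 : ∀ S ∈ 𝒮, #S ≤ 3) (D : ℕ)
    (hD : ∀ A : Finset ι, #{e ∈ A ×ˢ A | e.1 ≠ e.2 ∧ {e.1, e.2} ∈ 𝒮} ≤ D * #A) (A : Finset ι) :
    #{S ∈ 𝒮 | S ⊆ A} ≤ 1 + #A * (D + 1) ^ 2 := by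
  induction hn : #A generalizing A with
  | zero =>
    rw [card_eq_zero] at hn
    subst hn
    simp only [subset_empty, zero_mul, add_zero]
    exact card_le_one.2 (by simp +contextual)
  | succ n ih =>
    have hsum : ∑ v ∈ A, #{u ∈ A | v ≠ u ∧ {v, u} ∈ 𝒮} ≤ D * #A := by
      refine le_trans (le_of_eq ?_) (hD A)
      rw [card_filter, sum_product]
      simp only [card_filter]
    obtain ⟨v, hv, hdeg⟩ : ∃ v ∈ A, #{u ∈ A | v ≠ u ∧ {v, u} ∈ 𝒮} ≤ D := by
      by_contra! h
      have hne : A.Nonempty := card_pos.1 (by omega)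
      have := sum_lt_sum_of_nonempty hne h
      simp only [sum_const, smul_eq_mul] at this
      nlinarith
    set M := {u ∈ A | v ≠ u ∧ {v, u} ∈ 𝒮} with hM
    have hsub : {S ∈ 𝒮 | S ⊆ A} ⊆ {S ∈ 𝒮 | S ⊆ A.erase v} ∪
        (insert v M ×ˢ insert v M).image fun p => {v, p.1, p.2} := by
      intro S hS
      simp only [mem_filter] at hS
      by_cases hvS : v ∈ S
      · refine mem_union_right _ ?_
        have hin : ∀ u ∈ S, u ∈ insert v M := by
          intro u hu
          by_cases huv : u = v
          · simp [huv]
          · refine mem_insert_of_mem ?_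
            simp only [hM, mem_filter]
            refine ⟨hS.2 hu, fun h => huv h.symm, hlow ?_ hS.1⟩
            intro w hw
            simp only [mem_insert, mem_singleton] at hw
            rcases hw with rfl | rfl <;> assumption
        have hc : #(S.erase v) ≤ 2 := by
          rw [card_erase_of_mem hvS]; have := h3 S hS.1; omega
        obtain ⟨a, b, ha, hb, hab⟩ : ∃ a b, a ∈ S ∧ b ∈ S ∧ S.erase v ⊆ {a, b} ∧ True := by
          rcases Nat.lt_or_ge (#(S.erase v)) 1 with h0 | h0
          · have : S.erase v = ∅ := card_eq_zero.1 (by omega)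
            exact ⟨v, v, hvS, hvS, by simp [this], trivial⟩
          rcases Nat.lt_or_ge (#(S.erase v)) 2 with h1 | h1
          · obtain ⟨a, ha⟩ := card_eq_one.1 (show #(S.erase v) = 1 by omega)
            have : a ∈ S := mem_of_mem_erase (a := v) (by rw [ha]; simp)
            exact ⟨a, a, this, this, by simp [ha], trivial⟩
          · obtain ⟨a, b, -, h⟩ := card_eq_two.1 (show #(S.erase v) = 2 by omega)
            have ha : a ∈ S := mem_of_mem_erase (a := v) (by rw [h]; simp)
            have hb : b ∈ S := mem_of_mem_erase (a := v) (by rw [h]; simp)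
            exact ⟨a, b, ha, hb, by simp [h], trivial⟩
        refine mem_image.2 ⟨(a, b), by simp only [mem_product]; exact ⟨hin a ha, hin b hb⟩, ?_⟩
        refine Subset.antisymm ?_ ?_
        · intro w hw
          simp only [mem_insert, mem_singleton] at hw
          rcases hw with rfl | rfl | rfl <;> assumption
        · intro w hw
          by_cases hwv : w = v
          · simp [hwv]
          · exact mem_insert_of_mem (hab.1 (mem_erase.2 ⟨hwv, hw⟩))
      · exact mem_union_left _ (by
          simp only [mem_filter]
          exact ⟨hS.1, subset_erase.2 ⟨hS.2, hvS⟩⟩)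
    have h1 := ih (A.erase v) (by rw [card_erase_of_mem hv]; omega)
    have h2 : #((insert v M ×ˢ insert v M).image fun p : ι × ι => ({v, p.1, p.2} : Finset ι)) ≤
        (D + 1) ^ 2 := by
      refine card_image_le.trans ?_
      rw [card_product, sq]
      have : #(insert v M) ≤ D + 1 := (card_insert_le _ _).trans (by omega)
      exact Nat.mul_le_mul this this
    have h3 := (card_le_card hsub).trans (card_union_le _ _)
    nlinarith

/-- Random colourings: the number of colourings that are `0` on `e` and nonzero on `U`. -/
lemma card_colourings {N q : ℕ} (e U : Finset (Fin N)) (h : Disjoint e U) :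
    (#{c : Fin N → Fin (q + 1) | (∀ i ∈ e, c i = 0) ∧ ∀ i ∈ U, c i ≠ 0} : ℝ) =
      (q + 1) ^ N * ((1 / (q + 1)) ^ #e * (1 - 1 / (q + 1)) ^ #U) := by
  have heq : ({c : Fin N → Fin (q + 1) | (∀ i ∈ e, c i = 0) ∧ ∀ i ∈ U, c i ≠ 0} : Finset _) =
      Fintype.piFinset fun i => if i ∈ e then {0} else if i ∈ U then {0}ᶜ else univ := by
    ext c
    simp only [mem_filter, mem_univ, true_and, Fintype.mem_piFinset]
    constructor
    · intro hc i
      split_ifs with h1 h2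
      · simpa using hc.1 i h1
      · simpa using hc.2 i h2
      · simp
    · intro hc
      refine ⟨fun i hi => ?_, fun i hi => ?_⟩
      · simpa [hi] using hc i
      · have hie : i ∉ e := fun h' => disjoint_left.1 h h' hi
        simpa [hi, hie] using hc i
  have hq : (q : ℝ) + 1 ≠ 0 := by positivity
  rw [heq, Fintype.card_piFinset]
  push_cast
  have : ∀ i : Fin N, ((#(if i ∈ e then {0} else if i ∈ U then {0}ᶜ else univ : Finset (Fin (q + 1))) : ℕ) : ℝ) =
      ((q : ℝ) + 1) * ((if i ∈ e then 1 / ((q : ℝ) + 1) else 1) *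
        (if i ∈ U then 1 - 1 / ((q : ℝ) + 1) else 1)) := by
    intro i
    by_cases h1 : i ∈ e
    · have h2 : i ∉ U := disjoint_left.1 h h1
      simp [h1, h2, hq]
    · by_cases h2 : i ∈ U
      · simp [h1, h2, card_compl]
        field_simp
        ring
      · simp [h1, h2]
  rw [prod_congr rfl fun i _ => this i, prod_mul_distrib, prod_mul_distrib, prod_ite_mem,
    prod_ite_mem]
  simp

/-- A family of traces of points of depth at most `t` in an arrangement of halfspaces. -/
def IsShallowFamily {N : ℕ} (f : Fin N → Fin 4 → ℝ) (t : ℕ) (𝒜 : Finset (Finset (Fin N))) : Prop :=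
  ∀ S ∈ 𝒜, #S ≤ t ∧ ∃ y : Fin 4 → ℝ, y 0 = 1 ∧ ∀ i, 0 ≤ affEval (f i) y ↔ i ∈ S

lemma IsShallowFamily.card_shattered_le {N : ℕ} {f : Fin N → Fin 4 → ℝ} {t : ℕ}
    {𝒜 : Finset (Finset (Fin N))} (h : IsShallowFamily f t 𝒜) (B : Finset (Fin N))
    (hB : 𝒜.Shatters B) : #B ≤ 3 := by
  by_contra! hlt
  obtain ⟨T, hT, hy⟩ := not_shattered_by_points B f hlt
  obtain ⟨S, hS, rfl⟩ := hB hT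
  obtain ⟨-, y, hy0, hyS⟩ := h S hS
  exact hy y hy0 fun i hi => by simp [hyS i, hi]

/-- Clarkson–Shor bound for shattered pairs. -/
lemma IsShallowFamily.card_shattered_pairs_le {N : ℕ} {f : Fin N → Fin 4 → ℝ} {t : ℕ}
    {𝒜 : Finset (Finset (Fin N))} (h : IsShallowFamily f t 𝒜) (A : Finset (Fin N)) :
    #{e ∈ A ×ˢ A | e.1 ≠ e.2 ∧ {e.1, e.2} ∈ 𝒜.shatterer} ≤ 288 * (t + 1) * #A := by
  classical
  set E := {e ∈ A ×ˢ A | e.1 ≠ e.2 ∧ {e.1, e.2} ∈ 𝒜.shatterer} with hE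
  set q := 8 * t + 7 with hq
  have hq1 : (q : ℝ) + 1 = 8 * (t + 1) := by rw [hq]; push_cast; ring
  have hq0 : (0 : ℝ) < (q : ℝ) + 1 := by positivity
  have hgood : ∀ e ∈ E, ((q : ℝ) + 1) ^ N * ((1 / (q + 1)) ^ 2 * (1 / 2)) ≤
      #{c : Fin N → Fin (q + 1) | e.1 ∈ A.filter (c · = 0) ∧ e.2 ∈ A.filter (c · = 0) ∧
        IsEdge f (A.filter (c · = 0)) e.1 e.2} := by
    rintro ⟨i, j⟩ he
    simp only [hE, mem_filter, mem_product, mem_shatterer] at he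
    obtain ⟨⟨hi, hj⟩, hij, hsh⟩ := he
    choose! u hu using hsh
    set U := (({i, j} : Finset (Fin N)).powerset.biUnion u) \ {i, j} with hU
    have hUc : #U ≤ 4 * t := by
      refine (card_le_card sdiff_subset).trans ?_
      refine (card_biUnion_le_card_mul _ _ t fun T hT => ?_).trans ?_
      · exact (h _ (hu (mem_powerset.1 hT)).1).1
      · rw [card_powerset, card_pair hij]; norm_num
    have hcard := card_colourings (q := q) {i, j} U disjoint_sdiff
    rw [card_pair hij] at hcard
    have hbern : (1 / 2 : ℝ) ≤ (1 - 1 / ((q : ℝ) + 1)) ^ #U := by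
      have h1 := one_add_mul_le_pow (a := -(1 / ((q : ℝ) + 1))) (by
        rw [hq1]
        have : 1 / (8 * ((t : ℝ) + 1)) ≤ 1 := by
          rw [div_le_one (by positivity)]
          have : (0 : ℝ) ≤ t := by positivity
          linarith
        linarith) #U
      have h2 : (#U : ℝ) * (1 / ((q : ℝ) + 1)) ≤ 1 / 2 := by
        have : (#U : ℝ) ≤ 4 * t := by exact_mod_cast hUc
        rw [hq1, mul_one_div, div_le_div_iff₀ (by positivity) (by norm_num)]
        linarith
      rw [sub_eq_add_neg]
      linarith
    calc _ ≤ ((q : ℝ) + 1) ^ N * ((1 / (q + 1)) ^ 2 * (1 - 1 / ((q : ℝ) + 1)) ^ #U) := by gcongr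
      _ = _ := hcard.symm
      _ ≤ _ := by
        norm_cast
        refine card_le_card fun c hc => ?_
        simp only [mem_filter, mem_univ, true_and, mem_insert, mem_singleton, forall_eq_or_imp,
          forall_eq] at hc ⊢
        obtain ⟨⟨hci, hcj⟩, hcU⟩ := hc
        refine ⟨⟨hi, hci⟩, ⟨hj, hcj⟩, by simp [hi, hci], by simp [hj, hcj], hij, fun T hT => ?_⟩
        obtain ⟨huA, huT⟩ := hu hT
        obtain ⟨-, y, hy0, hy⟩ := h _ huA
        refine ⟨y, hy0, fun l hl => ?_⟩
        simp only [mem_filter] at hl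
        rw [hy l]
        constructor
        · intro hlu
          rw [← huT, mem_inter]
          refine ⟨?_, hlu⟩
          by_contra hle
          refine hcU l ?_ hl.2
          rw [hU, Finset.mem_sdiff, mem_biUnion]
          exact ⟨⟨T, mem_powerset.2 hT, hlu⟩, hle⟩
        · intro hlT
          rw [← huT, mem_inter] at hlT
          exact hlT.2
  have hswap : ∑ e ∈ E, #{c : Fin N → Fin (q + 1) | e.1 ∈ A.filter (c · = 0) ∧
      e.2 ∈ A.filter (c · = 0) ∧ IsEdge f (A.filter (c · = 0)) e.1 e.2} ≤
      ∑ c : Fin N → Fin (q + 1), 18 * #(A.filter (c · = 0)) := by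
    simp only [card_filter]
    rw [sum_comm]
    refine sum_le_sum fun c _ => ?_
    rw [← card_filter, ← card_filter]
    refine le_trans (card_le_card ?_) (card_edges_le f (A.filter (c · = 0)))
    intro e he
    simp only [mem_filter, mem_product] at he ⊢
    tauto
  have hQ : ∑ c : Fin N → Fin (q + 1), (#(A.filter (c · = 0)) : ℝ) =
      #A * (((q : ℝ) + 1) ^ N * (1 / (q + 1))) := by
    have : ∀ i ∈ A, (#{c : Fin N → Fin (q + 1) | c i = 0} : ℝ) =
        ((q : ℝ) + 1) ^ N * (1 / (q + 1)) := by
      intro i _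
      have := card_colourings (q := q) {i} ∅ (by simp)
      simpa using this
    rw [← nsmul_eq_mul, ← sum_const, ← sum_congr rfl this]
    norm_cast
    simp only [card_filter]
    rw [sum_comm]
  have hmain : (#E : ℝ) * (((q : ℝ) + 1) ^ N * ((1 / (q + 1)) ^ 2 * (1 / 2))) ≤
      18 * (#A * (((q : ℝ) + 1) ^ N * (1 / (q + 1)))) := by
    rw [← hQ, ← nsmul_eq_mul, ← sum_const, mul_sum]
    refine (sum_le_sum hgood).trans ?_
    exact_mod_cast hswap
  have hp : (0 : ℝ) < ((q : ℝ) + 1) ^ N := by positivity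
  have : (#E : ℝ) ≤ 36 * ((q : ℝ) + 1) * #A := by
    have e1 : (#E : ℝ) * (((q : ℝ) + 1) ^ N * ((1 / (q + 1)) ^ 2 * (1 / 2))) =
      (#E : ℝ) * (((q : ℝ) + 1) ^ N / (2 * (q + 1) ^ 2)) := by field_simp
    have e2 : 18 * (#A * (((q : ℝ) + 1) ^ N * (1 / (q + 1)))) =
      36 * ((q : ℝ) + 1) * #A * (((q : ℝ) + 1) ^ N / (2 * (q + 1) ^ 2)) := by field_simp; ring
    rw [e1, e2] at hmain
    exact le_of_mul_le_mul_right hmain (by positivity)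
  rw [hq1] at this
  have : (#E : ℝ) ≤ ((288 * (t + 1) * #A : ℕ) : ℝ) := by push_cast; linarith
  exact_mod_cast this

/-- The number of shallow cells in an arrangement of halfspaces in `ℝ³`. -/
lemma IsShallowFamily.card_le {N : ℕ} {f : Fin N → Fin 4 → ℝ} {t : ℕ}
    {𝒜 : Finset (Finset (Fin N))} (h : IsShallowFamily f t 𝒜) :
    #𝒜 ≤ 1 + N * (289 * (t + 1)) ^ 2 := by
  have h1 := card_lowerSet_le 𝒜.shatterer (isLowerSet_shatterer 𝒜)
    (fun S hS => h.card_shattered_le S (mem_shatterer.1 hS)) (288 * (t + 1))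
    (fun A => h.card_shattered_pairs_le A) univ
  simp only [subset_univ, filter_true, card_univ, Fintype.card_fin] at h1
  have h2 : 288 * (t + 1) + 1 ≤ 289 * (t + 1) := by omega
  calc #𝒜 ≤ #𝒜.shatterer := card_le_card_shatterer 𝒜
    _ ≤ _ := h1
    _ ≤ _ := by gcongr

section UnitDistance
variable {ι : Type*} [DecidableEq ι]

/-- Haussler's bound on the number of edges of the unit distance graph of a set family. -/
lemma card_unit_distance_le (U : Finset ι) : ∀ (d : ℕ) (F : Finset (Finset ι)), (∀ S ∈ F, S ⊆ U) →
    (∀ B, F.Shatters B → #B ≤ d) → ∑ i ∈ U, #{S ∈ F | i ∉ S ∧ insert i S ∈ F} ≤ d * #F := by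
  induction U using Finset.induction_on with
  | empty => simp
  | insert a U ha ih =>
    intro d F hF hd
    set F₀ := F.nonMemberSubfamily a with hF₀
    set F₁ := F.memberSubfamily a with hF₁
    have hcard : #F₁ + #F₀ = #F := F.card_memberSubfamily_add_card_nonMemberSubfamily a
    have h0 : ∀ S ∈ F₀, a ∉ S ∧ S ⊆ U ∧ S ∈ F := by
      intro S hS
      rw [hF₀, mem_nonMemberSubfamily] at hS
      exact ⟨hS.2, (subset_insert_iff_of_notMem hS.2).1 (hF S hS.1), hS.1⟩
    have h1 : ∀ S ∈ F₁, a ∉ S ∧ S ⊆ U ∧ insert a S ∈ F := by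
      intro S hS
      rw [hF₁, mem_memberSubfamily] at hS
      exact ⟨hS.2, (insert_subset_insert_iff hS.2).1 (hF _ hS.1), hS.1⟩
    have ea : #{S ∈ F | a ∉ S ∧ insert a S ∈ F} = #(F₀ ∩ F₁) := by
      congr 1
      ext S
      simp only [mem_filter, mem_inter, hF₀, hF₁, mem_nonMemberSubfamily, mem_memberSubfamily]
      tauto
    have ei : ∀ i ∈ U, #{S ∈ F | i ∉ S ∧ insert i S ∈ F} ≤
        #{S ∈ F₀ ∪ F₁ | i ∉ S ∧ insert i S ∈ F₀ ∪ F₁} +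
        #{S ∈ F₀ ∩ F₁ | i ∉ S ∧ insert i S ∈ F₀ ∩ F₁} := by
      intro i hi
      have hia : i ≠ a := fun h => ha (h ▸ hi)
      have e : #{S ∈ F | i ∉ S ∧ insert i S ∈ F} =
          #{S ∈ F₁ | i ∉ S ∧ insert i S ∈ F₁} + #{S ∈ F₀ | i ∉ S ∧ insert i S ∈ F₀} := by
        rw [← card_memberSubfamily_add_card_nonMemberSubfamily a]
        congr 2
        · ext S
          simp only [mem_filter, hF₁, mem_memberSubfamily, mem_insert, hia, hia.symm, false_or,
            insert_comm i a]
          tauto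
        · ext S
          simp only [mem_filter, hF₀, mem_nonMemberSubfamily, mem_insert, hia.symm, false_or]
          tauto
      rw [e, ← card_union_add_card_inter]
      refine Nat.add_le_add (card_le_card fun S hS => ?_) (card_le_card fun S hS => ?_)
      · simp only [mem_union, mem_filter] at hS ⊢
        tauto
      · simp only [mem_inter, mem_filter] at hS ⊢
        tauto
    rw [sum_insert ha, ea]
    have hs := (sum_le_sum ei).trans_eq sum_add_distrib
    have hU := ih d (F₀ ∪ F₁) (fun S hS => by
      rcases mem_union.1 hS with h | h
      · exact (h0 S h).2.1
      · exact (h1 S h).2.1) (fun B hB => by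
      refine hd B fun t ht => ?_
      obtain ⟨v, hv, hvB⟩ := hB (Subset.refl B)
      have haB : a ∉ B := by
        intro hh
        rw [← hvB, mem_inter] at hh
        rcases mem_union.1 hv with h | h
        · exact (h0 v h).1 hh.2
        · exact (h1 v h).1 hh.2
      obtain ⟨u, hu, rfl⟩ := hB ht
      rcases mem_union.1 hu with h | h
      · exact ⟨u, (h0 u h).2.2, rfl⟩
      · exact ⟨insert a u, (h1 u h).2.2, inter_insert_of_notMem haB⟩)
    have hcI := card_union_add_card_inter F₀ F₁
    rcases (F₀ ∩ F₁).eq_empty_or_nonempty with hI | hI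
    · have : ∑ i ∈ U, #{S ∈ F₀ ∩ F₁ | i ∉ S ∧ insert i S ∈ F₀ ∩ F₁} = 0 := by simp [hI]
      rw [hI, card_empty] at hcI ⊢
      rw [show #F = #(F₀ ∪ F₁) by omega]
      omega
    · have key : ∀ B, (F₀ ∩ F₁).Shatters B → #B + 1 ≤ d := by
        intro B hB
        obtain ⟨v, hv, hvB⟩ := hB (Subset.refl B)
        have haB : a ∉ B := by
          intro hh
          rw [← hvB, mem_inter] at hh
          exact (h0 v (mem_inter.1 hv).1).1 hh.2
        rw [← card_insert_of_notMem haB]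
        refine hd _ fun t ht => ?_
        obtain ⟨u, hu, hut⟩ := hB (show t.erase a ⊆ B from fun x hx => by
          rw [mem_erase] at hx
          exact (mem_insert.1 (ht hx.2)).resolve_left hx.1)
        obtain ⟨hu0, hu1⟩ := mem_inter.1 hu
        have hau := (h0 u hu0).1
        by_cases hat : a ∈ t
        · refine ⟨insert a u, (h1 u hu1).2.2, ?_⟩
          rw [← insert_inter_distrib, hut, insert_erase hat]
        · refine ⟨u, (h0 u hu0).2.2, ?_⟩
          rw [insert_inter_of_notMem hau, hut, erase_eq_of_notMem hat]
      obtain ⟨S, hS⟩ := hI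
      have hd1 := key ∅ (fun t ht => ⟨S, hS, by simp [subset_empty.1 ht]⟩)
      obtain ⟨e, rfl⟩ : ∃ e, d = e + 1 := ⟨d - 1, by simp at hd1; omega⟩
      have hI' := ih e (F₀ ∩ F₁) (fun S hS => (h0 S (mem_inter.1 hS).1).2.1)
        (fun B hB => by have := key B hB; omega)
      have : #F = #(F₀ ∪ F₁) + #(F₀ ∩ F₁) := by omega
      rw [this]
      nlinarith

lemma sum_min_unit_distance_le (U : Finset ι) (d : ℕ) (F : Finset (Finset ι))
    (hF : ∀ S ∈ F, S ⊆ U) (hd : ∀ B, F.Shatters B → #B ≤ d) (w : Finset ι → ℕ) :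
    ∑ i ∈ U, ∑ S ∈ F with i ∉ S ∧ insert i S ∈ F, min (w S) (w (insert i S)) ≤
      d * ∑ S ∈ F, w S := by
  set M := ∑ S ∈ F, w S with hM
  have hwM : ∀ S ∈ F, w S ≤ M := fun S hS => single_le_sum (f := w) (fun _ _ => Nat.zero_le _) hS
  have layer : ∀ a ≤ M, a = ∑ t ∈ range M, if t < a then 1 else 0 := by
    intro a ha
    rw [← card_filter]
    have : {t ∈ range M | t < a} = range a := by
      ext t; simp only [mem_filter, mem_range]; omega
    rw [this, card_range]
  have hsum : M = ∑ t ∈ range M, #{S ∈ F | t < w S} := by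
    conv_lhs => rw [hM, sum_congr rfl fun S hS => layer _ (hwM S hS), sum_comm]
    simp only [card_filter]
  calc ∑ i ∈ U, ∑ S ∈ F with i ∉ S ∧ insert i S ∈ F, min (w S) (w (insert i S))
      = ∑ t ∈ range M, ∑ i ∈ U, #{S ∈ {S ∈ F | t < w S} | i ∉ S ∧
          insert i S ∈ {S ∈ F | t < w S}} := by
        rw [sum_comm]
        refine sum_congr rfl fun i _ => ?_
        rw [sum_congr rfl fun S hS => layer _ ((min_le_left _ _).trans
          (hwM S (mem_filter.1 hS).1)), sum_comm]
        refine sum_congr rfl fun t _ => ?_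
        rw [← card_filter]
        congr 1
        ext S
        simp only [mem_filter, lt_min_iff]
        tauto
    _ ≤ ∑ t ∈ range M, d * #{S ∈ F | t < w S} := by
        refine sum_le_sum fun t _ => card_unit_distance_le U d _ (fun S hS => hF S
          (mem_filter.1 hS).1) fun B hB => hd B (hB.mono_left (filter_subset _ _))
    _ = d * M := by rw [← mul_sum, ← hsum]

end UnitDistance

section Sampling
variable {R : Type*} [Fintype R] {N : ℕ} (μ : R → ℝ)

lemma sum_prod_resample (g : (Fin N → R) → ℝ) (j : Fin N) (hμ : ∑ r, μ r = 1) :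
    ∑ s : Fin N → R, (∏ i, μ (s i)) * g s =
      ∑ s : Fin N → R, (∏ i, μ (s i)) * ∑ r, μ r * g (Function.update s j r) := by
  have h1 : ∑ s : Fin N → R, (∏ i, μ (s i)) * g s =
      ∑ p : (Fin N → R) × R, (∏ i, μ (p.1 i)) * μ p.2 * g p.1 := by
    rw [Fintype.sum_prod_type]
    refine sum_congr rfl fun s _ => ?_
    simp only
    rw [← sum_mul, ← mul_sum, hμ, mul_one]
  have h2 : ∑ s : Fin N → R, (∏ i, μ (s i)) * ∑ r, μ r * g (Function.update s j r) =
      ∑ p : (Fin N → R) × R, (∏ i, μ (p.1 i)) * μ p.2 * g (Function.update p.1 j p.2) := by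
    rw [Fintype.sum_prod_type]
    refine sum_congr rfl fun s _ => ?_
    rw [mul_sum]
    exact sum_congr rfl fun r _ => by ring
  rw [h1, h2]
  refine sum_nbij' (fun p => (Function.update p.1 j p.2, p.1 j))
    (fun p => (Function.update p.1 j p.2, p.1 j)) (by simp) (by simp) (by simp) (by simp) ?_
  rintro ⟨s, r⟩ -
  simp only [Function.update_idem, Function.update_eq_self]
  congr 1
  rw [← mul_prod_erase univ _ (mem_univ j), ← mul_prod_erase univ (fun i =>
    μ (Function.update s j r i)) (mem_univ j)]
  have : ∏ i ∈ univ.erase j, μ (Function.update s j r i) = ∏ i ∈ univ.erase j, μ (s i) :=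
    prod_congr rfl fun i hi => by rw [Function.update_of_ne (ne_of_mem_erase hi)]
  rw [this]
  simp
  ring

lemma sum_prod_weights (hμ : ∑ r, μ r = 1) : ∑ s : Fin N → R, ∏ i, μ (s i) = 1 := by
  rw [← Fintype.prod_sum fun (_ : Fin N) r => μ r]
  simp [hμ]

end Sampling

section Haussler
open Classical in
/-- The set of indices of the ranges in the sample `s` that contain `x`. -/
noncomputable def sampleTrace {α R : Type*} {N : ℕ} (inc : α → R → Prop) (s : Fin N → R) (x : α) :
    Finset (Fin N) := {j | inc x (s j)}

open Classical in
lemma sampleTrace_update_erase {α R : Type*} {N : ℕ} {inc : α → R → Prop} (s : Fin N → R) (j : Fin N)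
    (r : R) (x : α) :
    (sampleTrace inc (Function.update s j r) x).erase j = (sampleTrace inc s x).erase j := by
  ext i
  simp only [sampleTrace, mem_erase, mem_filter, mem_univ, true_and]
  refine and_congr_right fun h => ?_
  rw [Function.update_of_ne h]

variable {α R : Type*} [Fintype R] {N : ℕ} {inc : α → R → Prop} {μ : R → ℝ}

open Classical in
lemma card_mul_card_sub_one_le_separation (C : Finset α) {δ : ℝ} (hδ : 0 ≤ δ) (hμ0 : ∀ r, 0 ≤ μ r)
    (hsep : ∀ x ∈ C, ∀ y ∈ C, x ≠ y → δ ≤ ∑ r with ¬ (inc x r ↔ inc y r), μ r) :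
    (#C - 1) * (δ / 2) ≤
      ∑ r, μ r * (min #{x ∈ C | ¬ inc x r} #{x ∈ C | inc x r} : ℕ) := by
  have h1 : (#C : ℝ) * (#C - 1) * (δ / 2) ≤
      ∑ r, μ r * (#{x ∈ C | ¬ inc x r} * #{x ∈ C | inc x r} : ℕ) := by
    have e1 : ∑ r, μ r * (#{x ∈ C | ¬ inc x r} * #{x ∈ C | inc x r} : ℕ) =
        ∑ p ∈ C ×ˢ C, ∑ r, if ¬ inc p.1 r ∧ inc p.2 r then μ r else 0 := by
      rw [sum_comm]
      refine sum_congr rfl fun r _ => ?_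
      rw [← card_product, ← filter_product, ← sum_filter, sum_const, nsmul_eq_mul, mul_comm]
    have e2 : ∑ p ∈ C ×ˢ C, ∑ r, (if ¬ inc p.1 r ∧ inc p.2 r then μ r else 0) =
        ∑ p ∈ C ×ˢ C, ∑ r, if ¬ inc p.2 r ∧ inc p.1 r then μ r else 0 := by
      rw [sum_product, sum_comm, ← sum_product']
    have e3 : ∑ p ∈ C ×ˢ C, ∑ r, (if ¬ (inc p.1 r ↔ inc p.2 r) then μ r else 0) =
        2 * ∑ p ∈ C ×ˢ C, ∑ r, if ¬ inc p.1 r ∧ inc p.2 r then μ r else 0 := by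
      rw [two_mul]
      conv_rhs => rw [e2]
      conv_rhs => enter [1]; rw [← e2]
      rw [← sum_add_distrib]
      refine sum_congr rfl fun p _ => ?_
      rw [← sum_add_distrib]
      refine sum_congr rfl fun r _ => ?_
      by_cases h : inc p.1 r <;> by_cases h' : inc p.2 r <;> simp [h, h']
    have e4 : (#C : ℝ) * (#C - 1) * δ ≤
        ∑ p ∈ C ×ˢ C, ∑ r, (if ¬ (inc p.1 r ↔ inc p.2 r) then μ r else 0) := by
      calc (#C : ℝ) * (#C - 1) * δ = ∑ p ∈ C.offDiag, δ := by
            rw [sum_const, offDiag_card, nsmul_eq_mul, Nat.cast_sub (Nat.le_mul_self _)]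
            push_cast; ring
        _ ≤ ∑ p ∈ C.offDiag, ∑ r, (if ¬ (inc p.1 r ↔ inc p.2 r) then μ r else 0) := by
            refine sum_le_sum fun p hp => ?_
            rw [mem_offDiag] at hp
            rw [← sum_filter]
            exact hsep _ hp.1 _ hp.2.1 hp.2.2
        _ ≤ _ := by
            refine sum_le_sum_of_subset_of_nonneg (fun p hp => ?_) fun p _ _ =>
              sum_nonneg fun r _ => ?_
            · rw [mem_offDiag] at hp
              exact mem_product.2 ⟨hp.1, hp.2.1⟩
            · split_ifs <;> simp [hμ0]
    rw [e1]
    linarith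
  rcases C.eq_empty_or_nonempty with rfl | hC
  · simp; linarith
  have hpos : (0 : ℝ) < #C := by exact_mod_cast card_pos.2 hC
  refine le_of_mul_le_mul_left ?_ hpos
  calc (#C : ℝ) * ((#C - 1) * (δ / 2)) = (#C : ℝ) * (#C - 1) * (δ / 2) := by ring
    _ ≤ _ := h1
    _ ≤ ∑ r, #C * (μ r * (min #{x ∈ C | ¬ inc x r} #{x ∈ C | inc x r} : ℕ)) := by
        refine sum_le_sum fun r _ => ?_
        have hc : #{x ∈ C | inc x r} + #{x ∈ C | ¬ inc x r} = #C :=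
          card_filter_add_card_filter_not _
        have : #{x ∈ C | ¬ inc x r} * #{x ∈ C | inc x r} ≤
            #C * min #{x ∈ C | ¬ inc x r} #{x ∈ C | inc x r} := by
          rcases le_total #{x ∈ C | ¬ inc x r} #{x ∈ C | inc x r} with h | h
          · rw [min_eq_left h]; nlinarith
          · rw [min_eq_right h]; nlinarith
        have h' : ((#{x ∈ C | ¬ inc x r} * #{x ∈ C | inc x r} : ℕ) : ℝ) ≤
            #C * (min #{x ∈ C | ¬ inc x r} #{x ∈ C | inc x r} : ℕ) := by exact_mod_cast this
        calc _ ≤ μ r * (#C * (min #{x ∈ C | ¬ inc x r} #{x ∈ C | inc x r} : ℕ)) :=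
              mul_le_mul_of_nonneg_left h' (hμ0 r)
          _ = _ := by ring
    _ = _ := by rw [mul_sum]

open Classical in
/-- Haussler's packing argument: few sampled ranges distinguish many of the points. -/
lemma expected_card_trace_ge (X : Finset α) {δ : ℝ} {d : ℕ} (hδ : 0 ≤ δ) (hμ0 : ∀ r, 0 ≤ μ r)
    (hμ : ∑ r, μ r = 1)
    (hsep : ∀ x ∈ X, ∀ y ∈ X, x ≠ y → δ ≤ ∑ r with ¬ (inc x r ↔ inc y r), μ r)
    (hd : ∀ s : Fin N → R, ∀ B, (X.image (sampleTrace inc s)).Shatters B → #B ≤ d) :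
    N * (δ / 2) * (#X - ∑ s : Fin N → R, (∏ i, μ (s i)) * #(X.image (sampleTrace inc s))) ≤ d * #X := by
  set w : (Fin N → R) → Finset (Fin N) → ℕ := fun s S => #{x ∈ X | sampleTrace inc s x = S} with hw
  set T : Fin N → (Fin N → R) → Finset (Finset (Fin N)) :=
    fun j s => X.image fun x => (sampleTrace inc s x).erase j with hT
  set G : Fin N → (Fin N → R) → ℕ :=
    fun j s => ∑ S ∈ T j s, min (w s S) (w s (insert j S)) with hG
  have hGle : ∀ s, ∑ j, G j s ≤ d * #X := by
    intro s
    have h1 := sum_min_unit_distance_le univ d (X.image (sampleTrace inc s)) (fun _ _ => subset_univ _)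
      (hd s) (w s)
    have h2 : ∑ S ∈ X.image (sampleTrace inc s), w s S = #X :=
      (card_eq_sum_card_image _ _).symm
    rw [h2] at h1
    refine le_trans (sum_le_sum fun j _ => ?_) h1
    refine sum_le_sum_of_ne_zero fun S hS hne => ?_
    have hmin : 0 < w s S ∧ 0 < w s (insert j S) := lt_min_iff.1 (Nat.pos_of_ne_zero hne)
    obtain ⟨x, -, hx⟩ := mem_image.1 hS
    obtain ⟨y, hy⟩ := card_pos.1 hmin.1
    obtain ⟨z, hz⟩ := card_pos.1 hmin.2
    rw [mem_filter] at hy hz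
    simp only [mem_filter]
    exact ⟨mem_image.2 ⟨y, hy⟩, by simp [← hx], mem_image.2 ⟨z, hz⟩⟩
  have hGe : ∀ j s, (#X - #(X.image (sampleTrace inc s)) : ℝ) * (δ / 2) ≤
      ∑ r, μ r * (G j (Function.update s j r) : ℝ) := by
    intro j s
    have hTle : #(T j s) ≤ #(X.image (sampleTrace inc s)) := by
      have : T j s = (X.image (sampleTrace inc s)).image (·.erase j) := by
        rw [image_image]; rfl
      rw [this]
      exact card_image_le
    have hcX : (#X : ℝ) = ∑ S ∈ T j s, (#{x ∈ X | (sampleTrace inc s x).erase j = S} : ℝ) := by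
      exact_mod_cast card_eq_sum_card_image (fun x => (sampleTrace inc s x).erase j) X
    calc (#X - #(X.image (sampleTrace inc s)) : ℝ) * (δ / 2) ≤ (#X - #(T j s) : ℝ) * (δ / 2) := by
          gcongr
      _ = ∑ S ∈ T j s, (#{x ∈ X | (sampleTrace inc s x).erase j = S} - 1 : ℝ) * (δ / 2) := by
          rw [hcX, ← sum_mul, sum_sub_distrib]; simp
      _ ≤ ∑ S ∈ T j s, ∑ r, μ r * (min (w (Function.update s j r) S)
            (w (Function.update s j r) (insert j S)) : ℕ) := by
          refine sum_le_sum fun S hS => ?_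
          refine (card_mul_card_sub_one_le_separation _ hδ hμ0 fun x hx y hy =>
            hsep x (mem_filter.1 hx).1 y (mem_filter.1 hy).1).trans (le_of_eq ?_)
          refine sum_congr rfl fun r _ => ?_
          have hjS : j ∉ S := by
            obtain ⟨x, -, rfl⟩ := mem_image.1 hS
            simp
          congr 4
          · rw [filter_filter]
            refine filter_congr fun x _ => ?_
            constructor
            · rintro ⟨h1, h2⟩
              rw [← h1, ← sampleTrace_update_erase s j r x, erase_eq_of_notMem]
              simpa [sampleTrace] using h2
            · intro h
              refine ⟨by rw [← sampleTrace_update_erase s j r x, h, erase_eq_of_notMem hjS], ?_⟩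
              rw [← h] at hjS
              simpa [sampleTrace] using hjS
          · rw [filter_filter]
            refine filter_congr fun x _ => ?_
            constructor
            · rintro ⟨h1, h2⟩
              rw [← h1, ← sampleTrace_update_erase s j r x, insert_erase]
              simpa [sampleTrace] using h2
            · intro h
              refine ⟨by rw [← sampleTrace_update_erase s j r x, h, erase_insert hjS], ?_⟩
              have : j ∈ sampleTrace inc (Function.update s j r) x := by rw [h]; simp
              simpa [sampleTrace] using this
      _ = _ := by
          rw [sum_comm]
          refine sum_congr rfl fun r _ => ?_
          rw [← mul_sum, hG]
          have : T j (Function.update s j r) = T j s := by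
            simp only [hT, sampleTrace_update_erase]
          simp only [this]
          push_cast
          rfl
  have hW : ∀ s : Fin N → R, 0 ≤ ∏ i, μ (s i) := fun s => prod_nonneg fun i _ => hμ0 _
  have hW1 := sum_prod_weights (N := N) μ hμ
  calc N * (δ / 2) * (#X - ∑ s : Fin N → R, (∏ i, μ (s i)) * #(X.image (sampleTrace inc s)))
      = ∑ j : Fin N, ∑ s : Fin N → R, (∏ i, μ (s i)) *
          ((#X - #(X.image (sampleTrace inc s)) : ℝ) * (δ / 2)) := by
        simp only [sum_const, card_univ, Fintype.card_fin, nsmul_eq_mul, ← mul_assoc, ← sum_mul,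
          mul_sub, sum_sub_distrib, hW1]
        ring
    _ ≤ ∑ j : Fin N, ∑ s : Fin N → R, (∏ i, μ (s i)) *
          ∑ r, μ r * (G j (Function.update s j r) : ℝ) := by
        gcongr with j _ s _
        · exact hW s
        · exact hGe j s
    _ = ∑ j : Fin N, ∑ s : Fin N → R, (∏ i, μ (s i)) * (G j s : ℝ) := by
        refine sum_congr rfl fun j _ => ?_
        exact (sum_prod_resample μ (fun s => (G j s : ℝ)) j hμ).symm
    _ = ∑ s : Fin N → R, (∏ i, μ (s i)) * ((∑ j, G j s : ℕ) : ℝ) := by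
        rw [sum_comm]
        refine sum_congr rfl fun s _ => ?_
        push_cast
        rw [mul_sum]
    _ ≤ ∑ s : Fin N → R, (∏ i, μ (s i)) * (d * #X : ℝ) := by
        gcongr with s _
        · exact hW s
        · exact_mod_cast hGle s
    _ = d * #X := by rw [← sum_mul, hW1, one_mul]

open Classical in
lemma card_le_of_separated (X : Finset α) {δ τ : ℝ} {t B : ℕ} (hδ : 0 ≤ δ) (hμ0 : ∀ r, 0 ≤ μ r)
    (hμ : ∑ r, μ r = 1)
    (hsep : ∀ x ∈ X, ∀ y ∈ X, x ≠ y → δ ≤ ∑ r with ¬ (inc x r ↔ inc y r), μ r)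
    (hdepth : ∀ x ∈ X, ∑ r with inc x r, μ r ≤ τ)
    (hd : ∀ s : Fin N → R, ∀ B, (X.image (sampleTrace inc s)).Shatters B → #B ≤ 3)
    (hB : ∀ s : Fin N → R, #{S ∈ X.image (sampleTrace inc s) | #S ≤ t} ≤ B)
    (hN : 12 ≤ N * δ) (ht : 4 * (N * τ) ≤ t + 1) : #X ≤ 4 * B := by
  have hW : ∀ s : Fin N → R, 0 ≤ ∏ i, μ (s i) := fun s => prod_nonneg fun i _ => hμ0 _
  have hW1 := sum_prod_weights (N := N) μ hμ
  have h1 := expected_card_trace_ge X hδ hμ0 hμ hsep hd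
  set E := ∑ s : Fin N → R, (∏ i, μ (s i)) * (#(X.image (sampleTrace inc s)) : ℝ) with hE
  have hE0 : 0 ≤ E := sum_nonneg fun s _ => mul_nonneg (hW s) (by positivity)
  have hdeep : ∀ x ∈ X, ∑ s : Fin N → R, (∏ i, μ (s i)) * (#(sampleTrace inc s x) : ℝ) ≤ N * τ := by
    intro x hx
    have : ∀ j : Fin N, ∑ s : Fin N → R, (∏ i, μ (s i)) * (if inc x (s j) then 1 else 0) ≤ τ := by
      intro j
      rw [sum_prod_resample μ _ j hμ]
      simp only [Function.update_self]
      rw [← sum_mul, hW1, one_mul]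
      simpa [sum_filter] using hdepth x hx
    calc _ = ∑ s : Fin N → R, ∑ j : Fin N, (∏ i, μ (s i)) * (if inc x (s j) then 1 else 0) := by
          refine sum_congr rfl fun s _ => ?_
          rw [sampleTrace, card_filter, ← mul_sum]
          push_cast
          rfl
      _ ≤ ∑ j : Fin N, τ := by rw [sum_comm]; exact sum_le_sum fun j _ => this j
      _ = N * τ := by simp
  have hcard : ∀ s : Fin N → R, (#(X.image (sampleTrace inc s)) : ℝ) ≤
      B + ∑ x ∈ X, (#(sampleTrace inc s x) : ℝ) / (t + 1) := by
    intro s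
    have hsub : X.image (sampleTrace inc s) ⊆ {S ∈ X.image (sampleTrace inc s) | #S ≤ t} ∪
        {x ∈ X | t < #(sampleTrace inc s x)}.image (sampleTrace inc s) := by
      intro S hS
      by_cases h : #S ≤ t
      · exact mem_union_left _ (mem_filter.2 ⟨hS, h⟩)
      · obtain ⟨x, hx, rfl⟩ := mem_image.1 hS
        exact mem_union_right _ (mem_image_of_mem _ (mem_filter.2 ⟨hx, not_le.1 h⟩))
    have h2 : #(X.image (sampleTrace inc s)) ≤ B + #{x ∈ X | t < #(sampleTrace inc s x)} :=
      ((card_le_card hsub).trans (card_union_le _ _)).trans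
        (Nat.add_le_add (hB s) card_image_le)
    have h3 : (#{x ∈ X | t < #(sampleTrace inc s x)} : ℝ) ≤
        ∑ x ∈ X, (#(sampleTrace inc s x) : ℝ) / (t + 1) := by
      rw [card_filter]
      push_cast
      refine sum_le_sum fun x _ => ?_
      split_ifs with h
      · rw [le_div_iff₀ (by positivity), one_mul]
        exact_mod_cast h
      · positivity
    calc (#(X.image (sampleTrace inc s)) : ℝ) ≤ B + #{x ∈ X | t < #(sampleTrace inc s x)} := by
          exact_mod_cast h2
      _ ≤ _ := by linarith
  have h4 : E ≤ B + #X / 4 := by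
    calc E ≤ ∑ s : Fin N → R, (∏ i, μ (s i)) *
          (B + ∑ x ∈ X, (#(sampleTrace inc s x) : ℝ) / (t + 1)) :=
        sum_le_sum fun s _ => mul_le_mul_of_nonneg_left (hcard s) (hW s)
      _ = B + ∑ x ∈ X, (∑ s : Fin N → R, (∏ i, μ (s i)) * (#(sampleTrace inc s x) : ℝ)) / (t + 1) := by
        simp only [mul_add, sum_add_distrib, ← sum_mul, hW1, one_mul, mul_sum]
        rw [sum_comm]
        simp only [sum_div, mul_div_assoc]
      _ ≤ B + ∑ x ∈ X, (1 / 4 : ℝ) := by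
        refine add_le_add le_rfl (sum_le_sum fun x hx => ?_)
        rw [div_le_iff₀ (by positivity)]
        have := hdeep x hx
        linarith
      _ = _ := by simp; ring
  have h5 : (#X : ℝ) ≤ 4 * B := by
    push_cast at h1
    rcases le_total (#X : ℝ) E with h | h
    · linarith
    · nlinarith
  exact_mod_cast h5

end Haussler

open Classical in
/-- Packing lemma for shallow points with respect to weighted halfspaces. -/
lemma card_shallow_separated_le {α R : Type*} [Fintype R] {μ : R → ℝ} (f : R → Fin 4 → ℝ)
    (y : α → Fin 4 → ℝ) (hy : ∀ x, y x 0 = 1) (X : Finset α) {δ τ : ℝ} (hδ : 0 < δ) (hδ1 : δ ≤ 1)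
    (hτ : 0 ≤ τ) (hμ0 : ∀ r, 0 ≤ μ r) (hμ : ∑ r, μ r = 1)
    (hsep : ∀ x ∈ X, ∀ z ∈ X, x ≠ z →
      δ ≤ ∑ r with ¬ (0 ≤ affEval (f r) (y x) ↔ 0 ≤ affEval (f r) (y z)), μ r)
    (hdepth : ∀ x ∈ X, ∑ r with 0 ≤ affEval (f r) (y x), μ r ≤ τ) :
    (#X : ℝ) ≤ 4 * (1 + 13 / δ * (289 * (52 * τ / δ + 2)) ^ 2) := by
  set N := ⌈12 / δ⌉₊ with hN
  set t := ⌈4 * (N * τ)⌉₊ with ht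
  have hNle : (N : ℝ) ≤ 13 / δ := by
    have h1 := (Nat.ceil_lt_add_one (show 0 ≤ 12 / δ by positivity)).le
    have : 1 ≤ 1 / δ := by rw [le_div_iff₀ hδ]; linarith
    calc (N : ℝ) ≤ 12 / δ + 1 := h1
      _ ≤ 12 / δ + 1 / δ := by linarith
      _ = 13 / δ := by ring
  have htle : (t : ℝ) + 1 ≤ 52 * τ / δ + 2 := by
    have h1 := (Nat.ceil_lt_add_one (show 0 ≤ 4 * (N * τ) by positivity)).le
    have h2 : 4 * (N * τ) ≤ 52 * τ / δ := by
      calc 4 * (N * τ) ≤ 4 * (13 / δ * τ) := by gcongr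
        _ = 52 * τ / δ := by ring
    linarith
  have hshallow : ∀ t' : ℕ, ∀ s : Fin N → R, IsShallowFamily (fun i => f (s i)) t'
      {S ∈ X.image (sampleTrace (fun x r => 0 ≤ affEval (f r) (y x)) s) | #S ≤ t'} := by
    intro t' s S hS
    rw [mem_filter] at hS
    obtain ⟨x, -, rfl⟩ := mem_image.1 hS.1
    exact ⟨hS.2, y x, hy x, fun i => by simp [sampleTrace]⟩
  have := card_le_of_separated (inc := fun x r => 0 ≤ affEval (f r) (y x)) (N := N) (t := t)
    (B := 1 + N * (289 * (t + 1)) ^ 2) X hδ.le hμ0 hμ hsep hdepth (fun s B hB => by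
      have h := hshallow N s
      rw [filter_true_of_mem fun S _ => by simpa using card_le_univ S] at h
      exact h.card_shattered_le B hB) (fun s => (hshallow t s).card_le)
    (by
      have := Nat.le_ceil (12 / δ)
      rwa [div_le_iff₀ hδ] at this)
    (by have := Nat.le_ceil (4 * (N * τ)); linarith)
  have h2 : (#X : ℝ) ≤ 4 * (1 + N * (289 * (t + 1)) ^ 2) := by exact_mod_cast this
  refine h2.trans ?_
  gcongr

section Matching
variable {α R : Type*} [Fintype R]

open Classical in
/-- Among shallow points, some pair is separated by few (weighted) halfspaces. -/
lemma exists_pair_rarely_separated {μ : R → ℝ} (f : R → Fin 4 → ℝ)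
    (y : α → Fin 4 → ℝ) (hy : ∀ x, y x 0 = 1) (P : Finset α) (hP : 2 ≤ #P) {c : ℝ} (hc : 1 ≤ c)
    (hk : ∀ r, (#{x ∈ P | 0 ≤ affEval (f r) (y x)} : ℝ) ≤ c ^ 3) (hμ0 : ∀ r, 0 ≤ μ r)
    (hμ : ∑ r, μ r = 1) :
    ∃ x ∈ P, ∃ z ∈ P, x ≠ z ∧
      ∑ r with ¬ (0 ≤ affEval (f r) (y x) ↔ 0 ≤ affEval (f r) (y z)), μ r ≤
        4 * 10 ^ 8 * c ^ 2 / #P := by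
  by_contra hnot
  have hcon : ∀ x ∈ P, ∀ z ∈ P, x ≠ z → 4 * 10 ^ 8 * c ^ 2 / (#P : ℝ) <
      ∑ r with ¬ (0 ≤ affEval (f r) (y x) ↔ 0 ≤ affEval (f r) (y z)), μ r :=
    fun x hx z hz hxz => not_le.1 fun h => hnot ⟨x, hx, z, hz, hxz, h⟩
  set m : ℝ := (#P : ℝ) with hm
  have hm2 : (2 : ℝ) ≤ m := by rw [hm]; exact_mod_cast hP
  set δ : ℝ := 4 * 10 ^ 8 * c ^ 2 / m with hδ
  have hδ0 : 0 < δ := by positivity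
  have hδ1 : δ < 1 := by
    obtain ⟨x, hx, z, hz, hxz⟩ := one_lt_card.1 (show 1 < #P by omega)
    refine (hcon x hx z hz hxz).trans_le ?_
    rw [← hμ]
    exact sum_le_sum_of_subset_of_nonneg (filter_subset _ _) fun r _ _ => hμ0 r
  have hmbig : 4 * 10 ^ 8 * c ^ 2 < m := by rwa [hδ, div_lt_one (by linarith)] at hδ1
  set τ : ℝ := 2 * c ^ 3 / m with hτ
  have hτ0 : 0 < τ := by positivity
  set D : α → ℝ := fun x => ∑ r with 0 ≤ affEval (f r) (y x), μ r with hD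
  have hDsum : ∑ x ∈ P, D x ≤ c ^ 3 := by
    have : ∑ x ∈ P, D x = ∑ r, μ r * #{x ∈ P | 0 ≤ affEval (f r) (y x)} := by
      simp only [hD, sum_filter]
      rw [sum_comm]
      refine sum_congr rfl fun r _ => ?_
      rw [← sum_filter, sum_const, nsmul_eq_mul, mul_comm]
    rw [this]
    calc _ ≤ ∑ r, μ r * c ^ 3 := sum_le_sum fun r _ => mul_le_mul_of_nonneg_left (hk r) (hμ0 r)
      _ = c ^ 3 := by rw [← sum_mul, hμ, one_mul]
  have hdeep : (#{x ∈ P | ¬ D x ≤ τ} : ℝ) ≤ m / 2 := by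
    have h1 : (#{x ∈ P | ¬ D x ≤ τ} : ℝ) * τ ≤ c ^ 3 := by
      refine le_trans ?_ hDsum
      calc (#{x ∈ P | ¬ D x ≤ τ} : ℝ) * τ = ∑ x ∈ P with ¬ D x ≤ τ, τ := by simp
        _ ≤ ∑ x ∈ P with ¬ D x ≤ τ, D x :=
          sum_le_sum fun x hx => (not_le.1 (mem_filter.1 hx).2).le
        _ ≤ _ := sum_le_sum_of_subset_of_nonneg (filter_subset _ _) fun x _ _ =>
          sum_nonneg fun r _ => hμ0 r
    have h2 : m / 2 * τ = c ^ 3 := by rw [hτ]; field_simp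
    rw [← h2] at h1
    exact le_of_mul_le_mul_right h1 hτ0
  have hshallow : m / 2 ≤ (#{x ∈ P | D x ≤ τ} : ℝ) := by
    have : (#{x ∈ P | D x ≤ τ} : ℝ) + #{x ∈ P | ¬ D x ≤ τ} = m := by
      rw [hm]
      exact_mod_cast card_filter_add_card_filter_not (fun x => D x ≤ τ)
    linarith
  have h := card_shallow_separated_le f y hy {x ∈ P | D x ≤ τ} hδ0 hδ1.le hτ0.le hμ0 hμ
    (fun x hx z hz hxz => (hcon x (mem_filter.1 hx).1 z (mem_filter.1 hz).1 hxz).le)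
    (fun x hx => (mem_filter.1 hx).2)
  have hτδ : 52 * τ / δ + 2 ≤ 3 * c := by
    have : 52 * τ / δ = 104 * c / (4 * 10 ^ 8) := by
      rw [hτ, hδ]; field_simp; ring
    rw [this]; linarith
  have h3 : 13 / δ * (289 * (52 * τ / δ + 2)) ^ 2 ≤ m / 40 := by
    calc 13 / δ * (289 * (52 * τ / δ + 2)) ^ 2 ≤ 13 / δ * (289 * (3 * c)) ^ 2 := by gcongr
      _ = 13 * 867 ^ 2 / (4 * 10 ^ 8) * m := by rw [hδ]; field_simp; ring
      _ ≤ m / 40 := by linarith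
  nlinarith

open Classical in
/-- `L` is a list of disjoint pairs of elements of `P` leaving out at most one element. -/
def IsMatchingOf : List (α × α) → Finset α → Prop
  | [], P => #P ≤ 1
  | (x, z) :: L, P => x ∈ P ∧ z ∈ P ∧ x ≠ z ∧ IsMatchingOf L (P \ {x, z})

open Classical in
lemma exists_matching_low_crossing (f : R → Fin 4 → ℝ)
    (y : α → Fin 4 → ℝ) (hy : ∀ x, y x 0 = 1) {c : ℝ} (hc : 1 ≤ c) (m : ℕ) :
    ∀ (P : Finset α) (w : R → ℝ), #P = m →
    (∀ r, (#{x ∈ P | 0 ≤ affEval (f r) (y x)} : ℝ) ≤ c ^ 3) → (∀ r, 0 < w r) → Nonempty R →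
    ∃ L, IsMatchingOf L P ∧ ∑ r, w r * (L.map fun e =>
        if 0 ≤ affEval (f r) (y e.1) ↔ 0 ≤ affEval (f r) (y e.2) then (1 : ℝ) else 2).prod ≤
      (∑ r, w r) * Real.exp (4 * 10 ^ 8 * c ^ 2 * ∑ i ∈ range m, ((i : ℝ) + 1)⁻¹) := by
  induction m using Nat.strong_induction_on with
  | _ m ih =>
    intro P w hm hk hw hR
    rcases Nat.lt_or_ge m 2 with h2 | h2
    · refine ⟨[], by simp only [IsMatchingOf]; omega, ?_⟩
      simp only [List.map_nil, List.prod_nil, mul_one]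
      refine le_mul_of_one_le_right (sum_nonneg fun r _ => (hw r).le) (Real.one_le_exp ?_)
      positivity
    have hpos : 0 < ∑ r, w r := sum_pos (fun r _ => hw r) univ_nonempty
    obtain ⟨x, hx, z, hz, hxz, hsep⟩ := exists_pair_rarely_separated (μ := fun r => w r / ∑ r, w r)
      f y hy P (by omega) hc hk (fun r => div_nonneg (hw r).le hpos.le)
      (by rw [← sum_div, div_self hpos.ne'])
    rw [← sum_div, div_le_iff₀ hpos, hm] at hsep
    have hsub : ({x, z} : Finset α) ⊆ P := by
      intro u hu
      rcases mem_insert.1 hu with rfl | hu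
      · exact hx
      · rwa [mem_singleton.1 hu]
    obtain ⟨L, hL, hLw⟩ := ih (m - 2) (by omega) (P \ {x, z}) (fun r => w r *
      if 0 ≤ affEval (f r) (y x) ↔ 0 ≤ affEval (f r) (y z) then (1 : ℝ) else 2)
      (by rw [card_sdiff_of_subset hsub, card_pair hxz, hm])
      (fun r => le_trans (by
        norm_cast
        exact card_le_card (filter_subset_filter _ sdiff_subset)) (hk r))
      (fun r => mul_pos (hw r) (by split_ifs <;> norm_num)) hR
    refine ⟨(x, z) :: L, ⟨hx, hz, hxz, hL⟩, ?_⟩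
    simp only [List.map_cons, List.prod_cons, ← mul_assoc]
    refine hLw.trans ?_
    have hw' : ∑ r, (w r * if 0 ≤ affEval (f r) (y x) ↔ 0 ≤ affEval (f r) (y z) then (1 : ℝ)
        else 2) = ∑ r, w r + ∑ r with ¬ (0 ≤ affEval (f r) (y x) ↔ 0 ≤ affEval (f r) (y z)), w r := by
      rw [sum_filter, ← sum_add_distrib]
      refine sum_congr rfl fun r _ => ?_
      split_ifs <;> ring
    rw [hw']
    set q := 4 * 10 ^ 8 * c ^ 2 with hq
    have hq0 : 0 ≤ q := by positivity
    have hharm : ∑ i ∈ range (m - 2), ((i : ℝ) + 1)⁻¹ + (m : ℝ)⁻¹ ≤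
        ∑ i ∈ range m, ((i : ℝ) + 1)⁻¹ := by
      obtain ⟨n, rfl⟩ : ∃ n, m = n + 2 := ⟨m - 2, by omega⟩
      rw [Nat.add_sub_cancel, sum_range_succ, sum_range_succ]
      push_cast
      have : (0 : ℝ) ≤ ((n : ℝ) + 1)⁻¹ := by positivity
      have e : (n : ℝ) + 2 = n + 1 + 1 := by ring
      rw [e]
      linarith
    calc _ ≤ ((∑ r, w r) * Real.exp (q * (m : ℝ)⁻¹)) *
          Real.exp (q * ∑ i ∈ range (m - 2), ((i : ℝ) + 1)⁻¹) := by
          refine mul_le_mul_of_nonneg_right ?_ (Real.exp_pos _).le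
          have := Real.add_one_le_exp (q * (m : ℝ)⁻¹)
          rw [div_eq_mul_inv] at hsep
          nlinarith
      _ = (∑ r, w r) * Real.exp (q * (∑ i ∈ range (m - 2), ((i : ℝ) + 1)⁻¹ + (m : ℝ)⁻¹)) := by
          rw [mul_assoc, ← Real.exp_add]; ring_nf
      _ ≤ _ := by gcongr

open Classical in
/-- Choosing one endpoint from each pair of a matching, by the method of conditional
expectations. -/
lemma exists_endpoints_exp_sum_le {J : Type*} [Fintype J] (v : J → α → ℝ) (L : List (α × α)) :
    ∀ (P : Finset α) (w : J → ℝ), IsMatchingOf L P → (∀ j, 0 ≤ w j) →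
    ∃ Z ⊆ P, ∃ W ⊆ P, #W ≤ 1 ∧ 2 * #Z + #W = #P ∧
      ∑ j, w j * Real.exp (2 * ∑ x ∈ Z, v j x - ∑ x ∈ P \ W, v j x) ≤
      ∑ j, w j * (L.map fun e => Real.cosh (v j e.1 - v j e.2)).prod := by
  induction L with
  | nil =>
    intro P w hP hw
    exact ⟨∅, by simp, P, Subset.refl _, hP, by simp, by simp⟩
  | cons e L ih =>
    obtain ⟨x, z⟩ := e
    rintro P w ⟨hx, hz, hxz, hL⟩ hw
    have hsub : ({x, z} : Finset α) ⊆ P := by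
      intro u hu
      rcases mem_insert.1 hu with rfl | hu
      · exact hx
      · rwa [mem_singleton.1 hu]
    obtain ⟨Z, hZ, W, hW, hW1, hcard, hle⟩ := ih (P \ {x, z})
      (fun j => w j * Real.cosh (v j x - v j z)) hL
      (fun j => mul_nonneg (hw j) (Real.cosh_pos _).le)
    rw [card_sdiff_of_subset hsub, card_pair hxz] at hcard
    have hP2 : 2 ≤ #P := by rw [← card_pair hxz]; exact card_le_card hsub
    have hxZ : x ∉ Z := fun h => by simpa using hZ h
    have hzZ : z ∉ Z := fun h => by simpa using hZ h
    have hxW : x ∉ W := fun h => by simpa using hW h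
    have hzW : z ∉ W := fun h => by simpa using hW h
    have hsum : ∀ j, ∑ u ∈ P \ W, v j u = v j x + v j z + ∑ u ∈ (P \ {x, z}) \ W, v j u := by
      intro j
      have : P \ W = {x, z} ∪ ((P \ {x, z}) \ W) := by
        ext u
        simp only [Finset.mem_sdiff, mem_union, mem_insert, mem_singleton]
        constructor
        · tauto
        · rintro ((rfl | rfl) | h)
          · exact ⟨hx, hxW⟩
          · exact ⟨hz, hzW⟩
          · exact ⟨h.1.1, h.2⟩
      rw [this, sum_union, sum_pair hxz]
      exact disjoint_left.2 fun u hu hu' => (Finset.mem_sdiff.1 (Finset.mem_sdiff.1 hu').1).2 hu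
    set T : J → ℝ := fun j => 2 * ∑ u ∈ Z, v j u - ∑ u ∈ (P \ {x, z}) \ W, v j u with hT
    have hhalf : ∑ j, w j * Real.exp (v j x - v j z + T j) +
        ∑ j, w j * Real.exp (v j z - v j x + T j) =
        2 * ∑ j, w j * Real.cosh (v j x - v j z) * Real.exp (T j) := by
      rw [← sum_add_distrib, mul_sum]
      refine sum_congr rfl fun j _ => ?_
      rw [Real.cosh_eq, Real.exp_add, Real.exp_add, neg_sub]
      ring
    have hgoal : ∑ j, w j * (((x, z) :: L).map fun e => Real.cosh (v j e.1 - v j e.2)).prod =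
        ∑ j, w j * Real.cosh (v j x - v j z) * (L.map fun e => Real.cosh (v j e.1 - v j e.2)).prod := by
      simp only [List.map_cons, List.prod_cons, mul_assoc]
    rw [hgoal]
    have hWP : W ⊆ P := hW.trans sdiff_subset
    rcases le_total (∑ j, w j * Real.exp (v j x - v j z + T j))
      (∑ j, w j * Real.exp (v j z - v j x + T j)) with h | h
    · refine ⟨insert x Z, insert_subset hx (hZ.trans sdiff_subset), W, hWP, hW1, ?_, ?_⟩
      · rw [card_insert_of_notMem hxZ]; omega
      · refine le_trans (le_of_eq ?_) ((show _ ≤ _ by linarith : ∑ j, w j *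
          Real.exp (v j x - v j z + T j) ≤ _).trans hle)
        refine sum_congr rfl fun j _ => ?_
        rw [sum_insert hxZ, hsum j, hT]
        ring_nf
    · refine ⟨insert z Z, insert_subset hz (hZ.trans sdiff_subset), W, hWP, hW1, ?_, ?_⟩
      · rw [card_insert_of_notMem hzZ]; omega
      · refine le_trans (le_of_eq ?_) ((show _ ≤ _ by linarith : ∑ j, w j *
          Real.exp (v j z - v j x + T j) ≤ _).trans hle)
        refine sum_congr rfl fun j _ => ?_
        rw [sum_insert hzZ, hsum j, hT]
        ring_nf

end Matching

lemma card_le_pow_of_shatters_card_le {α : Type*} [DecidableEq α] (P : Finset α)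
    (𝒜 : Finset (Finset α)) (hP : ∀ S ∈ 𝒜, S ⊆ P) (h4 : ∀ B, 𝒜.Shatters B → #B ≤ 4) :
    #𝒜 ≤ (#P + 1) ^ 4 := by
  have hsub : 𝒜.shatterer ⊆ (range 5).biUnion fun i => P.powersetCard i := by
    intro B hB
    rw [mem_shatterer] at hB
    obtain ⟨S, hS, hBS⟩ := hB (Subset.refl B)
    simp only [mem_biUnion, mem_range, mem_powersetCard]
    exact ⟨#B, by have := h4 B hB; omega, (inter_eq_left.1 hBS).trans (hP S hS), rfl⟩
  calc #𝒜 ≤ #𝒜.shatterer := card_le_card_shatterer 𝒜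
    _ ≤ ∑ i ∈ range 5, #(P.powersetCard i) := (card_le_card hsub).trans card_biUnion_le
    _ ≤ ∑ i ∈ range 5, #P ^ i := sum_le_sum fun i _ => by
        rw [card_powersetCard]; exact Nat.choose_le_pow _ _
    _ ≤ (#P + 1) ^ 4 := by
        simp only [sum_range_succ, sum_range_zero]
        ring_nf
        nlinarith [Nat.zero_le (#P), Nat.zero_le (#P ^ 2), Nat.zero_le (#P ^ 3)]

open Classical in
/-- Halving a point set with small error on shallow halfspaces. -/
lemma exists_halving {α : Type*} (y : α → Fin 4 → ℝ) (hy : ∀ x, y x 0 = 1) (P : Finset α)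
    (hP : 1 ≤ #P) {c : ℝ} (hc : 1 ≤ c) :
    ∃ Z ⊆ P, 2 * #Z ≤ #P ∧ #P ≤ 2 * #Z + 1 ∧ ∀ g : Fin 4 → ℝ,
      (#{x ∈ P | 0 ≤ affEval g (y x)} : ℝ) ≤ c ^ 3 →
      |2 * (#{x ∈ Z | 0 ≤ affEval g (y x)} : ℝ) - #{x ∈ P | 0 ≤ affEval g (y x)}| ≤
        2 * 10 ^ 9 * c * Real.log (#P + 1) := by
  have hc0 : 0 < c := by linarith
  set 𝒜 : Finset (Finset α) := {S ∈ P.powerset | (#S : ℝ) ≤ c ^ 3 ∧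
    ∃ g : Fin 4 → ℝ, S = {x ∈ P | 0 ≤ affEval g (y x)}} with h𝒜
  have h𝒜P : ∀ S ∈ 𝒜, S ⊆ P := fun S hS => mem_powerset.1 (mem_filter.1 hS).1
  have h𝒜card : #𝒜 ≤ (#P + 1) ^ 4 := by
    refine card_le_pow_of_shatters_card_le P 𝒜 h𝒜P fun B hB => ?_
    by_contra! hlt
    obtain ⟨S, hS, hBS⟩ := hB (Subset.refl B)
    have hBP : B ⊆ P := (inter_eq_left.1 hBS).trans (h𝒜P S hS)
    obtain ⟨T, hT, hno⟩ := not_shattered_by_halfspaces B y hlt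
    obtain ⟨S, hS, rfl⟩ := hB hT
    obtain ⟨-, -, g, rfl⟩ := mem_filter.1 hS
    exact hno g fun i hi => by simp [hi, hBP hi]
  have hf : ∀ S : 𝒜, ∃ g : Fin 4 → ℝ, (S : Finset α) = {x ∈ P | 0 ≤ affEval g (y x)} :=
    fun S => (mem_filter.1 S.2).2.2
  choose f hf using hf
  have hne : Nonempty 𝒜 := by
    refine ⟨⟨∅, mem_filter.2 ⟨empty_mem_powerset _, by simp; positivity, ![-1, 0, 0, 0], ?_⟩⟩⟩
    symm
    rw [filter_eq_empty_iff]
    intro x _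
    simp [affEval, hy]
  set n := #P with hn
  have hn1 : (1 : ℝ) ≤ n := by exact_mod_cast hP
  set Λ := Real.log (n + 1) with hΛ
  have hlog2 : (0.69 : ℝ) < Real.log 2 := by have := Real.log_two_gt_d9; linarith
  have hΛ2 : Real.log 2 ≤ Λ := Real.log_le_log (by norm_num) (by linarith)
  have hlogA : Real.log (#𝒜) ≤ 4 * Λ := by
    have hpos : (0 : ℝ) < #𝒜 := by
      have : Nonempty 𝒜 := hne
      exact_mod_cast card_pos.2 (nonempty_coe_sort.1 this)
    have h1 : (#𝒜 : ℝ) ≤ (n + 1) ^ 4 := by exact_mod_cast h𝒜card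
    calc Real.log (#𝒜) ≤ Real.log (((n : ℝ) + 1) ^ 4) := Real.log_le_log hpos h1
      _ = 4 * Λ := by rw [Real.log_pow]; norm_num [hΛ]
  have hA0 : (0 : ℝ) < #𝒜 := by
    exact_mod_cast card_pos.2 (nonempty_coe_sort.1 hne)
  obtain ⟨L, hL, hLw⟩ := exists_matching_low_crossing f y hy hc n P (fun _ => 1) rfl
    (fun S => by rw [← hf S]; exact (mem_filter.1 S.2).2.1) (fun _ => one_pos) hne
  have hharm : ∑ i ∈ range n, ((i : ℝ) + 1)⁻¹ ≤ 3 * Λ := by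
    have h1 := harmonic_le_one_add_log n
    have h2 : ((harmonic n : ℚ) : ℝ) = ∑ i ∈ range n, ((i : ℝ) + 1)⁻¹ := by
      rw [harmonic]; push_cast; rfl
    have h3 : Real.log n ≤ Λ := Real.log_le_log (by linarith) (by linarith)
    rw [h2] at h1
    linarith
  set q : ℝ := 4 * 10 ^ 8 * c ^ 2 with hq
  have hq0 : 0 ≤ q := by positivity
  have hcross : ∀ S : 𝒜, (L.map fun e =>
      if 0 ≤ affEval (f S) (y e.1) ↔ 0 ≤ affEval (f S) (y e.2) then (1 : ℝ) else 2).prod ≤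
      Real.exp ((4 + 3 * q) * Λ) := by
    intro S
    have h1 : (L.map fun e =>
      if 0 ≤ affEval (f S) (y e.1) ↔ 0 ≤ affEval (f S) (y e.2) then (1 : ℝ) else 2).prod ≤
      ∑ r, 1 * (L.map fun e =>
      if 0 ≤ affEval (f r) (y e.1) ↔ 0 ≤ affEval (f r) (y e.2) then (1 : ℝ) else 2).prod := by
      simp only [one_mul]
      refine single_le_sum (f := fun r => (L.map fun e =>
        if 0 ≤ affEval (f r) (y e.1) ↔ 0 ≤ affEval (f r) (y e.2) then (1 : ℝ) else 2).prod)
        (fun r _ => List.prod_nonneg fun a ha => ?_) (mem_univ S)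
      obtain ⟨e, -, rfl⟩ := List.mem_map.1 ha
      split_ifs <;> norm_num
    refine h1.trans (hLw.trans ?_)
    simp only [sum_const, card_univ, Fintype.card_coe, nsmul_eq_mul, mul_one]
    rw [← Real.exp_log hA0, ← Real.exp_add, Real.exp_le_exp]
    nlinarith
  have hcosh : ∀ S : 𝒜, ∀ s : ℝ, |s| = 1 → (L.map fun e =>
      Real.cosh ((if 0 ≤ affEval (f S) (y e.1) then s / c else 0) -
        (if 0 ≤ affEval (f S) (y e.2) then s / c else 0))).prod ≤
      Real.exp ((4 + 3 * q) * Λ / c ^ 2) := by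
    intro S s hs
    have key : ∀ e : α × α, Real.cosh ((if 0 ≤ affEval (f S) (y e.1) then s / c else 0) -
        (if 0 ≤ affEval (f S) (y e.2) then s / c else 0)) ≤
        (if 0 ≤ affEval (f S) (y e.1) ↔ 0 ≤ affEval (f S) (y e.2) then (1 : ℝ) else 2) ^
          (1 / c ^ 2) := by
      intro e
      have hs2 : Real.cosh (s / c) ≤ 2 ^ (1 / c ^ 2) := by
        refine (Real.cosh_le_exp_half_sq _).trans ?_
        rw [Real.rpow_def_of_pos (by norm_num), Real.exp_le_exp, div_pow, ← sq_abs s, hs]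
        have : 0 < 1 / c ^ 2 := by positivity
        nlinarith
      by_cases h1 : 0 ≤ affEval (f S) (y e.1) <;> by_cases h2 : 0 ≤ affEval (f S) (y e.2)
      · simp [h1, h2]
      · simpa [h1, h2] using hs2
      · simpa [h1, h2] using hs2
      · simp [h1, h2]
    have hprod : ∀ L : List (α × α), (L.map fun e =>
      Real.cosh ((if 0 ≤ affEval (f S) (y e.1) then s / c else 0) -
        (if 0 ≤ affEval (f S) (y e.2) then s / c else 0))).prod ≤ (L.map fun e =>
        if 0 ≤ affEval (f S) (y e.1) ↔ 0 ≤ affEval (f S) (y e.2) then (1 : ℝ) else 2).prod ^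
          (1 / c ^ 2) ∧ 0 ≤ (L.map fun e =>
        if 0 ≤ affEval (f S) (y e.1) ↔ 0 ≤ affEval (f S) (y e.2) then (1 : ℝ) else 2).prod := by
      intro L
      induction L with
      | nil => simp
      | cons e L ih =>
        simp only [List.map_cons, List.prod_cons]
        have h0 : (0 : ℝ) ≤ if 0 ≤ affEval (f S) (y e.1) ↔ 0 ≤ affEval (f S) (y e.2) then
          (1 : ℝ) else 2 := by split_ifs <;> norm_num
        refine ⟨?_, mul_nonneg h0 ih.2⟩
        rw [Real.mul_rpow h0 ih.2]
        refine mul_le_mul (key e) ih.1 (List.prod_nonneg fun a ha => ?_) (by positivity)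
        obtain ⟨e, -, rfl⟩ := List.mem_map.1 ha
        exact (Real.cosh_pos _).le
    refine (hprod L).1.trans ((Real.rpow_le_rpow (hprod L).2 (hcross S) (by positivity)).trans ?_)
    rw [← Real.exp_mul]
    exact le_of_eq (by ring_nf)
  set sg : Bool → ℝ := fun b => if b then 1 else -1 with hsg
  have hsg1 : ∀ b, |sg b| = 1 := by intro b; cases b <;> simp [hsg]
  obtain ⟨Z, hZ, W, hW, hW1, hcard, hexp⟩ := exists_endpoints_exp_sum_le
    (fun (j : 𝒜 × Bool) x => if 0 ≤ affEval (f j.1) (y x) then sg j.2 / c else 0) L P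
    (fun _ => 1) hL (fun _ => zero_le_one)
  have hexp2 : ∀ j : 𝒜 × Bool, sg j.2 / c * (2 * #{x ∈ Z | 0 ≤ affEval (f j.1) (y x)} -
      #{x ∈ P \ W | 0 ≤ affEval (f j.1) (y x)}) ≤ (5 + (4 + 3 * q) / c ^ 2) * Λ := by
    intro j
    have h1 := single_le_sum (f := fun j : 𝒜 × Bool => 1 * Real.exp
      (2 * ∑ x ∈ Z, (if 0 ≤ affEval (f j.1) (y x) then sg j.2 / c else 0) -
        ∑ x ∈ P \ W, (if 0 ≤ affEval (f j.1) (y x) then sg j.2 / c else 0)))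
        (fun j _ => by positivity) (mem_univ j)
    have h2 := (h1.trans hexp).trans (sum_le_sum fun j _ => mul_le_mul_of_nonneg_left
      (hcosh j.1 (sg j.2) (hsg1 j.2)) zero_le_one)
    simp only [one_mul, sum_const, card_univ, Fintype.card_prod, Fintype.card_coe,
      Fintype.card_bool, nsmul_eq_mul, Nat.cast_mul, Nat.cast_ofNat] at h2
    have h3 : ((#𝒜 : ℝ) * 2) = Real.exp (Real.log (#𝒜) + Real.log 2) := by
      rw [Real.exp_add, Real.exp_log hA0, Real.exp_log (by norm_num)]
    rw [h3, ← Real.exp_add, Real.exp_le_exp, ← sum_filter, ← sum_filter, sum_const, sum_const,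
      nsmul_eq_mul, nsmul_eq_mul] at h2
    have h4 : (4 + 3 * q) * Λ / c ^ 2 = (4 + 3 * q) / c ^ 2 * Λ := by ring
    rw [h4] at h2
    linarith
  refine ⟨Z, hZ, by omega, by omega, fun g hg => ?_⟩
  obtain ⟨S, hS⟩ : ∃ S : 𝒜, (S : Finset α) = {x ∈ P | 0 ≤ affEval g (y x)} :=
    ⟨⟨_, mem_filter.2 ⟨mem_powerset.2 (filter_subset _ _), hg, g, rfl⟩⟩, rfl⟩
  have hfS : ∀ x ∈ P, 0 ≤ affEval (f S) (y x) ↔ 0 ≤ affEval g (y x) := by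
    intro x hx
    have h1 : x ∈ (S : Finset α) ↔ 0 ≤ affEval (f S) (y x) := by
      conv_lhs => rw [hf S]
      simp [hx]
    have h2 : x ∈ (S : Finset α) ↔ 0 ≤ affEval g (y x) := by rw [hS]; simp [hx]
    exact h1.symm.trans h2
  have eZ : {x ∈ Z | 0 ≤ affEval (f S) (y x)} = {x ∈ Z | 0 ≤ affEval g (y x)} :=
    filter_congr fun x hx => hfS x (hZ hx)
  have eW : {x ∈ P \ W | 0 ≤ affEval (f S) (y x)} = {x ∈ P \ W | 0 ≤ affEval g (y x)} :=
    filter_congr fun x hx => hfS x (Finset.mem_sdiff.1 hx).1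
  have h1 := hexp2 (S, true)
  have h2 := hexp2 (S, false)
  simp only [eZ, eW, hsg, if_true, Bool.false_eq_true, if_false] at h1 h2
  have hPW : (#{x ∈ P \ W | 0 ≤ affEval g (y x)} : ℝ) ≤ #{x ∈ P | 0 ≤ affEval g (y x)} := by
    norm_cast
    exact card_le_card (filter_subset_filter _ sdiff_subset)
  have hPW' : (#{x ∈ P | 0 ≤ affEval g (y x)} : ℝ) ≤
      #{x ∈ P \ W | 0 ≤ affEval g (y x)} + 1 := by
    norm_cast
    calc #{x ∈ P | 0 ≤ affEval g (y x)} ≤ #({x ∈ P \ W | 0 ≤ affEval g (y x)} ∪ W) := by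
          refine card_le_card fun x hx => ?_
          simp only [mem_filter, mem_union, Finset.mem_sdiff] at hx ⊢
          tauto
      _ ≤ _ := (card_union_le _ _).trans (by omega)
  set D : ℝ := 2 * #{x ∈ Z | 0 ≤ affEval g (y x)} - #{x ∈ P \ W | 0 ≤ affEval g (y x)} with hD
  have hΛ0 : 0 < Λ := by linarith
  have hbound : (5 + (4 + 3 * q) / c ^ 2) * Λ ≤ (1.2 * 10 ^ 9 + 9) * Λ := by
    refine mul_le_mul_of_nonneg_right ?_ hΛ0.le
    have : (4 + 3 * q) / c ^ 2 ≤ 1.2 * 10 ^ 9 + 4 := by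
      rw [div_le_iff₀ (by positivity), hq]
      nlinarith
    linarith
  have hD1 : D ≤ c * ((1.2 * 10 ^ 9 + 9) * Λ) := by
    have h := h1.trans hbound
    rw [div_mul_eq_mul_div, div_le_iff₀ hc0] at h
    linarith
  have hD2 : -D ≤ c * ((1.2 * 10 ^ 9 + 9) * Λ) := by
    have h := h2.trans hbound
    rw [div_mul_eq_mul_div, div_le_iff₀ hc0] at h
    linarith
  have hcΛ : 0.69 ≤ c * Λ := by nlinarith
  rw [abs_le]
  constructor <;> nlinarith

lemma one_le_log_two_div {ε p : ℝ} (hε : 0 < ε) (hε1 : ε < 1 / 2) (hp : 0 < p) (hp1 : p < 1) :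
    1 ≤ Real.log (2 / (ε * p)) := by
  have h1 : Real.log 4 ≤ Real.log (2 / (ε * p)) := by
    refine Real.log_le_log (by norm_num) ?_
    rw [le_div_iff₀ (by positivity)]
    nlinarith
  have h2 : Real.log 4 = 2 * Real.log 2 := by
    rw [show (4 : ℝ) = 2 ^ 2 by norm_num, Real.log_pow]; norm_num
  have := Real.log_two_gt_d9
  linarith

lemma log_approx_size_le {ε p D : ℝ} (hε : 0 < ε) (hε1 : ε < 1 / 2) (hp : 0 < p) (hp1 : p < 1)
    (hD : 1 ≤ D) :
    Real.log ((D * √(Real.log (2 / (ε * p)) / ε)) ^ 3 / p) ≤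
      3 * D + 3 * Real.log (2 / (ε * p)) := by
  have hL := one_le_log_two_div hε hε1 hp hp1
  set L := Real.log (2 / (ε * p)) with hLdef
  have hLe : L = Real.log 2 - (Real.log ε + Real.log p) := by
    rw [hLdef, Real.log_div (by norm_num) (by positivity), Real.log_mul hε.ne' hp.ne']
  have hs : 0 < √(L / ε) := Real.sqrt_pos.2 (by positivity)
  rw [Real.log_div (by positivity) hp.ne', Real.log_pow, Real.log_mul (by positivity) hs.ne',
    Real.log_sqrt (by positivity), Real.log_div (by positivity) hε.ne']
  have h1 := Real.log_le_sub_one_of_pos (show 0 < D by linarith)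
  have h2 := Real.log_le_sub_one_of_pos (show 0 < L by linarith)
  have h3 := Real.log_neg hε (by linarith)
  have h4 := Real.log_neg hp hp1
  have h5 := Real.log_two_gt_d9
  push_cast
  linarith

set_option maxHeartbeats 800000 in
lemma halving_step_error_le {ε p x K D : ℝ} (hε : 0 < ε) (hε1 : ε < 1 / 2) (hp : 0 < p)
    (hp1 : p < 1) (hK : 1 ≤ K) (hD : D = 130 * K)
    (hx : (D * √(Real.log (2 / (ε * p)) / ε)) ^ 3 / p ≤ x) :
    ∃ c, 1 ≤ c ∧ 2 * (p * x) ≤ c ^ 3 ∧ K * c * Real.log (x + 1) / x ≤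
      0.4 * √((ε * p / 2) ^ 2 * ((D * √(Real.log (2 / (ε * p)) / ε)) ^ 3 / p) / x) := by
  have hD1 : 1 ≤ D := by linarith
  have hlogM := log_approx_size_le hε hε1 hp hp1 hD1
  have hL := one_le_log_two_div hε hε1 hp hp1
  set L := Real.log (2 / (ε * p))
  set w := D * √(L / ε) with hw
  have hw2 : w ^ 2 = D ^ 2 * (L / ε) := by rw [hw, mul_pow, Real.sq_sqrt (by positivity)]
  have hw1 : 1 ≤ w := by
    have : 1 ≤ √(L / ε) := by
      rw [Real.one_le_sqrt, le_div_iff₀ hε]; linarith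
    rw [hw]; nlinarith
  have hw0 : 0 < w := by linarith
  set M := w ^ 3 / p with hM
  have hpM : p * M = w ^ 3 := by rw [hM]; field_simp
  have hM1 : 1 ≤ M := by
    rw [hM, le_div_iff₀ hp]; nlinarith [one_le_pow₀ hw1 (n := 3)]
  have hM0 : 0 < M := by linarith
  have hx0 : 0 < x := by linarith
  set s := (x / M) ^ (1 / 6 : ℝ) with hs
  have hs6 : s ^ 6 = x / M := by
    rw [hs, ← Real.rpow_natCast, ← Real.rpow_mul (by positivity)]; norm_num
  have hs1 : 1 ≤ s := Real.one_le_rpow (by rwa [le_div_iff₀ hM0, one_mul]) (by norm_num)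
  have hs0 : 0 < s := by linarith
  have hxs : x = M * s ^ 6 := by rw [hs6]; field_simp
  refine ⟨2 * w * s ^ 2, by nlinarith [one_le_pow₀ hs1 (n := 2)], ?_, ?_⟩
  · have : p * x = (w * s ^ 2) ^ 3 := by rw [hxs, ← mul_assoc, hpM]; ring
    rw [this]
    have : 0 ≤ (w * s ^ 2) ^ 3 := by positivity
    nlinarith
  · have hsq : √((ε * p / 2) ^ 2 * M / x) = ε * p / 2 / s ^ 3 := by
      rw [show (ε * p / 2) ^ 2 * M / x = (ε * p / 2 / s ^ 3) ^ 2 by rw [hxs]; field_simp,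
        Real.sqrt_sq (by positivity)]
    rw [hsq, div_le_iff₀ hx0]
    have hlog : Real.log (x + 1) ≤ 13 * (D * L * s) := by
      have h1 : Real.log (x + 1) ≤ Real.log (2 * (M * s ^ 6)) :=
        Real.log_le_log (by linarith) (by rw [← hxs]; linarith)
      rw [Real.log_mul (by norm_num) (by positivity), Real.log_mul (by positivity) (by positivity),
        Real.log_pow] at h1
      have h2 := Real.log_le_sub_one_of_pos hs0
      have h3 := Real.log_two_lt_d9
      push_cast at h1
      have hDL : 1 ≤ D * L := one_le_mul_of_one_le_of_one_le hD1 hL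
      have hLs : 1 ≤ L * s := one_le_mul_of_one_le_of_one_le hL hs1
      have hDs : 1 ≤ D * s := one_le_mul_of_one_le_of_one_le hD1 hs1
      have a1 : D ≤ D * L * s := by
        rw [mul_assoc]; exact le_mul_of_one_le_right (by linarith) hLs
      have a2 : L ≤ D * L * s := by
        rw [mul_comm D, mul_assoc]; exact le_mul_of_one_le_right (by linarith) hDs
      have a3 : s ≤ D * L * s := le_mul_of_one_le_left hs0.le hDL
      linarith
    have hkey : 0.4 * (ε * p / 2 / s ^ 3) * x = 0.2 * w * (D ^ 2 * L) * s ^ 3 := by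
      have : ε * (p * M) = w * (D ^ 2 * L) := by
        rw [hpM, show w ^ 3 = w * w ^ 2 by ring, hw2]; field_simp
      rw [hxs]
      calc 0.4 * (ε * p / 2 / s ^ 3) * (M * s ^ 6) = 0.2 * (ε * (p * M)) * s ^ 3 := by
            field_simp; ring
        _ = _ := by rw [this]; ring
    rw [hkey]
    calc K * (2 * w * s ^ 2) * Real.log (x + 1) ≤ K * (2 * w * s ^ 2) * (13 * (D * L * s)) := by
          gcongr
      _ = 0.2 * w * (D * (130 * K) * L) * s ^ 3 := by ring
      _ = 0.2 * w * (D ^ 2 * L) * s ^ 3 := by rw [← hD]; ring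

section Iterate
variable {α : Type*} (y : α → Fin 4 → ℝ)

open Classical in
/-- The fraction of points of `Z` lying in the halfspace with coefficients `g`. -/
noncomputable def halfspaceMeas (Z : Finset α) (g : Fin 4 → ℝ) : ℝ :=
  (#{x ∈ Z | 0 ≤ affEval g (y x)} : ℝ) / #Z

lemma exists_halving_meas (hy : ∀ x, y x 0 = 1) (P : Finset α)
    (hP : 2 ≤ #P) {c : ℝ} (hc : 1 ≤ c) :
    ∃ Z ⊆ P, 2 * #Z ≤ #P ∧ #P ≤ 2 * #Z + 1 ∧ ∀ g : Fin 4 → ℝ,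
      halfspaceMeas y P g * #P ≤ c ^ 3 →
      |halfspaceMeas y Z g - halfspaceMeas y P g| ≤ 5 * 10 ^ 9 * c * Real.log (#P + 1) / #P := by
  classical
  obtain ⟨Z, hZ, hZ1, hZ2, h⟩ := exists_halving y hy P (by omega) hc
  refine ⟨Z, hZ, hZ1, hZ2, fun g hg => ?_⟩
  have hn : (2 : ℝ) ≤ #P := by exact_mod_cast hP
  have hz0 : (0 : ℝ) < #Z := by
    have : 0 < #Z := by omega
    exact_mod_cast this
  have hz1 : 2 * (#Z : ℝ) ≤ #P := by exact_mod_cast hZ1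
  have hz2 : (#P : ℝ) ≤ 2 * #Z + 1 := by exact_mod_cast hZ2
  have hn0 : (0 : ℝ) < #P := by linarith
  rw [halfspaceMeas, div_mul_cancel₀ _ hn0.ne'] at hg
  have hD := h g hg
  have hle : (#{x ∈ P | 0 ≤ affEval g (y x)} : ℝ) ≤ #P := by
    exact_mod_cast card_filter_le _ _
  simp only [halfspaceMeas]
  set u : ℝ := (#{x ∈ Z | 0 ≤ affEval g (y x)} : ℝ)
  set v : ℝ := (#{x ∈ P | 0 ≤ affEval g (y x)} : ℝ)
  set n : ℝ := (#P : ℝ)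
  set z : ℝ := (#Z : ℝ)
  have hv0 : 0 ≤ v := Nat.cast_nonneg _
  have hΛ : 0.69 < Real.log (n + 1) := by
    have h1 := Real.log_two_gt_d9
    have h2 : Real.log 2 ≤ Real.log (n + 1) := Real.log_le_log (by norm_num) (by linarith)
    linarith
  set Λ := Real.log (n + 1)
  have hcΛ : 0.69 ≤ c * Λ := by nlinarith
  have e : u / z - v / n = ((2 * u - v) + v / n * (n - 2 * z)) / (2 * z) := by
    field_simp; ring
  have hvn : v / n ≤ 1 := (div_le_one hn0).2 hle
  have hvn0 : 0 ≤ v / n := by positivity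
  have hnum : |(2 * u - v) + v / n * (n - 2 * z)| ≤ 2 * 10 ^ 9 * c * Λ + 1 := by
    refine (abs_add_le _ _).trans (add_le_add hD ?_)
    rw [abs_of_nonneg (mul_nonneg hvn0 (by linarith))]
    nlinarith
  rw [e, abs_div, abs_of_pos (show 0 < 2 * z by linarith), div_le_div_iff₀ (by linarith) hn0]
  have h4 : n ≤ 2 * (2 * z) := by linarith
  calc _ ≤ (2 * 10 ^ 9 * c * Λ + 1) * (2 * (2 * z)) := by gcongr
    _ ≤ _ := by nlinarith

lemma exists_subset_of_iterated_halving (hy : ∀ x, y x 0 = 1) (P : Finset α) {p M E : ℝ}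
    (hM : 4 ≤ M) (hE : 0 ≤ E) (hEp : √(E / M) ≤ p)
    (hstep : ∀ x, M ≤ x → ∃ c, 1 ≤ c ∧ 2 * (p * x) ≤ c ^ 3 ∧
      5 * 10 ^ 9 * c * Real.log (x + 1) / x ≤ 0.4 * √(E / x)) (n : ℕ) :
    ∀ Q ⊆ P, #Q = n → M / 4 ≤ n → (∀ g, halfspaceMeas y P g ≤ p →
      |halfspaceMeas y Q g - halfspaceMeas y P g| ≤ √(E / n)) →
    ∃ Z ⊆ P, Z.Nonempty ∧ (#Z : ℝ) ≤ M ∧ ∀ g, halfspaceMeas y P g ≤ p →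
      |halfspaceMeas y Z g - halfspaceMeas y P g| ≤ √(4 * E / M) := by
  induction n using Nat.strong_induction_on with
  | _ n ih =>
    intro Q hQ hn hMn hg
    have hn1 : (1 : ℝ) ≤ n := by linarith
    rcases le_or_gt (n : ℝ) M with h | h
    · refine ⟨Q, hQ, card_pos.1 (by rw [hn]; exact_mod_cast hn1), by rwa [hn], fun g hgp =>
        (hg g hgp).trans (Real.sqrt_le_sqrt ?_)⟩
      rw [div_le_div_iff₀ (by linarith) (by linarith)]
      nlinarith
    · obtain ⟨c, hc, hc3, hcs⟩ := hstep n h.le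
      have hn4 : 4 ≤ n := by exact_mod_cast (hM.trans h.le)
      obtain ⟨Z, hZ, hZ1, hZ2, hZg⟩ := exists_halving_meas y hy Q (by omega) hc
      rw [hn] at hZ1 hZ2 hZg
      have hz2 : (n : ℝ) ≤ 2 * #Z + 1 := by exact_mod_cast hZ2
      have hz1 : 2 * (#Z : ℝ) ≤ n := by exact_mod_cast hZ1
      have hz0 : (0 : ℝ) < #Z := by linarith
      refine ih #Z (by omega) Z (hZ.trans hQ) rfl (by linarith) fun g hgp => ?_
      have h1 := hg g hgp
      have h2 : √(E / n) ≤ p := by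
        refine (Real.sqrt_le_sqrt ?_).trans hEp
        gcongr
      have h3 := hZg g (by
        refine le_trans ?_ hc3
        have := (abs_le.1 h1).2
        nlinarith)
      have h4 : 1.4 * √(E / n) ≤ √(E / #Z) := by
        rw [show (1.4 : ℝ) = √(1.4 ^ 2) by rw [Real.sqrt_sq (by norm_num)],
          ← Real.sqrt_mul (by norm_num)]
        refine Real.sqrt_le_sqrt ?_
        calc 1.4 ^ 2 * (E / n) ≤ 1.4 ^ 2 * (E / (2 * #Z)) := by gcongr
          _ ≤ 2 * (E / (2 * #Z)) := by gcongr; norm_num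
          _ = E / #Z := by field_simp
      calc |halfspaceMeas y Z g - halfspaceMeas y P g|
          ≤ |halfspaceMeas y Z g - halfspaceMeas y Q g| +
            |halfspaceMeas y Q g - halfspaceMeas y P g| := abs_sub_le _ _ _
        _ ≤ 0.4 * √(E / n) + √(E / n) := add_le_add (h3.trans hcs) h1
        _ ≤ √(E / #Z) := by linarith

lemma exists_shallow_halfspace_approx (hy : ∀ x, y x 0 = 1) (P : Finset α) (hP : P.Nonempty)
    {ε p : ℝ} (hε : 0 < ε) (hε1 : ε < 1 / 2) (hp : 0 < p) (hp1 : p < 1) :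
    ∃ Z ⊆ P, Z.Nonempty ∧
      (#Z : ℝ) ≤ (650 * 10 ^ 9) ^ 3 * (1 / (ε ^ ((3 : ℝ) / 2) * p)) *
        Real.log (2 / (ε * p)) ^ ((3 : ℝ) / 2) ∧
      ∀ g, halfspaceMeas y P g ≤ p → |halfspaceMeas y Z g - halfspaceMeas y P g| ≤ ε * p := by
  have hL := one_le_log_two_div hε hε1 hp hp1
  have hstep := fun x => halving_step_error_le (x := x) (K := 5 * 10 ^ 9) (D := 650 * 10 ^ 9)
    hε hε1 hp hp1 (by norm_num) (by norm_num)
  set L := Real.log (2 / (ε * p))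
  have hMeq : (650 * 10 ^ 9) ^ 3 * (1 / (ε ^ ((3 : ℝ) / 2) * p)) * L ^ ((3 : ℝ) / 2) =
      (650 * 10 ^ 9 * √(L / ε)) ^ 3 / p := by
    have : √(L / ε) ^ 3 = L ^ ((3 : ℝ) / 2) / ε ^ ((3 : ℝ) / 2) := by
      rw [← Real.div_rpow (by linarith) hε.le, Real.sqrt_eq_rpow, ← Real.rpow_natCast,
        ← Real.rpow_mul (by positivity)]
      norm_num
    rw [mul_pow _ √(L / ε), this]
    field_simp
  rw [hMeq]
  have hM : 4 ≤ (650 * 10 ^ 9 * √(L / ε)) ^ 3 / p := by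
    have h1 : 1 ≤ √(L / ε) := by
      rw [Real.one_le_sqrt, le_div_iff₀ hε]; linarith
    rw [le_div_iff₀ hp, mul_pow]
    nlinarith [one_le_pow₀ h1 (n := 3)]
  set M := (650 * 10 ^ 9 * √(L / ε)) ^ 3 / p
  rcases le_or_gt (#P : ℝ) M with h | h
  · exact ⟨P, Subset.refl _, hP, h, fun g _ => by rw [sub_self, abs_zero]; positivity⟩
  · have hM0 : 0 < M := by linarith
    obtain ⟨Z, hZ, hne, hcard, hg⟩ := exists_subset_of_iterated_halving y hy P (p := p) (M := M)
      (E := (ε * p / 2) ^ 2 * M) hM (by positivity) (by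
        rw [mul_div_cancel_right₀ _ hM0.ne', Real.sqrt_sq (by positivity)]
        nlinarith) hstep #P P (Subset.refl _) rfl (by linarith)
      (fun g _ => by rw [sub_self, abs_zero]; positivity)
    refine ⟨Z, hZ, hne, hcard, fun g hgp => (hg g hgp).trans (le_of_eq ?_)⟩
    rw [show 4 * ((ε * p / 2) ^ 2 * M) / M = (ε * p) ^ 2 by field_simp; ring,
      Real.sqrt_sq (by positivity)]

end Iterate

lemma meas3_eq_halfspaceMeas (Z : Finset (ℝ × ℝ × ℝ)) (a b c d : ℝ) :
    meas3 {x : ℝ × ℝ × ℝ | 0 ≤ a * x.1 + b * x.2.1 + c * x.2.2 + d} Z =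
      halfspaceMeas (fun x => ![1, x.1, x.2.1, x.2.2]) Z ![d, a, b, c] := by
  classical
  rw [meas3, halfspaceMeas]
  congr 2
  rw [← Set.ncard_coe_finset]
  congr 1
  ext x
  have e : affEval ![d, a, b, c] ![1, x.1, x.2.1, x.2.2] =
      a * x.1 + b * x.2.1 + c * x.2.2 + d := by
    simp only [affEval, Matrix.cons_val]
    ring
  simp [e]

end Helpers

/-- Every finite point set in `ℝ³` admits a subset `Z` of size
`O((1/(ε^{3/2}p))·log^{3/2}(2/(εp)))` such that every closed halfspace `h`
with `X̄(h,P) ≤ p` satisfies `|X̄(h,Z) − X̄(h,P)| ≤ εp`. -/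
theorem shallow_halfspace_approx_3d :
    ∃ C ε₀ : ℝ, 0 < C ∧ 0 < ε₀ ∧ ε₀ < 1 ∧
      ∀ P : Finset (ℝ × ℝ × ℝ), P.Nonempty →
        ∀ ε p : ℝ, 0 < ε → ε < ε₀ → 0 < p → p < 1 →
          ∃ Z : Finset (ℝ × ℝ × ℝ), Z ⊆ P ∧ Z.Nonempty ∧
            (Z.card : ℝ) ≤
              C * (1 / (ε ^ ((3 : ℝ) / 2) * p)) *
                Real.log (2 / (ε * p)) ^ ((3 : ℝ) / 2) ∧
            ∀ a b c d : ℝ, (a, b, c) ≠ (0, 0, 0) →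
              meas3 {x : ℝ × ℝ × ℝ | 0 ≤ a * x.1 + b * x.2.1 + c * x.2.2 + d} P ≤ p →
              |meas3 {x : ℝ × ℝ × ℝ | 0 ≤ a * x.1 + b * x.2.1 + c * x.2.2 + d} Z -
                  meas3 {x : ℝ × ℝ × ℝ | 0 ≤ a * x.1 + b * x.2.1 + c * x.2.2 + d} P| ≤
                ε * p := by
  refine ⟨(650 * 10 ^ 9) ^ 3, 1 / 2, by norm_num, by norm_num, by norm_num, ?_⟩
  intro P hP ε p hε hε1 hp hp1
  obtain ⟨Z, hZ, hne, hcard, hg⟩ := exists_shallow_halfspace_approx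
    (fun x : ℝ × ℝ × ℝ => ![1, x.1, x.2.1, x.2.2]) (fun x => rfl) P hP hε hε1 hp hp1
  refine ⟨Z, hZ, hne, hcard, fun a b c d _ h => ?_⟩
  rw [meas3_eq_halfspaceMeas] at h
  rw [meas3_eq_halfspaceMeas, meas3_eq_halfspaceMeas]
  exact hg _ h
end

section
/- There is an absolute constant C > 0 with the following property. Let P be a set of n points in ℝ² in general position, meaning that no two points of P have the same x-coordinate and no three points of P are collinear. Then for all integers x, y with x ≥ y ≥ 1, the number of unordered pairs {u,v} of distinct points of P such that the number of points of P lying strictly below the (non-vertical) line through u and v is at least x and at most x + y, is at most C·n·x^{1/3}·y^{2/3}. -/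
/-- The number of points of `P` lying strictly below the non-vertical line
through `u` and `v` (assuming `u.1 ≠ v.1`). -/
noncomputable def belowCount (P : Finset (ℝ × ℝ)) (u v : ℝ × ℝ) : ℕ :=
  ((↑P : Set (ℝ × ℝ)) ∩
    {p : ℝ × ℝ | p.2 < u.2 + (v.2 - u.2) / (v.1 - u.1) * (p.1 - u.1)}).ncard

/-- The slope of the line through two points of the plane. -/
noncomputable def lineSlope (u v : ℝ × ℝ) : ℝ := (v.2 - u.2) / (v.1 - u.1)

/-- The height over `t` of the line spanned by a pair of points. -/
noncomputable def lineAt (e : (ℝ × ℝ) × (ℝ × ℝ)) (t : ℝ) : ℝ :=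
  e.1.2 + lineSlope e.1 e.2 * (t - e.1.1)

/-- No two points share an `x`-coordinate and no three points are collinear. -/
structure GeneralPosition_s19 (P : Finset (ℝ × ℝ)) : Prop where
  eq_of_fst : ∀ u ∈ P, ∀ v ∈ P, u.1 = v.1 → u = v
  ne_lineAt : ∀ u ∈ P, ∀ v ∈ P, ∀ w ∈ P, u ≠ v → u ≠ w → v ≠ w → w.2 ≠ lineAt (u, v) w.1

/-- The segments `e` and `f`, each oriented from left to right, cross in their interiors, and `f` is
the steeper one. -/
def Crosses (e f : (ℝ × ℝ) × (ℝ × ℝ)) : Prop :=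
  lineSlope e.1 e.2 < lineSlope f.1 f.2 ∧
    ∃ t, e.1.1 < t ∧ t < e.2.1 ∧ f.1.1 < t ∧ t < f.2.1 ∧ lineAt e t = lineAt f t

/-- `G` consists of left-to-right segments between points of `P`. -/
def IsSegmentGraph (P : Finset (ℝ × ℝ)) (G : Finset ((ℝ × ℝ) × (ℝ × ℝ))) : Prop :=
  ∀ e ∈ G, e.1 ∈ P ∧ e.2 ∈ P ∧ e.1.1 < e.2.1

theorem GeneralPosition_s19.mono {P Q : Finset (ℝ × ℝ)} (hP : GeneralPosition_s19 P) (h : Q ⊆ P) :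
    GeneralPosition_s19 Q :=
  ⟨fun u hu v hv => hP.eq_of_fst u (h hu) v (h hv),
   fun u hu v hv w hw => hP.ne_lineAt u (h hu) v (h hv) w (h hw)⟩

theorem lineSlope_comm (u v : ℝ × ℝ) : lineSlope u v = lineSlope v u := by
  unfold lineSlope
  rw [← neg_sub v.2 u.2, ← neg_sub v.1 u.1, neg_div_neg_eq]

theorem lineSlope_mul {u v : ℝ × ℝ} (h : u.1 ≠ v.1) :
    lineSlope u v * (v.1 - u.1) = v.2 - u.2 :=
  div_mul_cancel₀ _ (sub_ne_zero.2 h.symm)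

theorem lineAt_left (e : (ℝ × ℝ) × (ℝ × ℝ)) : lineAt e e.1.1 = e.1.2 := by
  simp [lineAt]

theorem lineAt_right {e : (ℝ × ℝ) × (ℝ × ℝ)} (h : e.1.1 ≠ e.2.1) : lineAt e e.2.1 = e.2.2 := by
  rw [lineAt, lineSlope_mul h]; ring

theorem lineAt_sub (e : (ℝ × ℝ) × (ℝ × ℝ)) (s t : ℝ) :
    lineAt e t - lineAt e s = lineSlope e.1 e.2 * (t - s) := by
  simp only [lineAt]; ring

/-- Two segments whose vertical order differs at two common abscissae cross. -/
theorem crosses_of_lineAt_lt {e f : (ℝ × ℝ) × (ℝ × ℝ)} {s t : ℝ} (hst : s < t)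
    (hes : e.1.1 ≤ s) (het : t ≤ e.2.1) (hfs : f.1.1 ≤ s) (hft : t ≤ f.2.1)
    (h₁ : lineAt f s < lineAt e s) (h₂ : lineAt e t < lineAt f t) : Crosses e f := by
  have he := lineAt_sub e s t
  have hf := lineAt_sub f s t
  have hlt : lineSlope e.1 e.2 < lineSlope f.1 f.2 := by
    by_contra! h
    nlinarith [mul_le_mul_of_nonneg_right h (sub_nonneg.2 hst.le)]
  have hd : 0 < lineSlope f.1 f.2 - lineSlope e.1 e.2 := sub_pos.2 hlt
  obtain ⟨r, hr⟩ : ∃ r, r * (lineSlope f.1 f.2 - lineSlope e.1 e.2) = lineAt e s - lineAt f s :=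
    ⟨_, div_mul_cancel₀ _ hd.ne'⟩
  have hr0 : 0 < r := by
    by_contra! h
    nlinarith
  have hrt : r < t - s := by
    by_contra! h
    nlinarith [mul_le_mul_of_nonneg_right h hd.le]
  refine ⟨hlt, s + r, by linarith, by linarith, by linarith, by linarith, ?_⟩
  have he' := lineAt_sub e s (s + r)
  have hf' := lineAt_sub f s (s + r)
  linarith

/-- `e` passes over the abscissa of `p`, strictly above `p`, and no segment of `G` passes strictly
between. -/
def IsJustAbove (G : Finset ((ℝ × ℝ) × (ℝ × ℝ))) (p : ℝ × ℝ) (e : (ℝ × ℝ) × (ℝ × ℝ)) : Prop :=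
  e.1.1 < p.1 ∧ p.1 < e.2.1 ∧ p.2 < lineAt e p.1 ∧
    ∀ g ∈ G, g.1.1 < p.1 → p.1 < g.2.1 → p.2 < lineAt g p.1 → lineAt e p.1 ≤ lineAt g p.1

/-- `e` passes over the abscissa of `p`, strictly below `p`, and no segment of `G` passes strictly
between. -/
def IsJustBelow (G : Finset ((ℝ × ℝ) × (ℝ × ℝ))) (p : ℝ × ℝ) (e : (ℝ × ℝ) × (ℝ × ℝ)) : Prop :=
  e.1.1 < p.1 ∧ p.1 < e.2.1 ∧ lineAt e p.1 < p.2 ∧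
    ∀ g ∈ G, g.1.1 < p.1 → p.1 < g.2.1 → lineAt g p.1 < p.2 → lineAt g p.1 ≤ lineAt e p.1

theorem GeneralPosition_s19.eq_of_lineSlope_eq {P : Finset (ℝ × ℝ)} (hP : GeneralPosition_s19 P)
    {v p q : ℝ × ℝ} (hv : v ∈ P) (hp : p ∈ P) (hq : q ∈ P) (hvp : v ≠ p) (hvq : v ≠ q)
    (h : lineSlope v p = lineSlope v q) : p = q := by
  by_contra hpq
  refine hP.ne_lineAt v hv p hp q hq hvp hvq hpq ?_
  have := lineSlope_mul fun h' => hvq (hP.eq_of_fst v hv q hq h')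
  simp only [lineAt]
  rw [h]; linarith

/-- In a crossing-free segment graph, two segments that meet over a common interior abscissa
coincide. -/
theorem eq_of_lineAt_eq {P : Finset (ℝ × ℝ)} (hP : GeneralPosition_s19 P)
    {G : Finset ((ℝ × ℝ) × (ℝ × ℝ))} (hG : IsSegmentGraph P G)
    (hcr : ∀ e ∈ G, ∀ f ∈ G, ¬ Crosses e f) {e f : (ℝ × ℝ) × (ℝ × ℝ)} (he : e ∈ G) (hf : f ∈ G)
    {t : ℝ} (h1 : e.1.1 < t) (h2 : t < e.2.1) (h3 : f.1.1 < t) (h4 : t < f.2.1)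
    (h : lineAt e t = lineAt f t) : e = f := by
  have hs : lineSlope e.1 e.2 = lineSlope f.1 f.2 := by
    rcases lt_trichotomy (lineSlope e.1 e.2) (lineSlope f.1 f.2) with hl | hl | hl
    · exact absurd ⟨hl, t, h1, h2, h3, h4, h⟩ (hcr e he f hf)
    · exact hl
    · exact absurd ⟨hl, t, h3, h4, h1, h2, h.symm⟩ (hcr f hf e he)
  have hline : ∀ x, lineAt e x = lineAt f x := fun x => by
    have he' := lineAt_sub e t x
    have hf' := lineAt_sub f t x
    rw [hs] at he'
    linarith
  obtain ⟨he1, he2, he12⟩ := hG e he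
  obtain ⟨hf1, hf2, hf12⟩ := hG f hf
  have hne : e.1 ≠ e.2 := fun h => he12.ne (by rw [h])
  have key : ∀ w ∈ P, w.2 = lineAt f w.1 → w = e.1 ∨ w = e.2 := by
    intro w hw hwf
    by_contra! hc
    exact hP.ne_lineAt e.1 he1 e.2 he2 w hw hne hc.1.symm hc.2.symm
      (by rw [hwf]; exact (hline _).symm)
  have k1 := key f.1 hf1 (lineAt_left f).symm
  have k2 := key f.2 hf2 (lineAt_right hf12.ne).symm
  have e1 : f.1 = e.1 := k1.resolve_right fun h => by rw [h] at h3; linarith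
  have e2 : f.2 = e.2 := k2.resolve_left fun h => by rw [h] at h4; linarith
  exact Prod.ext e1.symm e2.symm

/-- A segment through a point's abscissa, strictly inside an empty wedge of segments, must leave the
wedge through its apex. -/
theorem false_of_enters_wedge {P : Finset (ℝ × ℝ)} (hP : GeneralPosition_s19 P)
    {G : Finset ((ℝ × ℝ) × (ℝ × ℝ))} (hG : IsSegmentGraph P G)
    (hcr : ∀ e ∈ G, ∀ f ∈ G, ¬ Crosses e f) {e f g : (ℝ × ℝ) × (ℝ × ℝ)} {t : ℝ}
    (he : e ∈ G) (hf : f ∈ G) (hg : g ∈ G) (hef : e.1 = f.1)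
    (hcons : ∀ g ∈ G, g.1 = e.1 → lineSlope e.1 e.2 < lineSlope g.1 g.2 →
      lineSlope f.1 f.2 ≤ lineSlope g.1 g.2)
    (hempty : ∀ q ∈ P, e.1.1 < q.1 → q.1 < t → lineAt e q.1 ≤ q.2 → lineAt f q.1 < q.2)
    (het : t ≤ e.2.1) (hft : t ≤ f.2.1) (het' : e.1.1 < t) (hgt : g.1.1 < t) (hgt' : t < g.2.1)
    (h1 : lineAt e t < lineAt g t) (h2 : lineAt g t < lineAt f t) : False := by
  have hft' : f.1.1 < t := hef ▸ het'
  obtain ⟨hg1, hg2, hg12⟩ := hG g hg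
  obtain ⟨he1, he2, he12⟩ := hG e he
  have hgl := lineAt_left g
  rcases lt_trichotomy e.1.1 g.1.1 with hlt | heq | hlt
  · have hflt : f.1.1 ≤ g.1.1 := hef ▸ hlt.le
    by_cases hb : lineAt e g.1.1 ≤ g.1.2
    · have := hempty g.1 hg1 hlt hgt hb
      exact hcr g hg f hf
        (crosses_of_lineAt_lt hgt le_rfl hgt'.le hflt hft (by rw [hgl]; exact this) h2)
    · exact hcr e he g hg
        (crosses_of_lineAt_lt hgt hlt.le het le_rfl hgt'.le (by rw [hgl]; linarith) h1)
  · have hge : g.1 = e.1 := (hP.eq_of_fst _ he1 _ hg1 heq).symm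
    have a1 := lineAt_sub e e.1.1 t
    have a2 := lineAt_sub f e.1.1 t
    have a3 := lineAt_sub g e.1.1 t
    have b1 := lineAt_left e
    have b2 := lineAt_left f
    have b3 := lineAt_left g
    rw [← hef] at b2
    rw [hge] at b3
    have hlt1 : lineSlope e.1 e.2 < lineSlope g.1 g.2 := by
      by_contra! h
      nlinarith [mul_le_mul_of_nonneg_right h (sub_nonneg.2 het'.le)]
    have := hcons g hg hge hlt1
    nlinarith [mul_le_mul_of_nonneg_right this (sub_nonneg.2 het'.le)]
  · have b1 := lineAt_left e
    have b2 := lineAt_left f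
    rw [← hef] at b2
    rcases lt_trichotomy (lineAt g e.1.1) e.1.2 with hv | hv | hv
    · exact hcr e he g hg
        (crosses_of_lineAt_lt het' le_rfl het hlt.le hgt'.le (by rw [b1]; exact hv) h1)
    · refine hP.ne_lineAt g.1 hg1 g.2 hg2 e.1 he1 ?_ ?_ ?_ hv.symm
      · exact fun h => hg12.ne (by rw [h])
      · exact fun h => hlt.ne (by rw [h])
      · exact fun h => (het'.trans hgt').ne (by rw [h])
    · exact hcr g hg f hf
        (crosses_of_lineAt_lt het' hlt.le hgt'.le (hef ▸ le_rfl) hft (by rw [b2]; exact hv) h2)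

/-- A segment is either the lowest one leaving its left endpoint, or it lies just above some point,
or the next lower segment leaving the same left endpoint lies just below its right endpoint. -/
theorem lowest_or_isJustAbove_or_isJustBelow {P : Finset (ℝ × ℝ)} (hP : GeneralPosition_s19 P)
    {G : Finset ((ℝ × ℝ) × (ℝ × ℝ))} (hG : IsSegmentGraph P G)
    (hcr : ∀ e ∈ G, ∀ f ∈ G, ¬ Crosses e f) {f : (ℝ × ℝ) × (ℝ × ℝ)} (hf : f ∈ G) :
    (∀ g ∈ G, g.1 = f.1 → lineSlope f.1 f.2 ≤ lineSlope g.1 g.2) ∨ (∃ p ∈ P, IsJustAbove G p f) ∨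
      ∃ e ∈ G, e.1 = f.1 ∧ IsJustBelow G f.2 e := by
  classical
  by_cases hmin : ∀ g ∈ G, g.1 = f.1 → lineSlope f.1 f.2 ≤ lineSlope g.1 g.2
  · exact Or.inl hmin
  right
  push Not at hmin
  obtain ⟨g₀, hg₀, hg₀f, hg₀s⟩ := hmin
  obtain ⟨e, he, hemax⟩ := Finset.exists_max_image
    (G.filter fun g => g.1 = f.1 ∧ lineSlope g.1 g.2 < lineSlope f.1 f.2)
    (fun g => lineSlope g.1 g.2) ⟨g₀, Finset.mem_filter.2 ⟨hg₀, hg₀f, hg₀s⟩⟩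
  rw [Finset.mem_filter] at he
  obtain ⟨heG, hef, hes⟩ := he
  have hcons : ∀ g ∈ G, g.1 = e.1 → lineSlope e.1 e.2 < lineSlope g.1 g.2 →
      lineSlope f.1 f.2 ≤ lineSlope g.1 g.2 := by
    intro g hg hge hs
    by_contra! h
    exact absurd (hemax g (Finset.mem_filter.2 ⟨hg, hge.trans hef, h⟩)) (not_le.2 hs)
  obtain ⟨he1, he2, he12⟩ := hG e heG
  obtain ⟨hf1, hf2, hf12⟩ := hG f hf
  have hlt : ∀ t, e.1.1 < t → lineAt e t < lineAt f t := by
    intro t ht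
    simp only [lineAt, ← hef]
    rw [hef] at hes ⊢
    rw [hef] at ht
    have := mul_lt_mul_of_pos_right hes (sub_pos.2 ht)
    linarith
  obtain ⟨p, hp, hpmin⟩ := Finset.exists_min_image
    (P.filter fun q => e.1.1 < q.1 ∧ q.1 ≤ e.2.1 ∧ q.1 ≤ f.2.1 ∧ lineAt e q.1 ≤ q.2 ∧
      q.2 ≤ lineAt f q.1) (fun q => q.1) (by
      rcases le_total e.2.1 f.2.1 with h | h
      · refine ⟨e.2, ?_⟩
        have h1 := hlt _ he12
        rw [lineAt_right he12.ne] at h1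
        simp [he2, he12, h, lineAt_right he12.ne, h1.le]
      · refine ⟨f.2, ?_⟩
        have hef2 : e.1.1 < f.2.1 := hef ▸ hf12
        have h1 := hlt _ hef2
        rw [lineAt_right hf12.ne] at h1
        simp [hf2, hef2, h, lineAt_right hf12.ne, h1.le])
  rw [Finset.mem_filter] at hp
  obtain ⟨hpP, hp1, hp2, hp3, hp4, hp5⟩ := hp
  have hempty : ∀ q ∈ P, e.1.1 < q.1 → q.1 < p.1 → lineAt e q.1 ≤ q.2 → lineAt f q.1 < q.2 := by
    intro q hq hq1 hq2 hq3
    by_contra! h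
    exact absurd (hpmin q (by
      rw [Finset.mem_filter]
      exact ⟨hq, hq1, by linarith, by linarith, hq3, h⟩)) (not_le.2 hq2)
  by_cases hpf : p = f.2
  · right
    subst hpf
    refine ⟨e, heG, hef, hp1, lt_of_le_of_ne hp2 fun h => ?_, ?_, ?_⟩
    · have h' : f.2 = e.2 := hP.eq_of_fst _ hpP _ he2 h
      rw [hef, h'] at hes
      exact lt_irrefl _ hes
    · exact (hlt _ hp1).trans_eq (lineAt_right hf12.ne)
    · intro g hg hg1 hg2 hg3
      by_contra! h
      exact false_of_enters_wedge hP hG hcr heG hf hg hef hcons hempty hp2 hp3 hp1 hg1 hg2 h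
        (hg3.trans_eq (lineAt_right hf12.ne).symm)
  · left
    have hfp : f.1.1 < p.1 := hef ▸ hp1
    refine ⟨p, hpP, hfp, lt_of_le_of_ne hp3 fun h => hpf (hP.eq_of_fst _ hpP _ hf2 h),
      lt_of_le_of_ne hp5 ?_, ?_⟩
    · exact hP.ne_lineAt f.1 hf1 f.2 hf2 p hpP (fun h => hf12.ne (by rw [h]))
        (fun h => hfp.ne (by rw [h])) (Ne.symm hpf)
    · intro g hg hg1 hg2 hg3
      by_contra! h
      exact false_of_enters_wedge hP hG hcr heG hf hg hef hcons hempty hp2 hp3 hp1 hg1 hg2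
        (hp4.trans_lt hg3) h

/-- A crossing-free segment graph has at most three times as many edges as vertices. -/
theorem card_le_of_not_crosses {P : Finset (ℝ × ℝ)} (hP : GeneralPosition_s19 P)
    {G : Finset ((ℝ × ℝ) × (ℝ × ℝ))} (hG : IsSegmentGraph P G)
    (hcr : ∀ e ∈ G, ∀ f ∈ G, ¬ Crosses e f) : G.card ≤ 3 * P.card := by
  classical
  have above_unique : ∀ p, ∀ e ∈ G, ∀ f ∈ G, IsJustAbove G p e → IsJustAbove G p f → e = f :=
    fun p e he f hf h h' => eq_of_lineAt_eq hP hG hcr he hf h.1 h.2.1 h'.1 h'.2.1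
      (le_antisymm (h.2.2.2 f hf h'.1 h'.2.1 h'.2.2.1) (h'.2.2.2 e he h.1 h.2.1 h.2.2.1))
  have below_unique : ∀ p, ∀ e ∈ G, ∀ f ∈ G, IsJustBelow G p e → IsJustBelow G p f → e = f :=
    fun p e he f hf h h' => eq_of_lineAt_eq hP hG hcr he hf h.1 h.2.1 h'.1 h'.2.1
      (le_antisymm (h'.2.2.2 e he h.1 h.2.1 h.2.2.1) (h.2.2.2 f hf h'.1 h'.2.1 h'.2.2.1))
  set G₁ := G.filter fun f => ∀ g ∈ G, g.1 = f.1 → lineSlope f.1 f.2 ≤ lineSlope g.1 g.2 with hG₁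
  set G₂ := G.filter fun f => ∃ p ∈ P, IsJustAbove G p f with hG₂
  set G₃ := G.filter fun f => ∃ e ∈ G, e.1 = f.1 ∧ IsJustBelow G f.2 e with hG₃
  have h₁ : G₁.card ≤ P.card := by
    refine Finset.card_le_card_of_injOn Prod.fst (fun f hf => ?_) fun f hf g hg h => ?_
    · exact (hG f (Finset.mem_filter.1 hf).1).1
    · obtain ⟨hfG, hf⟩ := Finset.mem_filter.1 hf
      obtain ⟨hgG, hg⟩ := Finset.mem_filter.1 hg
      have hs := le_antisymm (hf g hgG h.symm) (hg f hfG h)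
      obtain ⟨hf1, hf2, hf12⟩ := hG f hfG
      obtain ⟨hg1, hg2, hg12⟩ := hG g hgG
      refine Prod.ext h (hP.eq_of_lineSlope_eq hf1 hf2 hg2 ?_ ?_ (by rw [hs, h]))
      · exact fun h' => hf12.ne (by rw [h'])
      · exact fun h' => hg12.ne (by rw [← h, h'])
  have h₂ : G₂.card ≤ P.card := by
    have : ∀ f : G₂, ∃ p ∈ P, IsJustAbove G p f := fun f => (Finset.mem_filter.1 f.2).2
    choose φ hφ hφ' using this
    rw [← Finset.card_attach]
    refine Finset.card_le_card_of_injOn φ (fun f _ => hφ f) fun f _ g _ h => ?_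
    refine Subtype.ext (above_unique (φ f) f (Finset.mem_filter.1 f.2).1 g
      (Finset.mem_filter.1 g.2).1 (hφ' f) ?_)
    rw [h]
    exact hφ' g
  have h₃ : G₃.card ≤ P.card := by
    refine Finset.card_le_card_of_injOn Prod.snd (fun f hf => ?_) fun f hf g hg h => ?_
    · exact (hG f (Finset.mem_filter.1 hf).1).2.1
    · obtain ⟨hfG, e, he, hef, heb⟩ := Finset.mem_filter.1 hf
      obtain ⟨hgG, e', he', hef', heb'⟩ := Finset.mem_filter.1 hg
      have h' : f.2 = g.2 := h
      rw [← h'] at heb'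
      have := below_unique _ e he e' he' heb heb'
      exact Prod.ext (by rw [← hef, ← hef', this]) h
  have hsub : G ⊆ G₁ ∪ (G₂ ∪ G₃) := by
    intro f hf
    simp only [Finset.mem_union, hG₁, hG₂, hG₃, Finset.mem_filter, hf, true_and]
    exact lowest_or_isJustAbove_or_isJustBelow hP hG hcr hf
  have c1 := Finset.card_le_card hsub
  have c2 := Finset.card_union_le G₁ (G₂ ∪ G₃)
  have c3 := Finset.card_union_le G₂ G₃
  omega

open Classical in
/-- The crossing pairs of segments of `G`. -/
noncomputable def crossingPairs (G : Finset ((ℝ × ℝ) × (ℝ × ℝ))) :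
    Finset (((ℝ × ℝ) × (ℝ × ℝ)) × ((ℝ × ℝ) × (ℝ × ℝ))) :=
  (G ×ˢ G).filter fun z => Crosses z.1 z.2

theorem mem_crossingPairs {G : Finset ((ℝ × ℝ) × (ℝ × ℝ))}
    {z : ((ℝ × ℝ) × (ℝ × ℝ)) × ((ℝ × ℝ) × (ℝ × ℝ))} :
    z ∈ crossingPairs G ↔ (z.1 ∈ G ∧ z.2 ∈ G) ∧ Crosses z.1 z.2 := by
  simp [crossingPairs]

/-- A segment graph has at least `|G| - 3 |P|` crossings. -/
theorem card_le_add_card_crossingPairs {P : Finset (ℝ × ℝ)} (hP : GeneralPosition_s19 P)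
    (G : Finset ((ℝ × ℝ) × (ℝ × ℝ))) (hG : IsSegmentGraph P G) :
    G.card ≤ 3 * P.card + (crossingPairs G).card := by
  classical
  induction G using Finset.strongInduction with
  | H G ih =>
    by_cases hcr : ∀ e ∈ G, ∀ f ∈ G, ¬ Crosses e f
    · exact (card_le_of_not_crosses hP hG hcr).trans (Nat.le_add_right _ _)
    push Not at hcr
    obtain ⟨e, he, f, hf, hef⟩ := hcr
    have h1 := ih (G.erase e) (Finset.erase_ssubset he) fun g hg => hG g (Finset.mem_of_mem_erase hg)
    have h2 : (crossingPairs (G.erase e)).card < (crossingPairs G).card := by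
      refine Finset.card_lt_card ⟨fun z hz => ?_, fun h => ?_⟩
      · rw [mem_crossingPairs] at hz ⊢
        exact ⟨⟨Finset.mem_of_mem_erase hz.1.1, Finset.mem_of_mem_erase hz.1.2⟩, hz.2⟩
      · have := h (mem_crossingPairs.2 ⟨⟨he, hf⟩, hef⟩ : (e, f) ∈ crossingPairs G)
        simp [mem_crossingPairs] at this
    have h3 := Finset.card_erase_add_one he
    omega

/-- A random subset of `P`, containing each element independently with probability `p`, contains a
given subset `T` with probability `p ^ |T|`. -/
theorem sum_powerset_of_subset {α : Type*} [DecidableEq α] (P T : Finset α) (hT : T ⊆ P) (p : ℝ) :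
    ∑ S ∈ P.powerset, p ^ S.card * (1 - p) ^ (P \ S).card * (if T ⊆ S then 1 else 0) =
      p ^ T.card := by
  have h := Finset.prod_add (fun _ : α => p) (fun a => if a ∈ T then 0 else 1 - p) P
  have hl : ∏ a ∈ P, (p + if a ∈ T then 0 else 1 - p) = p ^ T.card := by
    have : ∀ a, (p + if a ∈ T then 0 else 1 - p) = if a ∈ T then p else 1 := fun a => by
      split_ifs <;> ring
    simp_rw [this]
    rw [Finset.prod_ite_mem, Finset.inter_eq_right.2 hT, Finset.prod_const]
  rw [← hl, h]
  refine Finset.sum_congr rfl fun S _ => ?_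
  rw [Finset.prod_const, mul_assoc]
  congr 1
  split_ifs with hTS
  · rw [mul_one, Finset.prod_congr rfl (g := fun _ => 1 - p), Finset.prod_const]
    intro a ha
    rw [if_neg fun haT => (Finset.mem_sdiff.1 ha).2 (hTS haT)]
  · obtain ⟨a, haT, haS⟩ := Finset.not_subset.1 hTS
    rw [mul_zero, eq_comm]
    exact Finset.prod_eq_zero (Finset.mem_sdiff.2 ⟨hT haT, haS⟩) (if_pos haT)

/-- Expected number of members of a `k`-uniform family contained in a random subset. -/
theorem sum_powerset_card_filter {α β : Type*} [DecidableEq α] (P : Finset α) (Z : Finset β)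
    (T : β → Finset α) (k : ℕ) (hT : ∀ z ∈ Z, T z ⊆ P) (hk : ∀ z ∈ Z, (T z).card = k) (p : ℝ) :
    ∑ S ∈ P.powerset, p ^ S.card * (1 - p) ^ (P \ S).card * ((Z.filter fun z => T z ⊆ S).card : ℝ) =
      Z.card * p ^ k := by
  simp_rw [Finset.card_filter, Nat.cast_sum, Finset.mul_sum]
  rw [Finset.sum_comm, ← nsmul_eq_mul]
  refine Finset.sum_eq_card_nsmul fun z hz => ?_
  rw [← hk z hz, ← sum_powerset_of_subset P (T z) (hT z hz) p]
  simp

theorem card_endpoints_of_crosses {e f : (ℝ × ℝ) × (ℝ × ℝ)} (h : Crosses e f) :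
    ({e.1, e.2, f.1, f.2} : Finset (ℝ × ℝ)).card = 4 := by
  obtain ⟨hs, t, h1, h2, h3, h4, ht⟩ := h
  have a1 := lineAt_sub e e.1.1 t
  have a2 := lineAt_sub f f.1.1 t
  have a3 := lineAt_sub e t e.2.1
  have a4 := lineAt_sub f t f.2.1
  rw [lineAt_left] at a1 a2
  rw [lineAt_right (h1.trans h2).ne] at a3
  rw [lineAt_right (h3.trans h4).ne] at a4
  have n1 : e.1 ≠ e.2 := fun h => (h1.trans h2).ne (by rw [h])
  have n2 : f.1 ≠ f.2 := fun h => (h3.trans h4).ne (by rw [h])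
  have n3 : e.1 ≠ f.2 := fun h => (h1.trans h4).ne (by rw [h])
  have n4 : e.2 ≠ f.1 := fun h => (h3.trans h2).ne (by rw [h])
  have n5 : e.1 ≠ f.1 := fun h => by
    have h' : (lineSlope f.1 f.2 - lineSlope e.1 e.2) * (t - f.1.1) = 0 := by
      rw [h] at a1 ⊢; linarith
    have := mul_pos (sub_pos.2 hs) (sub_pos.2 h3)
    linarith
  have n6 : e.2 ≠ f.2 := fun h => by
    have h' : (lineSlope f.1 f.2 - lineSlope e.1 e.2) * (f.2.1 - t) = 0 := by
      rw [h] at a3 ⊢; linarith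
    have := mul_pos (sub_pos.2 hs) (sub_pos.2 h4)
    linarith
  rw [Finset.card_insert_of_notMem, Finset.card_insert_of_notMem, Finset.card_pair n2] <;>
    simp [n1, n3, n4, n5, n6]

/-- The amplified form of `card_le_add_card_crossingPairs`, by passing to a random subset. -/
theorem card_mul_sq_le {P : Finset (ℝ × ℝ)} (hP : GeneralPosition_s19 P)
    {G : Finset ((ℝ × ℝ) × (ℝ × ℝ))} (hG : IsSegmentGraph P G) {p : ℝ} (hp0 : 0 ≤ p) (hp1 : p ≤ 1) :
    G.card * p ^ 2 ≤ 3 * (P.card * p) + (crossingPairs G).card * p ^ 4 := by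
  classical
  have hE := sum_powerset_card_filter P G (fun e => {e.1, e.2}) 2
    (fun e he => by
      obtain ⟨h1, h2, -⟩ := hG e he
      simp [Finset.insert_subset_iff, h1, h2])
    (fun e he => Finset.card_pair fun h => (hG e he).2.2.ne (by rw [h])) p
  have hV := sum_powerset_card_filter P P (fun v => {v}) 1 (by simp) (by simp) p
  have hX := sum_powerset_card_filter P (crossingPairs G)
    (fun z => {z.1.1, z.1.2, z.2.1, z.2.2}) 4
    (fun z hz => by
      rw [mem_crossingPairs] at hz
      obtain ⟨h1, h2, -⟩ := hG _ hz.1.1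
      obtain ⟨h3, h4, -⟩ := hG _ hz.1.2
      simp [Finset.insert_subset_iff, h1, h2, h3, h4])
    (fun z hz => card_endpoints_of_crosses (mem_crossingPairs.1 hz).2) p
  rw [pow_one] at hV
  rw [← hE, ← hV, ← hX, Finset.mul_sum, ← Finset.sum_add_distrib]
  refine Finset.sum_le_sum fun S hS => ?_
  rw [Finset.mem_powerset] at hS
  have hw : 0 ≤ p ^ S.card * (1 - p) ^ (P \ S).card :=
    mul_nonneg (pow_nonneg hp0 _) (pow_nonneg (sub_nonneg.2 hp1) _)
  have h := card_le_add_card_crossingPairs (hP.mono hS) (G.filter fun e => {e.1, e.2} ⊆ S)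
    fun e he => by
      obtain ⟨heG, heS⟩ := Finset.mem_filter.1 he
      simp only [Finset.insert_subset_iff, Finset.singleton_subset_iff] at heS
      exact ⟨heS.1, heS.2, (hG e heG).2.2⟩
  have h1 : (P.filter fun v => {v} ⊆ S) = S := by
    ext v
    simp only [Finset.mem_filter, Finset.singleton_subset_iff]
    exact ⟨fun h => h.2, fun h => ⟨hS h, h⟩⟩
  have h2 : crossingPairs (G.filter fun e => {e.1, e.2} ⊆ S) =
      (crossingPairs G).filter fun z => {z.1.1, z.1.2, z.2.1, z.2.2} ⊆ S := by
    ext z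
    simp only [mem_crossingPairs, Finset.mem_filter, Finset.insert_subset_iff,
      Finset.singleton_subset_iff]
    tauto
  rw [h2] at h
  rw [h1]
  have h' : ((G.filter fun e => {e.1, e.2} ⊆ S).card : ℝ) ≤ 3 * S.card +
      ((crossingPairs G).filter fun z => {z.1.1, z.1.2, z.2.1, z.2.2} ⊆ S).card := by
    exact_mod_cast h
  linarith [mul_le_mul_of_nonneg_left h' hw]

/-- The crossing lemma for segment graphs. -/
theorem card_pow_three_le {P : Finset (ℝ × ℝ)} (hP : GeneralPosition_s19 P)
    {G : Finset ((ℝ × ℝ) × (ℝ × ℝ))} (hG : IsSegmentGraph P G) (hm : 6 * P.card ≤ G.card) :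
    (G.card : ℝ) ^ 3 ≤ 72 * P.card ^ 2 * (crossingPairs G).card := by
  rcases P.eq_empty_or_nonempty with rfl | hne
  · have : G = ∅ := Finset.eq_empty_of_forall_notMem fun e he => by simpa using (hG e he).1
    simp [this]
  have hn : (0 : ℝ) < P.card := by exact_mod_cast hne.card_pos
  have hm' : 6 * (P.card : ℝ) ≤ G.card := by exact_mod_cast hm
  set n : ℝ := (P.card : ℝ)
  set m : ℝ := (G.card : ℝ)
  set c : ℝ := ((crossingPairs G).card : ℝ)
  have hm0 : 0 < m := by linarith
  have h := card_mul_sq_le hP hG (p := 6 * n / m) (by positivity) ((div_le_one hm0).2 hm')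
  change m * (6 * n / m) ^ 2 ≤ 3 * (n * (6 * n / m)) + c * (6 * n / m) ^ 4 at h
  have e : m * (6 * n / m) ^ 2 = 36 * n ^ 2 / m := by field_simp; ring
  have e' : 3 * (n * (6 * n / m)) = 18 * n ^ 2 / m := by field_simp; ring
  have e2 : c * (6 * n / m) ^ 4 = 18 * n ^ 2 / m * (72 * n ^ 2 * c / m ^ 3) := by field_simp; ring
  have e3 : 36 * n ^ 2 / m = 18 * n ^ 2 / m * 1 + 18 * n ^ 2 / m := by ring
  rw [e, e', e2, e3] at h
  have h' : 18 * n ^ 2 / m * 1 ≤ 18 * n ^ 2 / m * (72 * n ^ 2 * c / m ^ 3) := by linarith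
  have := le_of_mul_le_mul_left h' (by positivity)
  rwa [one_le_div (by positivity)] at this

/-- For a line rotating about a fixed point, with slopes `A` to the points on the right and `B` to
the points on the left, the number of points strictly below it at slope `s`. -/
noncomputable def pencilLevel (A B : Finset ℝ) (s : ℝ) : ℕ :=
  (A.filter (· < s)).card + (B.filter (s < ·)).card

/-- If the rotating line is at level at most `k` just after slope `s₁`, and passes no point on the
right at level exactly `k` before slope `s`, then it is at level at most `k` just before `s`. -/
theorem pencilLevel_le_of_forall_ne (A B : Finset ℝ) (k : ℕ) {s₁ s : ℝ} (hs : s₁ < s)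
    (h₁ : (A.filter (· ≤ s₁)).card + (B.filter (s₁ < ·)).card ≤ k)
    (hA : ∀ a ∈ A, s₁ < a → a < s → pencilLevel A B a ≠ k) :
    (A.filter (· < s)).card + (B.filter (s ≤ ·)).card ≤ k := by
  induction hn : (A.filter fun a => s₁ < a ∧ a < s).card using Nat.strong_induction_on
    generalizing s₁ with
  | _ n ih =>
    rcases (A.filter fun a => s₁ < a ∧ a < s).eq_empty_or_nonempty with h0 | hne
    · refine le_trans (add_le_add (Finset.card_le_card fun a ha => ?_)
        (Finset.card_le_card fun b hb => ?_)) h₁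
      · rw [Finset.mem_filter] at ha ⊢
        refine ⟨ha.1, not_lt.1 fun h => ?_⟩
        exact Finset.notMem_empty a (h0 ▸ Finset.mem_filter.2 ⟨ha.1, h, ha.2⟩)
      · rw [Finset.mem_filter] at hb ⊢
        exact ⟨hb.1, hs.trans_le hb.2⟩
    · obtain ⟨a, ha, hmin⟩ := Finset.exists_min_image _ id hne
      simp only [Finset.mem_filter, id] at ha hmin
      obtain ⟨haA, ha1, ha2⟩ := ha
      have hlev : pencilLevel A B a ≤ k := by
        refine le_trans (add_le_add (Finset.card_le_card fun x hx => ?_)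
          (Finset.card_le_card fun b hb => ?_)) h₁
        · rw [Finset.mem_filter] at hx ⊢
          refine ⟨hx.1, not_lt.1 fun h => ?_⟩
          exact absurd (hmin x ⟨hx.1, h, hx.2.trans ha2⟩) (not_le.2 hx.2)
        · rw [Finset.mem_filter] at hb ⊢
          exact ⟨hb.1, ha1.trans hb.2⟩
      have hlt : pencilLevel A B a < k := lt_of_le_of_ne hlev (hA a haA ha1 ha2)
      refine ih _ ?_ ha2 ?_ (fun x hx h => hA x hx (ha1.trans h)) rfl
      · rw [← hn]
        refine Finset.card_lt_card ⟨fun x hx => ?_, fun h => ?_⟩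
        · rw [Finset.mem_filter] at hx ⊢
          exact ⟨hx.1, ha1.trans hx.2.1, hx.2.2⟩
        · have := h (Finset.mem_filter.2 ⟨haA, ha1, ha2⟩)
          exact lt_irrefl _ (Finset.mem_filter.1 this).2.1
      · have : A.filter (· ≤ a) ⊆ insert a (A.filter (· < a)) := fun x hx => by
          rw [Finset.mem_filter] at hx
          rw [Finset.mem_insert, Finset.mem_filter]
          rcases hx.2.eq_or_lt with h | h
          · exact Or.inl h
          · exact Or.inr ⟨hx.1, h⟩
        have := (Finset.card_le_card this).trans (Finset.card_insert_le _ _)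
        rw [pencilLevel] at hlt
        omega

theorem card_filter_le_eq_of_notMem {A : Finset ℝ} {s : ℝ} (h : s ∉ A) :
    A.filter (· ≤ s) = A.filter (· < s) :=
  Finset.filter_congr fun _ hx => ⟨fun hl => lt_of_le_of_ne hl fun h' => h (h' ▸ hx), le_of_lt⟩

/-- Between two points on the left passed at level `k`, the rotating line passes a point on the right
at level `k`. -/
theorem exists_right_between {A B : Finset ℝ} (hAB : Disjoint A B) {k : ℕ} {b₁ b₂ : ℝ}
    (h₁ : b₁ ∈ B) (h₂ : b₂ ∈ B) (hlt : b₁ < b₂) (hk₁ : pencilLevel A B b₁ = k)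
    (hk₂ : pencilLevel A B b₂ = k) : ∃ a ∈ A, b₁ < a ∧ a < b₂ ∧ pencilLevel A B a = k := by
  by_contra! h
  have := pencilLevel_le_of_forall_ne A B k hlt (by
    rw [card_filter_le_eq_of_notMem (Finset.disjoint_right.1 hAB h₁)]
    exact hk₁.le) h
  have hss : (B.filter (b₂ < ·)).card < (B.filter (b₂ ≤ ·)).card := by
    refine Finset.card_lt_card ⟨fun x hx => ?_, fun h => ?_⟩
    · rw [Finset.mem_filter] at hx ⊢
      exact ⟨hx.1, hx.2.le⟩
    · exact lt_irrefl _ (Finset.mem_filter.1 (h (Finset.mem_filter.2 ⟨h₂, le_rfl⟩))).2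
  rw [pencilLevel] at hk₂
  omega

theorem pencilLevel_image_neg (A B : Finset ℝ) (s : ℝ) :
    pencilLevel (B.image Neg.neg) (A.image Neg.neg) (-s) = pencilLevel A B s := by
  simp only [pencilLevel, Finset.filter_image, neg_lt_neg_iff]
  rw [Finset.card_image_of_injective _ neg_injective, Finset.card_image_of_injective _ neg_injective,
    add_comm]

/-- Between two points on the right passed at level `k`, the rotating line passes a point on the left
at level `k`. -/
theorem exists_left_between {A B : Finset ℝ} (hAB : Disjoint A B) {k : ℕ} {a₁ a₂ : ℝ}
    (h₁ : a₁ ∈ A) (h₂ : a₂ ∈ A) (hlt : a₁ < a₂) (hk₁ : pencilLevel A B a₁ = k)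
    (hk₂ : pencilLevel A B a₂ = k) : ∃ b ∈ B, a₁ < b ∧ b < a₂ ∧ pencilLevel A B b = k := by
  obtain ⟨c, hc, hc1, hc2, hc3⟩ := exists_right_between (k := k)
    (A := B.image Neg.neg) (B := A.image Neg.neg)
    ((Finset.disjoint_image neg_injective).2 hAB.symm) (Finset.mem_image_of_mem _ h₂)
    (Finset.mem_image_of_mem _ h₁) (neg_lt_neg hlt) (by rwa [pencilLevel_image_neg])
    (by rwa [pencilLevel_image_neg])
  obtain ⟨b, hb, rfl⟩ := Finset.mem_image.1 hc
  rw [pencilLevel_image_neg] at hc3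
  exact ⟨b, hb, neg_lt_neg_iff.1 hc2, neg_lt_neg_iff.1 hc1, hc3⟩

/-- The slopes from `v` to the points of `P` on its right. -/
noncomputable def rightSlopes (P : Finset (ℝ × ℝ)) (v : ℝ × ℝ) : Finset ℝ :=
  (P.filter fun p => v.1 < p.1).image (lineSlope v)

/-- The slopes from `v` to the points of `P` on its left. -/
noncomputable def leftSlopes (P : Finset (ℝ × ℝ)) (v : ℝ × ℝ) : Finset ℝ :=
  (P.filter fun p => p.1 < v.1).image (lineSlope v)

theorem mem_rightSlopes {P : Finset (ℝ × ℝ)} {v : ℝ × ℝ} {s : ℝ} :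
    s ∈ rightSlopes P v ↔ ∃ p ∈ P, v.1 < p.1 ∧ lineSlope v p = s := by
  simp [rightSlopes, and_assoc]

theorem mem_leftSlopes {P : Finset (ℝ × ℝ)} {v : ℝ × ℝ} {s : ℝ} :
    s ∈ leftSlopes P v ↔ ∃ p ∈ P, p.1 < v.1 ∧ lineSlope v p = s := by
  simp [leftSlopes, and_assoc]

theorem disjoint_rightSlopes_leftSlopes {P : Finset (ℝ × ℝ)} (hP : GeneralPosition_s19 P) {v : ℝ × ℝ}
    (hv : v ∈ P) : Disjoint (rightSlopes P v) (leftSlopes P v) := by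
  rw [Finset.disjoint_left]
  intro s h1 h2
  obtain ⟨p, hp, hp1, rfl⟩ := mem_rightSlopes.1 h1
  obtain ⟨q, hq, hq1, hqs⟩ := mem_leftSlopes.1 h2
  have := hP.eq_of_lineSlope_eq hv hq hp (fun h => hq1.ne (by rw [h])) (fun h => hp1.ne (by rw [h]))
    hqs
  rw [this] at hq1
  exact lt_asymm hp1 hq1

theorem belowCount_eq_card_filter (P : Finset (ℝ × ℝ)) (v q : ℝ × ℝ) :
    belowCount P v q = (P.filter fun p => p.2 < v.2 + lineSlope v q * (p.1 - v.1)).card := by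
  rw [belowCount, ← Set.ncard_coe_finset, Finset.coe_filter]
  rfl

theorem belowCount_eq_pencilLevel {P : Finset (ℝ × ℝ)} (hP : GeneralPosition_s19 P) {v : ℝ × ℝ}
    (hv : v ∈ P) (q : ℝ × ℝ) :
    belowCount P v q = pencilLevel (rightSlopes P v) (leftSlopes P v) (lineSlope v q) := by
  classical
  rw [belowCount_eq_card_filter]
  generalize lineSlope v q = s
  have inj : ∀ Q : Finset (ℝ × ℝ), Q ⊆ P → (∀ p ∈ Q, v ≠ p) → Set.InjOn (lineSlope v) Q :=
    fun Q hQ hne p hp r hr h =>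
      hP.eq_of_lineSlope_eq hv (hQ hp) (hQ hr) (hne p hp) (hne r hr) h
  rw [pencilLevel, rightSlopes, leftSlopes, Finset.filter_image, Finset.filter_image,
    Finset.card_image_of_injOn, Finset.card_image_of_injOn, ← Finset.card_union_of_disjoint]
  · congr 1
    ext p
    simp only [Finset.mem_filter, Finset.mem_union]
    constructor
    · rintro ⟨hp, h⟩
      rcases lt_trichotomy p.1 v.1 with hlt | heq | hlt
      · refine Or.inr ⟨⟨hp, hlt⟩, ?_⟩
        have := lineSlope_mul hlt.ne'
        by_contra! hc
        nlinarith
      · rw [hP.eq_of_fst p hp v hv heq] at h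
        simp at h
      · refine Or.inl ⟨⟨hp, hlt⟩, ?_⟩
        have := lineSlope_mul hlt.ne
        by_contra! hc
        nlinarith
    · rintro (⟨⟨hp, hlt⟩, h⟩ | ⟨⟨hp, hlt⟩, h⟩)
      · have := lineSlope_mul hlt.ne
        exact ⟨hp, by nlinarith⟩
      · have := lineSlope_mul hlt.ne'
        exact ⟨hp, by nlinarith⟩
  · rw [Finset.disjoint_left]
    intro p h1 h2
    simp only [Finset.mem_filter] at h1 h2
    exact lt_asymm h1.1.2 h2.1.2
  · refine inj _ (fun p hp => (Finset.mem_filter.1 (Finset.mem_filter.1 hp).1).1) fun p hp h => ?_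
    exact (Finset.mem_filter.1 (Finset.mem_filter.1 hp).1).2.ne (by rw [h])
  · refine inj _ (fun p hp => (Finset.mem_filter.1 (Finset.mem_filter.1 hp).1).1) fun p hp h => ?_
    exact (Finset.mem_filter.1 (Finset.mem_filter.1 hp).1).2.ne (by rw [h])

theorem belowCount_comm {P : Finset (ℝ × ℝ)} {u v : ℝ × ℝ} (h : u.1 ≠ v.1) :
    belowCount P u v = belowCount P v u := by
  simp only [belowCount_eq_card_filter]
  congr 1
  refine Finset.filter_congr fun p _ => ?_
  have := lineSlope_mul h
  rw [lineSlope_comm v u]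
  constructor <;> intro <;> linarith

/-- At most `n (k + 1)` pairs of points span a line with at most `k` points below it. -/
theorem card_pairs_belowCount_le {P : Finset (ℝ × ℝ)} (hP : GeneralPosition_s19 P) (k : ℕ) :
    ((P ×ˢ P).filter fun q => q.1.1 < q.2.1 ∧ belowCount P q.1 q.2 ≤ k).card ≤
      P.card * (k + 1) := by
  classical
  rw [mul_comm]
  refine Finset.card_le_mul_card_image_of_maps_to (f := Prod.snd) (t := P)
    (fun q hq => (Finset.mem_product.1 (Finset.mem_filter.1 hq).1).2) _ fun v hv => ?_
  set U := P.filter fun u => u.1 < v.1 ∧ belowCount P u v ≤ k with hU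
  have hle : (((P ×ˢ P).filter fun q => q.1.1 < q.2.1 ∧ belowCount P q.1 q.2 ≤ k).filter
      fun q => q.2 = v).card ≤ U.card := by
    refine Finset.card_le_card_of_injOn Prod.fst (fun q hq => ?_) fun q hq r hr h => ?_
    · rw [Finset.mem_coe, Finset.mem_filter, Finset.mem_filter, Finset.mem_product] at hq
      obtain ⟨⟨⟨h1, -⟩, h2, h3⟩, rfl⟩ := hq
      simp [hU, h1, h2, h3]
    · exact Prod.ext h ((Finset.mem_filter.1 hq).2.trans (Finset.mem_filter.1 hr).2.symm)
  refine hle.trans ?_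
  rcases U.eq_empty_or_nonempty with h0 | hne
  · simp [h0]
  obtain ⟨u, hu, hmin⟩ := Finset.exists_min_image U (fun u => lineSlope v u) hne
  obtain ⟨huP, huv, huk⟩ := Finset.mem_filter.1 hu
  rw [← Finset.card_erase_add_one hu]
  refine Nat.succ_le_succ (le_trans ?_ huk)
  rw [belowCount_comm huv.ne, belowCount_eq_card_filter]
  refine Finset.card_le_card fun w hw => ?_
  rw [Finset.mem_erase] at hw
  obtain ⟨hwP, hwv, -⟩ := Finset.mem_filter.1 hw.2
  refine Finset.mem_filter.2 ⟨hwP, ?_⟩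
  have hlt : lineSlope v u < lineSlope v w := lt_of_le_of_ne (hmin w hw.2) fun h =>
    hw.1 (hP.eq_of_lineSlope_eq hv hwP huP (fun h => hwv.ne (by rw [h])) (fun h => huv.ne (by rw [h]))
      h.symm)
  have := lineSlope_mul hwv.ne'
  nlinarith

/-- `e` is a left-to-right segment between points of `P` with exactly `k` points below its line. -/
def IsLevelEdge (P : Finset (ℝ × ℝ)) (k : ℕ) (e : (ℝ × ℝ) × (ℝ × ℝ)) : Prop :=
  e.1 ∈ P ∧ e.2 ∈ P ∧ e.1.1 < e.2.1 ∧ belowCount P e.1 e.2 = k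

/-- `e` ends at `v`, and is the last level-`k` edge met by a line rotating about `v` before it
reaches slope `s`. -/
def IsLastBefore (P : Finset (ℝ × ℝ)) (k : ℕ) (v : ℝ × ℝ) (s : ℝ) (e : (ℝ × ℝ) × (ℝ × ℝ)) : Prop :=
  IsLevelEdge P k e ∧ e.2 = v ∧ lineSlope e.1 e.2 < s ∧
    ∀ p ∈ P, p ≠ v → lineSlope e.1 e.2 < lineSlope v p → lineSlope v p < s → belowCount P v p ≠ k

/-- `f` starts at `u`, and is the first level-`k` edge met by a line rotating about `u` after it
leaves slope `s`. -/
def IsFirstAfter (P : Finset (ℝ × ℝ)) (k : ℕ) (u : ℝ × ℝ) (s : ℝ) (f : (ℝ × ℝ) × (ℝ × ℝ)) : Prop :=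
  IsLevelEdge P k f ∧ f.1 = u ∧ s < lineSlope f.1 f.2 ∧
    ∀ p ∈ P, p ≠ u → s < lineSlope u p → lineSlope u p < lineSlope f.1 f.2 → belowCount P u p ≠ k

/-- `e'` follows `e` in a convex chain of level-`k` edges. -/
def IsNextEdge (P : Finset (ℝ × ℝ)) (k : ℕ) (e e' : (ℝ × ℝ) × (ℝ × ℝ)) : Prop :=
  IsLevelEdge P k e ∧ IsFirstAfter P k e.2 (lineSlope e.1 e.2) e'

section Chains

variable {P : Finset (ℝ × ℝ)} {k : ℕ} {e e' f f' : (ℝ × ℝ) × (ℝ × ℝ)} {u v : ℝ × ℝ} {s : ℝ}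

theorem IsLevelEdge.left_ne_right (h : IsLevelEdge P k e) : e.1 ≠ e.2 :=
  fun h' => h.2.2.1.ne (by rw [h'])

theorem IsLevelEdge.belowCount_right_left (h : IsLevelEdge P k e) : belowCount P e.2 e.1 = k := by
  rw [← belowCount_comm h.2.2.1.ne, h.2.2.2]

theorem IsNextEdge.isLastBefore (h : IsNextEdge P k e e') :
    IsLastBefore P k e'.1 (lineSlope e'.1 e'.2) e :=
  ⟨h.1, h.2.2.1.symm, h.2.2.2.1, by
    have := h.2.2.2.2
    simp only [h.2.2.1] at this ⊢
    exact this⟩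

theorem IsLastBefore.eq (hP : GeneralPosition_s19 P) (h : IsLastBefore P k v s e)
    (h' : IsLastBefore P k v s e') : e = e' := by
  obtain ⟨he, rfl, hs, hn⟩ := h
  obtain ⟨he', hv, hs', hn'⟩ := h'
  have c' : lineSlope e.2 e'.1 = lineSlope e'.1 e'.2 := by rw [← hv, lineSlope_comm]
  rcases lt_trichotomy (lineSlope e.1 e.2) (lineSlope e'.1 e'.2) with hl | hl | hl
  · refine absurd ?_ (hn e'.1 he'.1 (hv ▸ he'.left_ne_right) (c' ▸ hl) (c' ▸ hs'))
    rw [← hv, he'.belowCount_right_left]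
  · refine Prod.ext ?_ hv.symm
    exact hP.eq_of_lineSlope_eq he.2.1 he.1 he'.1 he.left_ne_right.symm
      (hv ▸ he'.left_ne_right.symm) (by rw [c', ← hl, lineSlope_comm])
  · have c := lineSlope_comm e.2 e.1
    exact absurd he.belowCount_right_left
      (hn' e.1 he.1 he.left_ne_right (c ▸ hl) (c ▸ hs))

theorem IsFirstAfter.eq (hP : GeneralPosition_s19 P) (h : IsFirstAfter P k u s f)
    (h' : IsFirstAfter P k u s f') : f = f' := by
  obtain ⟨hf, rfl, hs, hn⟩ := h
  obtain ⟨hf', hu, hs', hn'⟩ := h'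
  have c' : lineSlope f.1 f'.2 = lineSlope f'.1 f'.2 := by rw [hu]
  rcases lt_trichotomy (lineSlope f.1 f.2) (lineSlope f'.1 f'.2) with hl | hl | hl
  · exact absurd hf.2.2.2 (hn' f.2 hf.2.1 hf.left_ne_right.symm hs hl)
  · refine Prod.ext hu.symm ?_
    exact hP.eq_of_lineSlope_eq hf.1 hf.2.1 hf'.2.1 hf.left_ne_right
      (hu ▸ hf'.left_ne_right) (by rw [c', ← hl])
  · refine absurd ?_ (hn f'.2 hf'.2.1 (hu ▸ hf'.left_ne_right.symm) (c' ▸ hs') (c' ▸ hl))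
    rw [← hu, hf'.2.2.2]

theorem IsNextEdge.right_unique (hP : GeneralPosition_s19 P) :
    Relator.RightUnique (IsNextEdge P k) :=
  fun _ _ _ h h' => h.2.eq hP h'.2

theorem IsNextEdge.left_unique (hP : GeneralPosition_s19 P) :
    Relator.RightUnique (Function.swap (IsNextEdge P k)) :=
  fun _ _ _ h h' => h.isLastBefore.eq hP h'.isLastBefore

/-- A chain of level-`k` edges continues to the right at slope less than `s`, unless the line of
slope `s` through the end of the chain supports it. -/
theorem exists_isNextEdge_of_not_isLastBefore (hP : GeneralPosition_s19 P) (he : IsLevelEdge P k e)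
    (hs : lineSlope e.1 e.2 < s) (h : ¬ IsLastBefore P k e.2 s e) :
    ∃ e', IsNextEdge P k e e' ∧ lineSlope e'.1 e'.2 < s := by
  classical
  have hne : (P.filter fun p => p ≠ e.2 ∧ lineSlope e.1 e.2 < lineSlope e.2 p ∧
      lineSlope e.2 p < s ∧ belowCount P e.2 p = k).Nonempty := by
    by_contra! hc
    refine h ⟨he, rfl, hs, fun p hp h1 h2 h3 h4 => ?_⟩
    exact Finset.notMem_empty p (hc ▸ Finset.mem_filter.2 ⟨hp, h1, h2, h3, h4⟩)
  obtain ⟨p, hp, hmin⟩ := Finset.exists_min_image _ (lineSlope e.2) hne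
  obtain ⟨hpP, hpe, hp1, hp2, hpk⟩ := Finset.mem_filter.1 hp
  have hmin' : ∀ q ∈ P, q ≠ e.2 → lineSlope e.1 e.2 < lineSlope e.2 q →
      lineSlope e.2 q < lineSlope e.2 p → belowCount P e.2 q ≠ k := fun q hq h1 h2 h3 h4 =>
    absurd (hmin q (Finset.mem_filter.2 ⟨hq, h1, h2, h3.trans hp2, h4⟩)) (not_le.2 h3)
  rcases lt_trichotomy e.2.1 p.1 with hlt | heq | hlt
  · exact ⟨(e.2, p), ⟨he, ⟨he.2.1, hpP, hlt, hpk⟩, rfl, hp1, hmin'⟩, hp2⟩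
  · exact absurd (hP.eq_of_fst _ he.2.1 _ hpP heq).symm hpe
  · exfalso
    rw [belowCount_eq_pencilLevel hP he.2.1] at hpk
    have hek := he.belowCount_right_left
    rw [belowCount_eq_pencilLevel hP he.2.1] at hek
    obtain ⟨a, ha, ha1, ha2, ha3⟩ := exists_right_between
      (disjoint_rightSlopes_leftSlopes hP he.2.1)
      (mem_leftSlopes.2 ⟨e.1, he.1, he.2.2.1, rfl⟩) (mem_leftSlopes.2 ⟨p, hpP, hlt, rfl⟩)
      (by rwa [lineSlope_comm e.2 e.1]) hek hpk
    obtain ⟨q, hq, hqe, rfl⟩ := mem_rightSlopes.1 ha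
    rw [lineSlope_comm e.2 e.1] at ha1
    refine hmin' q hq (fun h => hqe.ne (by rw [h])) ha1 ha2 ?_
    rw [belowCount_eq_pencilLevel hP he.2.1, ha3]

/-- A chain of level-`k` edges continues to the left at slope greater than `s`, unless the line of
slope `s` through the start of the chain supports it. -/
theorem exists_isNextEdge_of_not_isFirstAfter (hP : GeneralPosition_s19 P) (hf : IsLevelEdge P k f)
    (hs : s < lineSlope f.1 f.2) (h : ¬ IsFirstAfter P k f.1 s f) :
    ∃ f', IsNextEdge P k f' f ∧ s < lineSlope f'.1 f'.2 := by
  classical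
  have hne : (P.filter fun p => p ≠ f.1 ∧ s < lineSlope f.1 p ∧
      lineSlope f.1 p < lineSlope f.1 f.2 ∧ belowCount P f.1 p = k).Nonempty := by
    by_contra! hc
    refine h ⟨hf, rfl, hs, fun p hp h1 h2 h3 h4 => ?_⟩
    exact Finset.notMem_empty p (hc ▸ Finset.mem_filter.2 ⟨hp, h1, h2, h3, h4⟩)
  obtain ⟨p, hp, hmax⟩ := Finset.exists_max_image _ (lineSlope f.1) hne
  obtain ⟨hpP, hpf, hp1, hp2, hpk⟩ := Finset.mem_filter.1 hp
  have hmax' : ∀ q ∈ P, q ≠ f.1 → lineSlope f.1 p < lineSlope f.1 q →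
      lineSlope f.1 q < lineSlope f.1 f.2 → belowCount P f.1 q ≠ k := fun q hq h1 h2 h3 h4 =>
    absurd (hmax q (Finset.mem_filter.2 ⟨hq, h1, hp1.trans h2, h3, h4⟩)) (not_le.2 h2)
  rcases lt_trichotomy p.1 f.1.1 with hlt | heq | hlt
  · have c := lineSlope_comm f.1 p
    refine ⟨(p, f.1), ⟨⟨hpP, hf.1, hlt, ?_⟩, hf, rfl, c ▸ hp2, ?_⟩, c ▸ hp1⟩
    · rw [← hpk, belowCount_comm hlt.ne]
    · rw [c] at hmax'
      exact hmax'
  · exact absurd (hP.eq_of_fst _ hpP _ hf.1 heq) hpf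
  · exfalso
    rw [belowCount_eq_pencilLevel hP hf.1] at hpk
    have hfk := hf.2.2.2
    rw [belowCount_eq_pencilLevel hP hf.1] at hfk
    obtain ⟨b, hb, hb1, hb2, hb3⟩ := exists_left_between
      (disjoint_rightSlopes_leftSlopes hP hf.1)
      (mem_rightSlopes.2 ⟨p, hpP, hlt, rfl⟩) (mem_rightSlopes.2 ⟨f.2, hf.2.1, hf.2.2.1, rfl⟩)
      hp2 hpk hfk
    obtain ⟨q, hq, hqf, rfl⟩ := mem_leftSlopes.1 hb
    refine hmax' q hq (fun h => hqf.ne (by rw [h])) hb1 hb2 ?_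
    rw [belowCount_eq_pencilLevel hP hf.1, hb3]

theorem IsLastBefore.belowCount_le (hP : GeneralPosition_s19 P)
    (h : IsLastBefore P k v (lineSlope v u) e) : belowCount P v u ≤ k := by
  obtain ⟨he, rfl, hs, hn⟩ := h
  have hek := he.belowCount_right_left
  rw [belowCount_eq_pencilLevel hP he.2.1] at hek
  rw [lineSlope_comm e.1 e.2] at hs hn
  rw [belowCount_eq_pencilLevel hP he.2.1]
  refine le_trans ?_ (pencilLevel_le_of_forall_ne (rightSlopes P e.2) (leftSlopes P e.2) k hs ?_ ?_)
  · refine Nat.add_le_add_left (Finset.card_le_card fun x hx => ?_) _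
    rw [Finset.mem_filter] at hx ⊢
    exact ⟨hx.1, hx.2.le⟩
  · rw [card_filter_le_eq_of_notMem]
    · exact hek.le
    · exact Finset.disjoint_right.1 (disjoint_rightSlopes_leftSlopes hP he.2.1)
        (mem_leftSlopes.2 ⟨e.1, he.1, he.2.2.1, rfl⟩)
  · intro a ha h1 h2
    obtain ⟨q, hq, hqe, rfl⟩ := mem_rightSlopes.1 ha
    rw [← belowCount_eq_pencilLevel hP he.2.1]
    exact hn q hq (fun h => hqe.ne (by rw [h])) h1 h2

theorem IsLevelEdge.of_chain (he : IsLevelEdge P k e)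
    (h : Relation.ReflTransGen (IsNextEdge P k) e e') : IsLevelEdge P k e' := by
  cases h with
  | refl => exact he
  | tail _ h => exact h.2.1

theorem IsLevelEdge.of_chain_left (hf : IsLevelEdge P k f)
    (h : Relation.ReflTransGen (IsNextEdge P k) f' f) : IsLevelEdge P k f' := by
  rcases Relation.ReflTransGen.cases_head h with rfl | ⟨c, h, -⟩
  · exact hf
  · exact h.1

theorem lineSlope_le_of_chain (h : Relation.ReflTransGen (IsNextEdge P k) e e') :
    lineSlope e.1 e.2 ≤ lineSlope e'.1 e'.2 := by
  induction h with
  | refl => exact le_rfl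
  | tail _ h ih => exact ih.trans h.2.2.2.1.le

/-- A chain whose slopes are all less than `s` descends with respect to lines of slope `s`. -/
theorem chain_descends (h : Relation.ReflTransGen (IsNextEdge P k) e e')
    (hs : lineSlope e'.1 e'.2 < s) :
    e = e' ∨ e.2.1 ≤ e'.1.1 ∧ e'.1.2 - s * e'.1.1 ≤ e.2.2 - s * e.2.1 := by
  induction h with
  | refl => exact Or.inl rfl
  | @tail m e' hm h ih =>
    right
    have hlt : lineSlope m.1 m.2 < s := h.2.2.2.1.trans hs
    rw [h.2.2.1]
    rcases ih hlt with rfl | ⟨h1, h2⟩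
    · exact ⟨le_rfl, le_rfl⟩
    · have h3 := h.1.2.2.1
      have h4 := lineSlope_mul h3.ne
      exact ⟨by linarith, by nlinarith⟩

/-- A chain whose slopes are all greater than `s` ascends with respect to lines of slope `s`. -/
theorem chain_ascends (h : Relation.ReflTransGen (IsNextEdge P k) e e')
    (hs : s < lineSlope e.1 e.2) :
    e = e' ∨ e.2.1 ≤ e'.1.1 ∧ e.2.2 - s * e.2.1 ≤ e'.1.2 - s * e'.1.1 := by
  induction h with
  | refl => exact Or.inl rfl
  | @tail m e' hm h ih =>
    right
    have hlt : s < lineSlope m.1 m.2 := hs.trans_le (lineSlope_le_of_chain hm)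
    rw [h.2.2.1]
    rcases ih with rfl | ⟨h1, h2⟩
    · exact ⟨le_rfl, le_rfl⟩
    · have h3 := h.1.2.2.1
      have h4 := lineSlope_mul h3.ne
      exact ⟨by linarith, by nlinarith⟩

end Chains

theorem lineSlope_between {u v w : ℝ × ℝ} (huv : u.1 < v.1) (hvw : v.1 < w.1)
    (h : lineSlope v w < lineSlope u v) :
    lineSlope v w < lineSlope u w ∧ lineSlope u w < lineSlope u v := by
  have h1 := lineSlope_mul huv.ne
  have h2 := lineSlope_mul hvw.ne
  have h3 := lineSlope_mul (huv.trans hvw).ne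
  constructor <;> by_contra! hc <;> nlinarith

/-- Following the chains of two crossing edges leads to a common tangent of the two chains. -/
theorem exists_tangent_of_crosses {P : Finset (ℝ × ℝ)} (hP : GeneralPosition_s19 P) {i j : ℕ}
    {e f : (ℝ × ℝ) × (ℝ × ℝ)} (he : IsLevelEdge P i e) (hf : IsLevelEdge P j f)
    (hcr : Crosses e f) :
    ∃ e' f', Relation.ReflTransGen (IsNextEdge P i) e e' ∧
      Relation.ReflTransGen (IsNextEdge P j) f' f ∧ f'.1.1 < e'.2.1 ∧
      IsLastBefore P i e'.2 (lineSlope f'.1 e'.2) e' ∧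
      IsFirstAfter P j f'.1 (lineSlope f'.1 e'.2) f' := by
  classical
  obtain ⟨hs, t, h1, h2, h3, h4, ht⟩ := hcr
  have s1 : lineSlope f.1 (t, lineAt e t) = lineSlope f.1 f.2 := by
    have := lineSlope_mul (u := f.1) (v := (t, lineAt e t)) h3.ne
    have a := lineAt_sub f f.1.1 t
    rw [lineAt_left, ← ht] at a
    exact mul_right_cancel₀ (sub_pos.2 h3).ne' (this.trans a)
  have s2 : lineSlope (t, lineAt e t) e.2 = lineSlope e.1 e.2 := by
    have := lineSlope_mul (u := (t, lineAt e t)) (v := e.2) h2.ne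
    have a := lineAt_sub e t e.2.1
    rw [lineAt_right (h1.trans h2).ne] at a
    exact mul_right_cancel₀ (sub_pos.2 h2).ne' (this.trans a)
  have h0 := lineSlope_between (u := f.1) (v := (t, lineAt e t)) (w := e.2) h3 h2
    (by rw [s1, s2]; exact hs)
  rw [s1, s2] at h0
  obtain ⟨z, hz, hmax⟩ := Finset.exists_max_image
    (((P ×ˢ P) ×ˢ (P ×ˢ P)).filter fun z : ((ℝ × ℝ) × (ℝ × ℝ)) × ((ℝ × ℝ) × (ℝ × ℝ)) =>
      Relation.ReflTransGen (IsNextEdge P i) e z.1 ∧ Relation.ReflTransGen (IsNextEdge P j) z.2 f ∧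
        z.2.1.1 < z.1.2.1 ∧ lineSlope z.1.1 z.1.2 < lineSlope z.2.1 z.1.2 ∧
        lineSlope z.2.1 z.1.2 < lineSlope z.2.1 z.2.2)
    (fun z => z.1.2.1 - z.2.1.1)
    ⟨(e, f), by
      simp only [Finset.mem_filter, Finset.mem_product]
      exact ⟨⟨⟨he.1, he.2.1⟩, hf.1, hf.2.1⟩, .refl, .refl, h3.trans h2, h0⟩⟩
  obtain ⟨e', f'⟩ := z
  simp only [Finset.mem_filter, Finset.mem_product, and_imp, Prod.forall] at hz hmax
  obtain ⟨-, hee, hff, hlt, hse, hsf⟩ := hz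
  have he' := he.of_chain hee
  have hf' := hf.of_chain_left hff
  refine ⟨e', f', hee, hff, hlt, ?_, ?_⟩
  · by_contra hc
    obtain ⟨g, hg, hgs⟩ := exists_isNextEdge_of_not_isLastBefore hP he' hse hc
    have hgl := hg.2.1
    have hg1 : g.1 = e'.2 := hg.2.2.1
    have hg12 : e'.2.1 < g.2.1 := hg1 ▸ hgl.2.2.1
    have hb := lineSlope_between hlt hg12 (by rw [hg1] at hgs; exact hgs)
    have := hmax g.1.1 g.1.2 g.2.1 g.2.2 f'.1.1 f'.1.2 f'.2.1 f'.2.2 hgl.1 hgl.2.1 hf'.1 hf'.2.1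
      (hee.tail hg) hff (hlt.trans hg12) (by
        have := hb.1
        rw [← hg1] at this
        exact this) (hb.2.trans hsf)
    linarith
  · by_contra hc
    obtain ⟨g, hg, hgs⟩ := exists_isNextEdge_of_not_isFirstAfter hP hf' hsf hc
    have hgl := hg.1
    have hg2 : f'.1 = g.2 := hg.2.2.1
    have hg12 : g.1.1 < f'.1.1 := hg2 ▸ hgl.2.2.1
    have hb := lineSlope_between hg12 hlt (by rw [hg2] at hgs ⊢; exact hgs)
    have := hmax e'.1.1 e'.1.2 e'.2.1 e'.2.2 g.1.1 g.1.2 g.2.1 g.2.2 he'.1 he'.2.1 hgl.1 hgl.2.1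
      hee (.head hg hff) (hg12.trans hlt) (hse.trans hb.1) (by
        have := hb.2
        rw [hg2] at this
        exact this)
    linarith

/-- A common tangent of two chains determines the crossing it was obtained from. -/
theorem eq_of_chains_of_crosses {P : Finset (ℝ × ℝ)} {i j : ℕ} {s : ℝ}
    {e₁ e₂ f₁ f₂ : (ℝ × ℝ) × (ℝ × ℝ)} (h₁ : Crosses e₁ f₁) (h₂ : Crosses e₂ f₂)
    (he : Relation.ReflTransGen (IsNextEdge P i) e₁ e₂ ∨
      Relation.ReflTransGen (IsNextEdge P i) e₂ e₁)
    (hf : Relation.ReflTransGen (IsNextEdge P j) f₁ f₂ ∨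
      Relation.ReflTransGen (IsNextEdge P j) f₂ f₁)
    (hse₁ : lineSlope e₁.1 e₁.2 < s) (hse₂ : lineSlope e₂.1 e₂.2 < s)
    (hsf₁ : s < lineSlope f₁.1 f₁.2) (hsf₂ : s < lineSlope f₂.1 f₂.2) :
    e₁ = e₂ ∧ f₁ = f₂ := by
  obtain ⟨-, t₁, a1, a2, a3, a4, a5⟩ := h₁
  obtain ⟨-, t₂, b1, b2, b3, b4, b5⟩ := h₂
  have low : ∀ g : (ℝ × ℝ) × (ℝ × ℝ), lineSlope g.1 g.2 < s → ∀ x y, x < y →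
      lineAt g y - s * y < lineAt g x - s * x := fun g hg x y hxy => by
    have := lineAt_sub g x y
    nlinarith
  have high : ∀ g : (ℝ × ℝ) × (ℝ × ℝ), s < lineSlope g.1 g.2 → ∀ x y, x < y →
      lineAt g x - s * x < lineAt g y - s * y := fun g hg x y hxy => by
    have := lineAt_sub g x y
    nlinarith
  have le1 := low e₁ hse₁ _ _ a1
  have le2 := low e₁ hse₁ _ _ a2
  have le3 := low e₂ hse₂ _ _ b1
  have le4 := low e₂ hse₂ _ _ b2
  have lf1 := high f₁ hsf₁ _ _ a3
  have lf2 := high f₁ hsf₁ _ _ a4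
  have lf3 := high f₂ hsf₂ _ _ b3
  have lf4 := high f₂ hsf₂ _ _ b4
  rw [lineAt_left] at le1 le3 lf1 lf3
  rw [lineAt_right (a1.trans a2).ne] at le2
  rw [lineAt_right (b1.trans b2).ne] at le4
  rw [lineAt_right (a3.trans a4).ne] at lf2
  rw [lineAt_right (b3.trans b4).ne] at lf4
  have E : e₁ = e₂ ∨ (t₁ < t₂ ∧ lineAt e₂ t₂ - s * t₂ < lineAt e₁ t₁ - s * t₁) ∨
      (t₂ < t₁ ∧ lineAt e₁ t₁ - s * t₁ < lineAt e₂ t₂ - s * t₂) := by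
    rcases he with h | h
    · rcases chain_descends h hse₂ with h | ⟨h, h'⟩
      · exact Or.inl h
      · exact Or.inr (Or.inl ⟨by linarith, by linarith⟩)
    · rcases chain_descends h hse₁ with h | ⟨h, h'⟩
      · exact Or.inl h.symm
      · exact Or.inr (Or.inr ⟨by linarith, by linarith⟩)
  have F : f₁ = f₂ ∨ (t₁ < t₂ ∧ lineAt f₁ t₁ - s * t₁ < lineAt f₂ t₂ - s * t₂) ∨
      (t₂ < t₁ ∧ lineAt f₂ t₂ - s * t₂ < lineAt f₁ t₁ - s * t₁) := by
    rcases hf with h | h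
    · rcases chain_ascends h hsf₁ with h | ⟨h, h'⟩
      · exact Or.inl h
      · exact Or.inr (Or.inl ⟨by linarith, by linarith⟩)
    · rcases chain_ascends h hsf₂ with h | ⟨h, h'⟩
      · exact Or.inl h.symm
      · exact Or.inr (Or.inr ⟨by linarith, by linarith⟩)
  rcases E with rfl | ⟨E1, E2⟩ | ⟨E1, E2⟩ <;> rcases F with rfl | ⟨F1, F2⟩ | ⟨F1, F2⟩
  · exact ⟨rfl, rfl⟩
  · have := low e₁ hse₁ _ _ F1
    linarith
  · have := low e₁ hse₁ _ _ F1
    linarith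
  · have := high f₁ hsf₁ _ _ E1
    linarith
  · linarith
  · linarith
  · have := high f₁ hsf₁ _ _ E1
    linarith
  · linarith
  · linarith

/-- The number of crossings among edges whose levels lie in `[x, x + y]`. -/
theorem card_crossingPairs_le {P : Finset (ℝ × ℝ)} (hP : GeneralPosition_s19 P) {x y : ℕ}
    {G : Finset ((ℝ × ℝ) × (ℝ × ℝ))}
    (hG : ∀ e ∈ G, ∃ k ∈ Finset.Icc x (x + y), IsLevelEdge P k e) :
    (crossingPairs G).card ≤ P.card * (x + y + 1) * ((y + 1) * (y + 1)) := by
  classical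
  have key : ∀ z : crossingPairs G, ∃ i ∈ Finset.Icc x (x + y), ∃ j ∈ Finset.Icc x (x + y),
      ∃ e' f', Relation.ReflTransGen (IsNextEdge P i) z.1.1 e' ∧
        Relation.ReflTransGen (IsNextEdge P j) f' z.1.2 ∧
        f'.1 ∈ P ∧ e'.2 ∈ P ∧ f'.1.1 < e'.2.1 ∧ belowCount P f'.1 e'.2 ≤ x + y ∧
        IsLastBefore P i e'.2 (lineSlope f'.1 e'.2) e' ∧
        IsFirstAfter P j f'.1 (lineSlope f'.1 e'.2) f' := by
    rintro ⟨⟨e, f⟩, hz⟩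
    obtain ⟨⟨heG, hfG⟩, hcr⟩ := mem_crossingPairs.1 hz
    obtain ⟨i, hi, he⟩ := hG e heG
    obtain ⟨j, hj, hf⟩ := hG f hfG
    obtain ⟨e', f', h1, h2, h3, h4, h5⟩ := exists_tangent_of_crosses hP he hf hcr
    refine ⟨i, hi, j, hj, e', f', h1, h2, h5.1.1, h4.1.2.1, h3, ?_, h4, h5⟩
    rw [belowCount_comm h3.ne]
    rw [lineSlope_comm] at h4
    exact (h4.belowCount_le hP).trans (Finset.mem_Icc.1 hi).2
  choose i hi j hj e' f' h1 h2 hu hv h3 hk h4 h5 using key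
  have hcard : (crossingPairs G).card ≤
      (((P ×ˢ P).filter fun q => q.1.1 < q.2.1 ∧ belowCount P q.1 q.2 ≤ x + y) ×ˢ
        (Finset.Icc x (x + y) ×ˢ Finset.Icc x (x + y))).card := by
    rw [← Finset.card_attach]
    refine Finset.card_le_card_of_injOn (fun z => (((f' z).1, (e' z).2), (i z, j z)))
      (fun z _ => ?_) fun z _ w _ h => ?_
    · simp only [Finset.coe_product, Set.mem_prod, Finset.mem_coe, Finset.mem_filter,
        Finset.mem_product]
      exact ⟨⟨⟨hu z, hv z⟩, h3 z, hk z⟩, hi z, hj z⟩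
    · simp only [Prod.mk.injEq] at h
      obtain ⟨⟨hf, he⟩, hij, hji⟩ := h
      have h4w := h4 w
      have h5w := h5 w
      have h1w := h1 w
      have h2w := h2 w
      rw [← hf, ← he, ← hij] at h4w
      rw [← hf, ← he, ← hji] at h5w
      rw [← hij, ← (h4 z).eq hP h4w] at h1w
      rw [← hji, ← (h5 z).eq hP h5w] at h2w
      have hE := (Relation.ReflTransGen.total_of_right_unique
        (IsNextEdge.left_unique hP) (Relation.reflTransGen_swap.2 (h1 z))
        (Relation.reflTransGen_swap.2 h1w)).imp Relation.reflTransGen_swap.1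
        Relation.reflTransGen_swap.1
      have hF := Relation.ReflTransGen.total_of_right_unique
        (IsNextEdge.right_unique hP) (h2 z) h2w
      obtain ⟨hz, hz'⟩ := eq_of_chains_of_crosses (mem_crossingPairs.1 z.2).2
        (mem_crossingPairs.1 w.2).2 hE.symm hF
        ((lineSlope_le_of_chain (h1 z)).trans_lt (h4 z).2.2.1)
        ((lineSlope_le_of_chain h1w).trans_lt (h4 z).2.2.1)
        ((h5 z).2.2.1.trans_le (lineSlope_le_of_chain (h2 z)))
        ((h5 z).2.2.1.trans_le (lineSlope_le_of_chain h2w))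
      exact Subtype.ext (Prod.ext hz hz')
  refine hcard.trans ?_
  have hI : (Finset.Icc x (x + y)).card = y + 1 := by
    rw [Nat.card_Icc]; omega
  rw [Finset.card_product, Finset.card_product, hI]
  exact Nat.mul_le_mul_right _ (card_pairs_belowCount_le hP (x + y))

/-- Distinct `x`-coordinates and the absence of collinear triples give general position. -/
theorem generalPosition_of_not_collinear {P : Finset (ℝ × ℝ)}
    (h₁ : ∀ u ∈ P, ∀ v ∈ P, u ≠ v → u.1 ≠ v.1)
    (h₂ : ∀ u ∈ P, ∀ v ∈ P, ∀ w ∈ P, u ≠ v → u ≠ w → v ≠ w →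
      ¬ Collinear ℝ ({u, v, w} : Set (ℝ × ℝ))) : GeneralPosition_s19 P := by
  refine ⟨fun u hu v hv h => by_contra fun hne => h₁ u hu v hv hne h,
    fun u hu v hv w hw huv huw hvw h => h₂ u hu v hv w hw huv huw hvw ?_⟩
  rw [collinear_iff_of_mem (p₀ := u) (by simp)]
  refine ⟨(1, lineSlope u v), fun p hp => ⟨p.1 - u.1, ?_⟩⟩
  have hs := lineSlope_mul (h₁ u hu v hv huv)
  simp only [lineAt] at h
  simp only [Set.mem_insert_iff, Set.mem_singleton_iff] at hp
  rcases hp with rfl | rfl | rfl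
  · simp
  · ext
    · simp
    · simp only [vadd_eq_add, Prod.snd_add, Prod.smul_snd, smul_eq_mul]
      linarith
  · ext
    · simp
    · simp only [vadd_eq_add, Prod.snd_add, Prod.smul_snd, smul_eq_mul]
      linarith

/-- For a planar point set in general position, the number of pairs of points
whose connecting line has between `x` and `x + y` points of `P` strictly below
it is at most `C·n·x^{1/3}·y^{2/3}`. -/
theorem count_pairs_with_level_in_range :
    ∃ C : ℝ, 0 < C ∧
      ∀ P : Finset (ℝ × ℝ),
        (∀ u ∈ P, ∀ v ∈ P, u ≠ v → u.1 ≠ v.1) →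
        (∀ u ∈ P, ∀ v ∈ P, ∀ w ∈ P, u ≠ v → u ≠ w → v ≠ w →
          ¬ Collinear ℝ ({u, v, w} : Set (ℝ × ℝ))) →
        ∀ x y : ℕ, 1 ≤ y → y ≤ x →
          (({q : (ℝ × ℝ) × (ℝ × ℝ) | q.1 ∈ P ∧ q.2 ∈ P ∧ q.1.1 < q.2.1 ∧
              x ≤ belowCount P q.1 q.2 ∧ belowCount P q.1 q.2 ≤ x + y}).ncard : ℝ)
            ≤ C * (P.card : ℝ) * (x : ℝ) ^ ((1 : ℝ) / 3) * (y : ℝ) ^ ((2 : ℝ) / 3) := by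
  classical
  refine ⟨10, by norm_num, fun P h₁ h₂ x y hy hyx => ?_⟩
  have hP := generalPosition_of_not_collinear h₁ h₂
  set G := (P ×ˢ P).filter fun q => q.1.1 < q.2.1 ∧ x ≤ belowCount P q.1 q.2 ∧
    belowCount P q.1 q.2 ≤ x + y with hGdef
  have hset : {q : (ℝ × ℝ) × (ℝ × ℝ) | q.1 ∈ P ∧ q.2 ∈ P ∧ q.1.1 < q.2.1 ∧
      x ≤ belowCount P q.1 q.2 ∧ belowCount P q.1 q.2 ≤ x + y} = ↑G := by
    ext q
    rw [Finset.mem_coe, hGdef, Finset.mem_filter, Finset.mem_product, and_assoc]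
    rfl
  rw [hset, Set.ncard_coe_finset]
  have hG : IsSegmentGraph P G := fun e he => by
    rw [hGdef, Finset.mem_filter, Finset.mem_product] at he
    exact ⟨he.1.1, he.1.2, he.2.1⟩
  have hcr := card_crossingPairs_le hP (x := x) (y := y) (G := G) fun e he => by
    rw [hGdef, Finset.mem_filter, Finset.mem_product] at he
    exact ⟨_, Finset.mem_Icc.2 he.2.2, he.1.1, he.1.2, he.2.1, rfl⟩
  have hy' : (1 : ℝ) ≤ y := by exact_mod_cast hy
  have hx' : (y : ℝ) ≤ x := by exact_mod_cast hyx
  have hn : (0 : ℝ) ≤ P.card := Nat.cast_nonneg _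
  rw [mul_assoc]
  set r : ℝ := (x : ℝ) ^ ((1 : ℝ) / 3) * (y : ℝ) ^ ((2 : ℝ) / 3) with hr
  have hr1 : 1 ≤ r := one_le_mul_of_one_le_of_one_le
    (Real.one_le_rpow (hy'.trans hx') (by norm_num)) (Real.one_le_rpow hy' (by norm_num))
  have hr3 : r ^ 3 = x * y ^ 2 := by
    rw [hr, mul_pow, ← Real.rpow_natCast, ← Real.rpow_natCast, ← Real.rpow_mul (by positivity),
      ← Real.rpow_mul (by positivity)]
    norm_num
  rcases le_total (6 * P.card) G.card with hm | hm
  · have hlem := card_pow_three_le hP hG hm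
    have hcr' : ((crossingPairs G).card : ℝ) ≤ P.card * (x + y + 1) * ((y + 1) * (y + 1)) := by
      exact_mod_cast hcr
    have hxy : ((x : ℝ) + y + 1) * ((y + 1) * (y + 1)) ≤ 3 * x * (2 * y * (2 * y)) := by
      gcongr <;> linarith
    rw [← pow_le_pow_iff_left₀ (Nat.cast_nonneg _) (by positivity) (three_ne_zero)]
    calc (G.card : ℝ) ^ 3 ≤ 72 * P.card ^ 2 * (crossingPairs G).card := hlem
      _ ≤ 72 * P.card ^ 2 * (P.card * (x + y + 1) * ((y + 1) * (y + 1))) := by gcongr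
      _ = 72 * P.card ^ 3 * ((x + y + 1) * ((y + 1) * (y + 1))) := by ring
      _ ≤ 72 * P.card ^ 3 * (3 * x * (2 * y * (2 * y))) := by gcongr
      _ = 864 * (P.card ^ 3 * r ^ 3) := by rw [hr3]; ring
      _ ≤ 1000 * (P.card ^ 3 * r ^ 3) := by gcongr; norm_num
      _ = (10 * P.card * r) ^ 3 := by ring
  · have hm' : (G.card : ℝ) ≤ 6 * P.card := by exact_mod_cast hm
    nlinarith
end
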